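/- arXiv:2305.19104 — 4 statements merged into one kernel-verified Lean document; each statement's English description precedes it below -/
import Mathlib

section
/- For every real ε > 0 and every function s : ℕ → ℕ such that s(n) ≥ 2 for all n and such that there exist C > 0 and n₁ with s(n) ≤ C·n^{1/2−ε} for all n ≥ n₁, there exist constants c₁, c₂, c₃, c₄ > 0, a threshold n₀, and a family (G_n) of DAGs, each with a unique sink and in-degree at most 2, such that for all n ≥ n₀: c₁·n ≤ |V(G_n)| ≤ c₂·n, Black(G_n) ≤ c₃·s(n), and Pers(G_n) ≥ c₄·s(n)·log₂ n. -/
/-! ## Directed graphs and pebbling -/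

structure Dgraph where
  V : Type
  [fintypeV : Fintype V]
  [decEqV : DecidableEq V]
  edge : V → V → Prop

attribute [instance] Dgraph.fintypeV Dgraph.decEqV

namespace Dgraph

/-- A directed graph is acyclic if no vertex lies on a directed cycle. -/
def Acyclic (G : Dgraph) : Prop :=
  ∀ v : G.V, ¬ Relation.TransGen G.edge v v

def IsSink (G : Dgraph) (z : G.V) : Prop := ∀ u : G.V, ¬ G.edge z u

def IsSource (G : Dgraph) (v : G.V) : Prop := ∀ u : G.V, ¬ G.edge u v

def UniqueSink (G : Dgraph) (z : G.V) : Prop :=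
  G.IsSink z ∧ ∀ w : G.V, G.IsSink w → w = z

/-- Every vertex has in-degree at most 2. -/
def InDegLe2 (G : Dgraph) : Prop :=
  ∀ v : G.V, {u : G.V | G.edge u v}.ncard ≤ 2

/-- One step of the reversible pebble game. -/
def RevStep (G : Dgraph) (P P' : Finset G.V) : Prop :=
  (∃ v : G.V, v ∉ P ∧ (∀ u : G.V, G.edge u v → u ∈ P) ∧ P' = insert v P) ∨
  (∃ v : G.V, v ∈ P ∧ (∀ u : G.V, G.edge u v → u ∈ P) ∧ P' = P.erase v)

/-- One step of the standard pebble game. -/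
def StdStep (G : Dgraph) (P P' : Finset G.V) : Prop :=
  (∃ v : G.V, v ∉ P ∧ (∀ u : G.V, G.edge u v → u ∈ P) ∧ P' = insert v P) ∨
  (∃ v : G.V, v ∈ P ∧ P' = P.erase v)

/-- An unconditional reversible pebbling of time `τ`. -/
def IsRevPebbling (G : Dgraph) (P : ℕ → Finset G.V) (τ : ℕ) : Prop :=
  P 0 = ∅ ∧ ∀ t < τ, G.RevStep (P t) (P (t+1))

/-- An unconditional standard pebbling of time `τ`. -/
def IsStdPebbling (G : Dgraph) (P : ℕ → Finset G.V) (τ : ℕ) : Prop :=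
  P 0 = ∅ ∧ ∀ t < τ, G.StdStep (P t) (P (t+1))

/-- The space of a pebbling. -/
def space (G : Dgraph) (P : ℕ → Finset G.V) (τ : ℕ) : ℕ :=
  (Finset.range (τ+1)).sup fun t => (P t).card

/-- Persistent (reversible) pebbling price of a vertex. -/
noncomputable def pers (G : Dgraph) (v : G.V) : ℕ :=
  sInf { s : ℕ | ∃ P τ, G.IsRevPebbling P τ ∧ P τ = {v} ∧ G.space P τ = s }

/-- Visiting (reversible) pebbling price of a vertex. -/
noncomputable def visit (G : Dgraph) (v : G.V) : ℕ :=
  sInf { s : ℕ | ∃ P τ, G.IsRevPebbling P τ ∧ v ∈ P τ ∧ G.space P τ = s }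

/-- Surrounding (reversible) pebbling price of a vertex. -/
noncomputable def surround (G : Dgraph) (v : G.V) : ℕ :=
  sInf { s : ℕ | ∃ P τ, G.IsRevPebbling P τ ∧ (∀ u : G.V, G.edge u v → u ∈ P τ) ∧
    G.space P τ = s }

/-- Standard pebbling price of a vertex. -/
noncomputable def black (G : Dgraph) (z : G.V) : ℕ :=
  sInf { s : ℕ | ∃ P τ, G.IsStdPebbling P τ ∧ P τ = {z} ∧ G.space P τ = s }

/-- Space of a pebbling counted only inside the region `R`. -/
noncomputable def spaceIn (G : Dgraph) (R : Set G.V) (P : ℕ → Finset G.V) (τ : ℕ) : ℕ :=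
  (Finset.range (τ+1)).sup fun t => ((P t : Set G.V) ∩ R).ncard

/-- `R`-restricted persistent price. -/
noncomputable def persIn (G : Dgraph) (R : Set G.V) (v : G.V) : ℕ :=
  sInf { s : ℕ | ∃ P τ, G.IsRevPebbling P τ ∧ ((P τ : Set G.V) ∩ R) = {v} ∧
    G.spaceIn R P τ = s }

/-- `R`-restricted visiting price. -/
noncomputable def visitIn (G : Dgraph) (R : Set G.V) (v : G.V) : ℕ :=
  sInf { s : ℕ | ∃ P τ, G.IsRevPebbling P τ ∧ v ∈ P τ ∧ G.spaceIn R P τ = s }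

/-- `R`-restricted surrounding price. -/
noncomputable def surroundIn (G : Dgraph) (R : Set G.V) (v : G.V) : ℕ :=
  sInf { s : ℕ | ∃ P τ, G.IsRevPebbling P τ ∧ (∀ u : G.V, G.edge u v → u ∈ P τ) ∧
    G.spaceIn R P τ = s }

/-- `B` blocks the graph: every directed path from a source to a sink meets `B`. -/
def Blocks (G : Dgraph) (B : Set G.V) : Prop :=
  ∀ (p : List G.V) (hp : p ≠ []), List.Chain' G.edge p →
    G.IsSource (p.head hp) → G.IsSink (p.getLast hp) → ∃ v ∈ p, v ∈ B

/-- A minimal blocking set. -/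
def MinBlocking (G : Dgraph) (B : Set G.V) : Prop :=
  G.Blocks B ∧ ∀ B' : Set G.V, B' ⊂ B → ¬ G.Blocks B'

end Dgraph

/-! ## Layered graphs: open vertices -/

namespace Sep
open Relation

section Abstract

variable {G : Dgraph} {lay : G.V → ℕ}

/-- `Op lay a P v`: `v` is reachable from layer `a` by a path avoiding `P`. -/
inductive Op (lay : G.V → ℕ) (a : ℕ) (P : Finset G.V) : G.V → Prop
  | base (v : G.V) : lay v = a → v ∉ P → Op lay a P v
  | step (u v : G.V) : Op lay a P u → G.edge u v → v ∉ P → Op lay a P v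

def IsOp (lay : G.V → ℕ) (a x : ℕ) (P : Finset G.V) : Prop := ∃ v, lay v = x ∧ Op lay a P v

def cnt (lay : G.V → ℕ) (P : Finset G.V) (a x : ℕ) : ℕ :=
  (P.filter (fun v => a ≤ lay v ∧ lay v ≤ x)).card

def E (lay : G.V → ℕ) (M a x : ℕ) (P P' : Finset G.V) : Prop :=
  G.RevStep P P' ∧ cnt lay P a x < M ∧ cnt lay P' a x < M

structure Hyp (lay : G.V → ℕ) (N r w : ℕ) : Prop where
  irr : ∀ v, ¬ G.edge v v
  le : ∀ u v, G.edge u v → lay u ≤ lay v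
  le_succ : ∀ u v, G.edge u v → lay v ≤ lay u + 1
  pred : ∀ v, 1 ≤ lay v → lay v ≤ N → ∃ u, G.edge u v ∧ lay u + 1 = lay v
  conn : ∀ a P b, b + r ≤ N → (∀ v ∈ P, ¬ (b ≤ lay v ∧ lay v ≤ b + r)) → IsOp lay a b P →
    ∀ v, lay v = b + r → Op lay a P v
  cols : ∀ a x P, a ≤ x → x ≤ N → cnt lay P a x < w → IsOp lay a x P

theorem Op.not_mem {a : ℕ} {P : Finset G.V} {v : G.V} (h : Op lay a P v) : v ∉ P := by
  cases h <;> assumption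

theorem move {N r w : ℕ} (H : Hyp lay N r w) {P P' : Finset G.V} (h : G.RevStep P P') :
    ∃ v, (∀ u, G.edge u v → u ∈ P ∧ u ∈ P') ∧ (∀ u, u ≠ v → (u ∈ P ↔ u ∈ P')) := by
  rcases h with ⟨v, hv, hp, rfl⟩ | ⟨v, hv, hp, rfl⟩
  · exact ⟨v, fun u hu => ⟨hp u hu, Finset.mem_insert_of_mem (hp u hu)⟩, fun u hu => by simp [hu]⟩
  · refine ⟨v, fun u hu => ⟨hp u hu, Finset.mem_erase.2 ⟨?_, hp u hu⟩⟩, fun u hu => by simp [hu]⟩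
    rintro rfl; exact H.irr _ hu

theorem rev_symm (hirr : ∀ v, ¬ G.edge v v) {P P' : Finset G.V} (h : G.RevStep P P') :
    G.RevStep P' P := by
  rcases h with ⟨v, hv, hp, rfl⟩ | ⟨v, hv, hp, rfl⟩
  · exact Or.inr ⟨v, Finset.mem_insert_self _ _, fun u hu => Finset.mem_insert_of_mem (hp u hu),
      by simp [hv]⟩
  · refine Or.inl ⟨v, by simp, fun u hu => Finset.mem_erase.2 ⟨?_, hp u hu⟩, by simp [hv]⟩
    rintro rfl; exact hirr _ hu

theorem op_move {a : ℕ} {P P' : Finset G.V} {v : G.V} (hv : lay v ≠ a)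
    (hp : ∀ u, G.edge u v → u ∈ P) (hag : ∀ u, u ≠ v → (u ∈ P ↔ u ∈ P')) {u : G.V}
    (h : Op lay a P u) : Op lay a P' u := by
  induction h with
  | base u hu hP =>
    refine Op.base u hu ?_
    rwa [← hag u (by rintro rfl; exact hv hu)]
  | step u u' h he hP ih =>
    refine Op.step u u' ih he ?_
    rw [← hag u' (by rintro rfl; exact h.not_mem (hp u he))]
    exact hP

theorem op_congr {N r w : ℕ} (H : Hyp lay N r w) {a : ℕ} {P P' : Finset G.V}
    (hag : ∀ u, a ≤ lay u → (u ∈ P ↔ u ∈ P')) {u : G.V}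
    (h : Op lay a P u) : a ≤ lay u ∧ Op lay a P' u := by
  induction h with
  | base u hu hP => exact ⟨hu.ge, Op.base u hu (by rwa [← hag u hu.ge])⟩
  | step u u' h he hP ih =>
    have := ih.1.trans (H.le _ _ he)
    exact ⟨this, Op.step u u' ih.2 he (by rwa [← hag u' this])⟩

theorem op_anti {a : ℕ} {P P' : Finset G.V} (hs : P' ⊆ P) {u : G.V}
    (h : Op lay a P u) : Op lay a P' u := by
  induction h with
  | base u hu hP => exact Op.base u hu (fun h => hP (hs h))
  | step u u' h he hP ih => exact Op.step u u' ih he (fun h => hP (hs h))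

theorem op_mono {N r w : ℕ} (H : Hyp lay N r w) {a m : ℕ} (ham : a ≤ m) {P : Finset G.V} {u : G.V}
    (h : Op lay a P u) : m ≤ lay u → Op lay m P u ∧ IsOp lay a m P := by
  induction h with
  | base u hu hP =>
    intro h
    have : lay u = m := by omega
    exact ⟨Op.base u this hP, u, this, Op.base u hu hP⟩
  | step u u' h he hP ih =>
    intro hm
    by_cases hu : m ≤ lay u
    · exact ⟨Op.step u u' (ih hu).1 he hP, (ih hu).2⟩
    · have := H.le_succ _ _ he
      have : lay u' = m := by omega
      exact ⟨Op.base u' this hP, u', this, Op.step u u' h he hP⟩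

theorem op_ext {N r w : ℕ} (H : Hyp lay N r w) {a y : ℕ} (hy : y < N) {P : Finset G.V}
    (hfull : ∀ v, lay v = y → Op lay a P v) {u : G.V} (h : Op lay (y+1) P u) : Op lay a P u := by
  induction h with
  | base u hu hP =>
    obtain ⟨u', he, hl⟩ := H.pred u (by omega) (by omega)
    exact Op.step u' u (hfull u' (by omega)) he hP
  | step u u' h he hP ih => exact Op.step u u' ih he hP

theorem gap {M r a x c : ℕ} {P : Finset G.V} (hc : cnt lay P a x < M) (hac : a ≤ c)
    (hx : c + M * (r+1) ≤ x + 1) :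
    ∃ b, c ≤ b ∧ b + r < c + M * (r+1) ∧ ∀ v ∈ P, ¬ (b ≤ lay v ∧ lay v ≤ b + r) := by
  by_contra! hcon
  have hsub : Finset.range M ⊆
      (P.filter (fun v => a ≤ lay v ∧ lay v ≤ x)).image (fun v => (lay v - c) / (r+1)) := by
    intro j hj
    rw [Finset.mem_range] at hj
    have h1 : (j+1) * (r+1) ≤ M * (r+1) := Nat.mul_le_mul_right _ hj
    have h2 : (j+1) * (r+1) = j * (r+1) + r + 1 := by ring
    obtain ⟨v, hv, hl⟩ := hcon (c + j * (r+1)) (by omega) (by omega)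
    refine Finset.mem_image.2 ⟨v, Finset.mem_filter.2 ⟨hv, by omega, by omega⟩, ?_⟩
    apply Nat.div_eq_of_lt_le
    · omega
    · show _ < (j+1) * (r+1); omega
  have := (Finset.card_le_card hsub).trans Finset.card_image_le
  rw [Finset.card_range] at this
  unfold cnt at hc
  omega

theorem gapU {N r w M : ℕ} (H : Hyp lay N r w) {a m x : ℕ} {P : Finset G.V} (ham : a ≤ m)
    (hmx : m + M * (r+1) ≤ x) (hx : x ≤ N) (hc : cnt lay P a x < M) (ho : IsOp lay a x P) (v : G.V)
    (hv : lay v = x) : Op lay a P v ↔ Op lay m P v := by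
  refine ⟨fun h => (op_mono H ham h (by omega)).1, fun h => ?_⟩
  obtain ⟨b, hb, hb', he⟩ := gap (r := r) (c := m) hc ham (by omega)
  obtain ⟨z, hz, hz'⟩ := ho
  have h1 : IsOp lay a b P := (op_mono H (by omega) hz' (by omega)).2
  have h2 := H.conn a P b (by omega) he h1
  exact op_ext H (by omega) h2 (op_mono H (by omega) h (by omega)).1

theorem cnt_add (P : Finset G.V) (a m x : ℕ) (ham : a ≤ m) (hmx : m ≤ x) :
    cnt lay P a m + cnt lay P (m+1) x ≤ cnt lay P a x := by
  unfold cnt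
  rw [← Finset.card_union_of_disjoint]
  · apply Finset.card_le_card
    intro v
    simp only [Finset.mem_union, Finset.mem_filter]
    rintro (⟨h, h1, h2⟩ | ⟨h, h1, h2⟩) <;> exact ⟨h, by omega, by omega⟩
  · rw [Finset.disjoint_filter]
    intro v _ h; omega

theorem rtg_mono {α : Type*} {R S : α → α → Prop} {Q P : α} (h : ReflTransGen R Q P)
    (hRS : ∀ A B, R A B → S A B) : ReflTransGen S Q P := by
  induction h with
  | refl => exact ReflTransGen.refl
  | tail _ h ih => exact ih.tail (hRS _ _ h)

theorem rtg_symm {α : Type*} {R : α → α → Prop} {Q P : α} (h : ReflTransGen R Q P)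
    (hR : ∀ A B, R A B → R B A) : ReflTransGen R P Q := by
  induction h with
  | refl => exact ReflTransGen.refl
  | tail _ h ih => exact ReflTransGen.head (hR _ _ h) ih

theorem split {α : Type*} {R : α → α → Prop} {φ : α → Prop} {Q P : α}
    (h : ReflTransGen R Q P) (hQ : φ Q) : ¬ φ P → ∃ A B, φ A ∧ ¬ φ B ∧ R A B ∧
      ReflTransGen (fun A B => R A B ∧ ¬ φ A ∧ ¬ φ B) B P := by
  induction h with
  | refl => intro h; exact absurd hQ h
  | @tail b c h1 h2 ih =>
    intro hc
    by_cases hb : φ b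
    · exact ⟨b, c, hb, hc, h2, ReflTransGen.refl⟩
    · obtain ⟨A, B, hA, hB, hR, hr⟩ := ih hb
      exact ⟨A, B, hA, hB, hR, hr.tail ⟨h2, hb, hc⟩⟩

def D (M r : ℕ) : ℕ → ℕ
  | 0 => 0
  | k+1 => 2 * D M r k + 2 * (M * (r+1)) + 1

theorem main {N r w K : ℕ} (H : Hyp lay N r w) : ∀ k ≤ K, ∀ a x, a + D (K*w) r k ≤ x → x ≤ N →
    ∀ P0 P, ReflTransGen (E lay (k*w) a x) P0 P → IsOp lay a x P0 →
      (∀ v, lay v = x → Op lay a P0 v → v ∉ P) ∧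
      (IsOp lay a x P → ∀ v, lay v = x → (Op lay a P v ↔ Op lay a P0 v)) := by
  intro k
  induction k with
  | zero =>
    intro _ a x _ _ P0 P h ho
    have : P = P0 := by
      induction h with
      | refl => rfl
      | tail _ h _ => exact absurd h.2.1 (by simp)
    subst this
    exact ⟨fun v _ h => h.not_mem, fun _ v _ => Iff.rfl⟩
  | succ k IH =>
    intro hk a x hax hxN P0 P h ho
    have IH := IH (by omega)
    have hkM : (k+1) * w ≤ K * w := Nat.mul_le_mul_right _ hk
    have hkw : (k+1) * w = k * w + w := by ring
    generalize hM : K * w = M at *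
    generalize hd : D M r k = d at *
    have hax' : a + (2 * d + 2 * (M * (r+1)) + 1) ≤ x := by rw [← hd]; exact hax
    clear hax
    set g := M * (r+1) with hg
    set m := a + 1 + d + g with hm
    -- invariant
    have key : (IsOp lay a x P ∧ ∀ v, lay v = x → (Op lay a P v ↔ Op lay a P0 v)) ∨
        (¬ IsOp lay a x P ∧ ∃ Q, (∀ y, a < y → y ≤ m → IsOp lay y x Q) ∧
          (∀ v, lay v = x → (Op lay m Q v ↔ Op lay a P0 v)) ∧
          w ≤ cnt lay P a (a + d + g) ∧
          ReflTransGen (fun A B => E lay ((k+1)*w) a x A B ∧ w ≤ cnt lay A a (a + d + g) ∧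
            w ≤ cnt lay B a (a + d + g)) Q P) := by
      induction h with
      | refl => exact Or.inl ⟨ho, fun v _ => Iff.rfl⟩
      | @tail P P' hr hE ih =>
        obtain ⟨hstep, hc, hc'⟩ := hE
        obtain ⟨v, hp, hag⟩ := move H hstep
        have h2c : ¬ IsOp lay a x P' → ∀ Q, (∀ y, a < y → y ≤ m → IsOp lay y x Q) →
            ReflTransGen (E lay ((k+1)*w) a x) Q P → w ≤ cnt lay P' a (a + d + g) := by
          intro h1 Q h2 h5
          by_contra hw
          push Not at hw
          obtain ⟨b, hb, hb', he⟩ := gap (r := r) (M := M) (c := a + 1 + d) (by omega : cnt lay P' a x < M)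
            (by omega) (by omega)
          have hcb : cnt lay P' a b < w := by
            refine lt_of_le_of_lt (Finset.card_le_card ?_) hw
            intro u; simp only [Finset.mem_filter]; rintro ⟨h, h', h''⟩
            exact ⟨h, h', by omega⟩
          have hfull := H.conn a P' b (by omega) he (H.cols a b P' (by omega) (by omega) hcb)
          have hbl : ¬ IsOp lay (b+r+1) x P' := by
            rintro ⟨u, hu, hu'⟩
            exact h1 ⟨u, hu, op_ext H (by omega) hfull hu'⟩
          have hpath : ReflTransGen (E lay ((k+1)*w) a x) Q P' :=
            ReflTransGen.tail h5 ⟨hstep, hc, hc'⟩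
          obtain ⟨A, B, hA, hB, ⟨hAB, _, _⟩, hBP⟩ := split (φ := fun Q => IsOp lay (b+r+1) x Q) hpath
            (h2 _ (by omega) (by omega)) hbl
          obtain ⟨v', hp', hag'⟩ := move H hAB
          have hv' : lay v' = b + r + 1 := by
            by_contra hne
            obtain ⟨u, hu, hu'⟩ := hA
            exact hB ⟨u, hu, op_move hne (fun u hu => (hp' u hu).1) hag' hu'⟩
          obtain ⟨q, hq, hql⟩ := H.pred v' (by omega) (by omega)
          have hlow : ∀ C, ¬ IsOp lay (b+r+1) x C → cnt lay C a x < (k+1)*w →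
              cnt lay C a (b+r) < k * w := by
            intro C hC1 hC2
            have h1 : w ≤ cnt lay C (b+r+1) x := by
              by_contra hlt
              exact hC1 (H.cols _ _ _ (by omega) hxN (by omega))
            have h2 := cnt_add (lay := lay) C a (b+r) x (by omega) (by omega)
            omega
          have hback : ReflTransGen (E lay (k*w) a (b+r)) P' B := by
            have : ReflTransGen (E lay (k*w) a (b+r)) B P' := by
              refine rtg_mono hBP ?_
              rintro X Y ⟨⟨e1, e2, e3⟩, e4, e5⟩
              exact ⟨e1, hlow _ e4 e2, hlow _ e5 e3⟩
            exact rtg_symm this fun X Y e => ⟨rev_symm H.irr e.1, e.2.2, e.2.1⟩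
          exact (IH a (b+r) (by omega) (by omega) P' B hback
            ⟨q, by omega, hfull q (by omega)⟩).1 q (by omega) (hfull q (by omega)) (hp' q hq).2
        by_cases hva : lay v = a
        swap
        · -- the open sets from layer a do not change
          have hsame : ∀ u, Op lay a P u ↔ Op lay a P' u := fun u =>
            ⟨op_move hva (fun u hu => (hp u hu).1) hag,
             op_move hva (fun u hu => (hp u hu).2) (fun u hu => (hag u hu).symm)⟩
          have hsame' : IsOp lay a x P ↔ IsOp lay a x P' := by simp [IsOp, hsame]
          rcases ih with ⟨h1, h2⟩ | ⟨h1, Q, h2, h3, h4, h5⟩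
          · exact Or.inl ⟨hsame'.1 h1, fun u hu => by rw [← hsame, h2 u hu]⟩
          · rw [hsame'] at h1
            refine Or.inr ⟨h1, Q, h2, h3, ?_⟩
            have hw := h2c h1 Q h2 (rtg_mono h5 fun A B h => h.1)
            exact ⟨hw, h5.tail ⟨⟨hstep, hc, hc'⟩, h4, hw⟩⟩
        · have hag2 : ∀ u, lay u ≠ a → (u ∈ P ↔ u ∈ P') := fun u hu => hag u (by rintro rfl; exact hu hva)
          have hsame : ∀ y, a < y → ∀ u, Op lay y P u ↔ Op lay y P' u := fun y hy u =>
            ⟨fun h => (op_congr H (fun u hu => hag2 u (by omega)) h).2,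
             fun h => (op_congr H (fun u hu => (hag2 u (by omega)).symm) h).2⟩
          have hU : IsOp lay a x P → ∀ v, lay v = x → (Op lay a P v ↔ Op lay m P v) :=
            fun h => gapU (M := M) H (by omega) (by omega) hxN (by omega) h
          have hU' : IsOp lay a x P' → ∀ v, lay v = x → (Op lay a P' v ↔ Op lay m P' v) :=
            fun h => gapU (M := M) H (by omega) (by omega) hxN (by omega) h
          by_cases ho' : IsOp lay a x P'
          · refine Or.inl ⟨ho', fun u hu => ?_⟩
            rcases ih with ⟨h1, h2⟩ | ⟨h1, Q, h2, h3, h4, h5⟩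
            · rw [hU' ho' u hu, ← hsame m (by omega), ← hU h1 u hu, h2 u hu]
            · rw [hU' ho' u hu, ← hsame m (by omega), ← h3 u hu]
              have hlow : ∀ C, w ≤ cnt lay C a (a + d + g) → cnt lay C a x < (k+1)*w →
                  cnt lay C m x < k * w := by
                intro C hC1 hC2
                have h2 := cnt_add (lay := lay) C a (a+d+g) x (by omega) (by omega)
                have h3 : a + d + g + 1 = m := by omega
                rw [h3] at h2
                omega
              have hpath : ReflTransGen (E lay (k*w) m x) Q P := by
                refine rtg_mono h5 ?_
                rintro X Y ⟨⟨e1, e2, e3⟩, e4, e5⟩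
                exact ⟨e1, hlow _ e4 e2, hlow _ e5 e3⟩
              refine (IH m x (by omega) hxN Q P hpath (h2 m (by omega) le_rfl)).2 ?_ u hu
              obtain ⟨z, hz, hz'⟩ := ho'
              exact ⟨z, hz, by rw [hsame m (by omega)]; exact (op_mono H (by omega) hz' (by omega)).1⟩
          · refine Or.inr ⟨ho', ?_⟩
            rcases ih with ⟨h1, h2⟩ | ⟨h1, Q, h2, h3, h4, h5⟩
            · have hw : w ≤ cnt lay P' a (a + d + g) := by
                by_contra hw
                push Not at hw
                obtain ⟨b, hb, hb', he⟩ := gap (r := r) (M := M) (c := a + 1 + d) (by omega : cnt lay P' a x < M)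
                  (by omega) (by omega)
                have hcb : cnt lay P' a b < w := by
                  refine lt_of_le_of_lt (Finset.card_le_card ?_) hw
                  intro u; simp only [Finset.mem_filter]; rintro ⟨h, h', h''⟩
                  exact ⟨h, h', by omega⟩
                have hfull := H.conn a P' b (by omega) he (H.cols a b P' (by omega) (by omega) hcb)
                obtain ⟨z, hz, hz'⟩ := h1
                apply ho'
                refine ⟨z, hz, op_ext H (by omega) hfull ?_⟩
                rw [← hsame _ (by omega)]
                exact (op_mono H (by omega) hz' (by omega)).1
              refine ⟨P', ?_, ?_, hw, ReflTransGen.refl⟩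
              · intro y hy hy'
                obtain ⟨z, hz, hz'⟩ := h1
                exact ⟨z, hz, by rw [← hsame y hy]; exact (op_mono H (by omega) hz' (by omega)).1⟩
              · intro u hu
                rw [← hsame m (by omega), ← hU h1 u hu, h2 u hu]
            · refine ⟨Q, h2, h3, ?_⟩
              have hw := h2c ho' Q h2 (rtg_mono h5 fun A B h => h.1)
              exact ⟨hw, h5.tail ⟨⟨hstep, hc, hc'⟩, h4, hw⟩⟩
    rcases key with ⟨h1, h2⟩ | ⟨h1, Q, h2, h3, h4, h5⟩
    · exact ⟨fun v hv hv' => ((h2 v hv).2 hv').not_mem, fun _ => h2⟩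
    · refine ⟨fun v hv hv' => ?_, fun h => absurd h h1⟩
      have hlow : ∀ C, w ≤ cnt lay C a (a + d + g) → cnt lay C a x < (k+1)*w →
          cnt lay C m x < k * w := by
        intro C hC1 hC2
        have h2 := cnt_add (lay := lay) C a (a+d+g) x (by omega) (by omega)
        have h3 : a + d + g + 1 = m := by omega
        rw [h3] at h2
        omega
      have hpath : ReflTransGen (E lay (k*w) m x) Q P := by
        refine rtg_mono h5 ?_
        rintro X Y ⟨⟨e1, e2, e3⟩, e4, e5⟩
        exact ⟨e1, hlow _ e4 e2, hlow _ e5 e3⟩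
      exact (IH m x (by omega) hxN Q P hpath (h2 m (by omega) le_rfl)).1 v hv ((h3 v hv).2 hv')

end Abstract
end Sep

/-! ## Pebbling sequences -/

namespace Sep
open Relation

theorem rtg_seq {α : Type*} {R : α → α → Prop} {Q P : α} (h : ReflTransGen R Q P) :
    ∃ (f : ℕ → α) (τ : ℕ), f 0 = Q ∧ f τ = P ∧ ∀ t < τ, R (f t) (f (t+1)) := by
  induction h with
  | refl => exact ⟨fun _ => Q, 0, rfl, rfl, fun t ht => absurd ht (by omega)⟩
  | @tail b c _ h ih =>
    obtain ⟨f, τ, h0, h1, h2⟩ := ih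
    refine ⟨fun t => if t ≤ τ then f t else c, τ + 1, by simp [h0], by simp, fun t ht => ?_⟩
    rcases Nat.lt_succ_iff_lt_or_eq.1 ht with ht | rfl
    · have h3 : t + 1 ≤ τ := ht
      have h4 : t ≤ τ := by omega
      simp only [h3, h4, if_true]
      exact h2 t ht
    · simp [h1, h]

section Generic
variable {G : Dgraph}

def SR (G : Dgraph) (M : ℕ) (P P' : Finset G.V) : Prop :=
  G.StdStep P P' ∧ P.card ≤ M ∧ P'.card ≤ M

theorem sr_add {M : ℕ} (P S : Finset G.V) : (∀ v ∈ S, ∀ u, G.edge u v → u ∈ P) →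
    (P ∪ S).card ≤ M → ReflTransGen (SR G M) P (P ∪ S) := by
  induction S using Finset.induction_on with
  | empty => intro _ _; simpa using ReflTransGen.refl
  | insert v S hv ih =>
    intro h hc
    have hins : P ∪ insert v S = insert v (P ∪ S) := by simp
    have hc' : (P ∪ S).card ≤ M := by
      refine le_trans (Finset.card_le_card ?_) hc
      rw [hins]; exact Finset.subset_insert _ _
    have h1 := ih (fun v hv => h v (Finset.mem_insert_of_mem hv)) hc'
    by_cases hvP : v ∈ P ∪ S
    · rw [hins, Finset.insert_eq_of_mem hvP]; exact h1
    · refine h1.tail ⟨Or.inl ⟨v, hvP, fun u hu => ?_, hins⟩, hc', hc⟩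
      exact Finset.mem_union_left _ (h v (Finset.mem_insert_self _ _) u hu)

theorem sr_sub {M : ℕ} (P S : Finset G.V) (hM : (P ∪ S).card ≤ M) :
    ReflTransGen (SR G M) (P ∪ S) P := by
  induction S using Finset.induction_on with
  | empty => simpa using ReflTransGen.refl
  | insert v S hv ih =>
    have hins : P ∪ insert v S = insert v (P ∪ S) := by simp
    have hc' : (P ∪ S).card ≤ M := by
      refine le_trans (Finset.card_le_card ?_) hM
      rw [hins]; exact Finset.subset_insert _ _
    by_cases hvP : v ∈ P ∪ S
    · rw [hins, Finset.insert_eq_of_mem hvP]; exact ih hc'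
    · refine ReflTransGen.head ⟨Or.inr ⟨v, by simp, ?_⟩, hM, hc'⟩ (ih hc')
      rw [hins, Finset.erase_insert hvP]

theorem sr_subset {M : ℕ} {P Q : Finset G.V} (h : P ⊆ Q) (hM : Q.card ≤ M) :
    ReflTransGen (SR G M) Q P := by
  have := sr_sub (M := M) P Q (by rwa [Finset.union_eq_right.2 h])
  rwa [Finset.union_eq_right.2 h] at this

theorem black_le {M : ℕ} (hM : 1 ≤ M) (z : G.V) (h : ReflTransGen (SR G M) ∅ {z}) :
    G.black z ≤ M := by
  obtain ⟨f, τ, h0, h1, h2⟩ := rtg_seq h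
  have hle : G.space f τ ≤ M := by
    refine Finset.sup_le fun t ht => ?_
    rw [Finset.mem_range] at ht
    rcases Nat.lt_succ_iff_lt_or_eq.1 ht with ht | rfl
    · exact (h2 t ht).2.1
    · simpa [h1] using hM
  exact le_trans (Nat.sInf_le ⟨f, τ, ⟨h0, fun t ht => (h2 t ht).1⟩, h1, rfl⟩) hle

theorem rev_univ (rank : G.V → ℕ) (hrank : ∀ u v, G.edge u v → rank u < rank v) :
    ∀ (n : ℕ) (P : Finset G.V), Pᶜ.card = n → ReflTransGen G.RevStep P Finset.univ := by
  intro n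
  induction n with
  | zero =>
    intro P hP
    have : P = Finset.univ := by simpa using hP
    rw [this]
  | succ n ih =>
    intro P hP
    obtain ⟨v, hv, hmin⟩ := Finset.exists_min_image Pᶜ rank (Finset.card_pos.1 (by omega))
    have hvP : v ∉ P := by simpa using hv
    refine ReflTransGen.head (Or.inl ⟨v, hvP, fun u hu => ?_, rfl⟩) (ih (insert v P) ?_)
    · by_contra huP
      have := hmin u (by simpa using huP)
      have := hrank u v hu
      omega
    · rw [Finset.compl_insert, Finset.card_erase_of_mem hv, hP]; rfl

theorem pers_ge {M : ℕ} (rank : G.V → ℕ) (hrank : ∀ u v, G.edge u v → rank u < rank v) (z : G.V)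
    (h : ∀ P τ, G.IsRevPebbling P τ → P τ = {z} → ¬ (∀ t ≤ τ, (P t).card < M)) :
    M ≤ G.pers z := by
  have hirr : ∀ v, ¬ G.edge v v := fun v hv => lt_irrefl _ (hrank v v hv)
  have hne : { s : ℕ | ∃ P τ, G.IsRevPebbling P τ ∧ P τ = {z} ∧ G.space P τ = s }.Nonempty := by
    have h1 := rev_univ rank hrank _ ∅ rfl
    have h2 := rtg_symm (rev_univ rank hrank _ {z} rfl) (fun A B => rev_symm hirr)
    obtain ⟨f, τ, h3, h4, h5⟩ := rtg_seq (h1.trans h2)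
    exact ⟨G.space f τ, f, τ, ⟨h3, h5⟩, h4, rfl⟩
  obtain ⟨P, τ, h1, h2, h3⟩ := Nat.sInf_mem hne
  by_contra hlt
  refine h P τ h1 h2 fun t ht => ?_
  have h4 : (P t).card ≤ G.space P τ :=
    Finset.le_sup (f := fun t => (P t).card) (Finset.mem_range.2 (by omega))
  rw [h3] at h4
  exact lt_of_le_of_lt h4 (not_le.1 hlt)

end Generic

/-! ## The butterfly road -/

abbrev Vt (N r : ℕ) : Type := Fin (N+2) × (Fin r → Bool)

noncomputable def num (r : ℕ) : (Fin r → Bool) ≃ Fin (2^r) := Fintype.equivFinOfCardEq (by simp)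

def bedge (N r : ℕ) (u v : Vt N r) : Prop :=
  (v.1.val = u.1.val + 1 ∧ v.1.val ≤ N ∧ ∀ k : Fin r, k.val ≠ u.1.val % r → v.2 k = u.2 k) ∨
  (v.1.val = N + 1 ∧ u.1.val = N ∧ v.2 = u.2) ∨
  (v.1.val = N + 1 ∧ u.1.val = N + 1 ∧ (num r v.2).val = (num r u.2).val + 1)

abbrev BG (N r : ℕ) : Dgraph where
  V := Vt N r
  edge := bedge N r

def blay (N r : ℕ) (v : (BG N r).V) : ℕ := v.1.val

theorem blay_def {N r : ℕ} (i : Fin (N+2)) (c : Fin r → Bool) :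
    blay N r ((i, c) : Vt N r) = i.val := rfl

noncomputable def brank (N r : ℕ) (v : (BG N r).V) : ℕ :=
  if v.1.val ≤ N then v.1.val else N + 1 + (num r v.2).val

theorem brank_lt {N r : ℕ} (u v : (BG N r).V) (h : (BG N r).edge u v) :
    brank N r u < brank N r v := by
  unfold brank
  rcases h with ⟨h1, h2, _⟩ | ⟨h1, h2, _⟩ | ⟨h1, h2, h3⟩
  · rw [if_pos (by omega), if_pos h2]; omega
  · rw [if_pos (by omega), if_neg (by omega)]; omega
  · rw [if_neg (by omega), if_neg (by omega)]; omega

theorem bg_acyclic (N r : ℕ) : (BG N r).Acyclic := by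
  have : ∀ u v, TransGen (BG N r).edge u v → brank N r u < brank N r v := by
    intro u v h
    induction h with
    | single h => exact brank_lt _ _ h
    | tail _ h ih => exact ih.trans (brank_lt _ _ h)
  exact fun v h => lt_irrefl _ (this v v h)

noncomputable def bz (N r : ℕ) : (BG N r).V :=
  ((⟨N+1, by omega⟩ : Fin (N+2)), (num r).symm ⟨2^r - 1, by have := Nat.two_pow_pos r; omega⟩)

theorem bg_sink (N r : ℕ) : (BG N r).UniqueSink (bz N r) := by
  have hz1 : (bz N r).1.val = N + 1 := rfl
  have hz2 : (num r (bz N r).2).val = 2^r - 1 := by simp [bz]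
  constructor
  · intro u h
    have hu := u.1.isLt
    have hc := (num r u.2).isLt
    rcases h with ⟨h1, h2, _⟩ | ⟨h1, h2, _⟩ | ⟨h1, h2, h3⟩ <;> omega
  · intro v hv
    have hlt := v.1.isLt
    rcases lt_trichotomy v.1.val N with h | h | h
    · exact absurd (Or.inl ⟨rfl, by simp; omega, fun _ _ => rfl⟩)
        (hv ((⟨v.1.val + 1, by omega⟩ : Fin (N+2)), v.2))
    · exact absurd (Or.inr (Or.inl ⟨rfl, h, rfl⟩)) (hv ((⟨N+1, by omega⟩ : Fin (N+2)), v.2))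
    · have hN : v.1.val = N + 1 := by omega
      by_cases hc : (num r v.2).val + 1 < 2^r
      · exact absurd (Or.inr (Or.inr ⟨rfl, hN, by simp⟩))
          (hv ((⟨N+1, by omega⟩ : Fin (N+2)), (num r).symm ⟨_, hc⟩))
      · have := (num r v.2).isLt
        refine Prod.ext (Fin.ext (by omega)) ((num r).injective (Fin.ext (by omega)))

theorem bg_indeg {N r : ℕ} (hr : 0 < r) : (BG N r).InDegLe2 := by
  intro v
  suffices h : ∃ p q : (BG N r).V, ∀ u, (BG N r).edge u v → u = p ∨ u = q by
    obtain ⟨p, q, h⟩ := h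
    have h1 : {u | (BG N r).edge u v} ⊆ ({p, q} : Set (BG N r).V) := fun u hu => by
      simpa using h u hu
    exact (Set.ncard_le_ncard h1 (Set.toFinite _)).trans ((Set.ncard_insert_le p {q}).trans (by simp))
  have hlt := v.1.isLt
  by_cases hN : v.1.val = N + 1
  · refine ⟨((⟨N, by omega⟩ : Fin (N+2)), v.2), ((⟨N+1, by omega⟩ : Fin (N+2)),
      (num r).symm ⟨(num r v.2).val - 1, by have := (num r v.2).isLt; omega⟩), fun u hu => ?_⟩
    rcases hu with ⟨h1, h2, _⟩ | ⟨h1, h2, h3⟩ | ⟨h1, h2, h3⟩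
    · omega
    · exact Or.inl (Prod.ext (Fin.ext h2) h3.symm)
    · refine Or.inr (Prod.ext (Fin.ext h2) ((num r).injective (Fin.ext ?_)))
      simp; omega
  · let k : Fin r := ⟨(v.1.val - 1) % r, Nat.mod_lt _ hr⟩
    let f : Bool → (BG N r).V := fun b =>
      ((⟨v.1.val - 1, by omega⟩ : Fin (N+2)), Function.update v.2 k b)
    refine ⟨f true, f false, fun u hu => ?_⟩
    suffices h : u = f (u.2 k) by
      rcases Bool.eq_false_or_eq_true (u.2 k) with h' | h' <;> rw [h'] at h
      · exact Or.inl h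
      · exact Or.inr h
    rcases hu with ⟨h1, h2, h3⟩ | ⟨h1, h2, h3⟩ | ⟨h1, h2, h3⟩
    · refine Prod.ext (Fin.ext (by simp [f]; omega)) (funext fun j => ?_)
      by_cases hj : j = k
      · subst hj; simp [f]
      · have h4 : u.2 j = v.2 j := by
          refine (h3 j fun h => hj (Fin.ext ?_)).symm
          rw [h]; simp only [k]; congr 1; omega
        simp [f, hj, h4]
    · omega
    · omega

theorem bg_card (N r : ℕ) : Fintype.card (BG N r).V = (N+2) * 2^r := by
  show @Fintype.card (Vt N r) (BG N r).fintypeV = _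
  have : (BG N r).fintypeV = (inferInstance : Fintype (Vt N r)) := rfl
  rw [this]; simp

theorem bg_conn {N r : ℕ} (hr : 0 < r) (a : ℕ) (P : Finset (BG N r).V) (b : ℕ) (hb : b + r ≤ N)
    (hP : ∀ v ∈ P, ¬ (b ≤ blay N r v ∧ blay N r v ≤ b + r)) (ho : IsOp (blay N r) a b P)
    (v : (BG N r).V) (hv : blay N r v = b + r) : Op (blay N r) a P v := by
  classical
  obtain ⟨u, hu, huo⟩ := ho
  let c : ℕ → (Fin r → Bool) := fun i k => if ∃ i' < i, (b + i') % r = k.val then v.2 k else u.2 k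
  have key : ∀ i (hi : i ≤ r),
      Op (G := BG N r) (blay N r) a P ((⟨b + i, by omega⟩ : Fin (N+2)), c i) := by
    intro i
    induction i with
    | zero =>
      intro hi
      convert huo using 1
      exact (Prod.ext (Fin.ext hu.symm) (funext fun k => by simp [c]) : (((⟨b, by omega⟩ : Fin (N+2)), c 0) : Vt N r) = u)
    | succ i ih =>
      intro hi
      refine Op.step _ _ (ih (by omega)) (Or.inl ⟨rfl, by simp; omega, fun k hk => ?_⟩) fun hmem =>
        hP _ hmem ⟨?_, ?_⟩
      · have h1 : (∃ i' < i + 1, (b + i') % r = k.val) ↔ (∃ i' < i, (b + i') % r = k.val) := by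
          constructor
          · rintro ⟨i', hi', h⟩
            rcases Nat.lt_succ_iff_lt_or_eq.1 hi' with h' | rfl
            · exact ⟨i', h', h⟩
            · exact absurd h.symm hk
          · rintro ⟨i', hi', h⟩; exact ⟨i', by omega, h⟩
        simp only [c, h1]
      · show b ≤ b + (i+1); omega
      · show b + (i+1) ≤ b + r; omega
  convert key r le_rfl using 1
  refine Prod.ext (Fin.ext hv) (funext fun k => ?_)
  have : ∃ i' < r, (b + i') % r = k.val := by
    have hk := k.isLt
    have hbr := Nat.mod_lt b hr
    have hdm := Nat.div_add_mod b r
    by_cases h : b % r ≤ k.val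
    · refine ⟨k.val - b % r, by omega, ?_⟩
      rw [← Nat.mod_add_mod, show b % r + (k.val - b % r) = k.val by omega, Nat.mod_eq_of_lt hk]
    · refine ⟨r + k.val - b % r, by omega, ?_⟩
      rw [← Nat.mod_add_mod, show b % r + (r + k.val - b % r) = k.val + r by omega,
        Nat.add_mod_right, Nat.mod_eq_of_lt hk]
  simp only [c, this, if_true]

theorem bg_cols {N r : ℕ} (a x : ℕ) (P : Finset (BG N r).V) (hax : a ≤ x) (hx : x ≤ N)
    (hc : cnt (blay N r) P a x < 2^r) : IsOp (blay N r) a x P := by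
  obtain ⟨c, hcol⟩ : ∃ c : Fin r → Bool,
      c ∉ (P.filter (fun v => a ≤ blay N r v ∧ blay N r v ≤ x)).image (fun v : Vt N r => v.2) := by
    by_contra! hall
    have h1 : (Finset.univ : Finset (Fin r → Bool)).card ≤ cnt (blay N r) P a x :=
      (Finset.card_le_card (fun c _ => hall c)).trans Finset.card_image_le
    simp at h1
    omega
  have hnot : ∀ i (hi : i < N + 2), a ≤ i → i ≤ x → (((⟨i, hi⟩ : Fin (N+2)), c) : Vt N r) ∉ P := by
    intro i hi h1 h2 hmem
    exact hcol (Finset.mem_image.2 ⟨_, Finset.mem_filter.2 ⟨hmem, h1, h2⟩, rfl⟩)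
  have key : ∀ i (hi : a + i ≤ x),
      Op (G := BG N r) (blay N r) a P ((⟨a + i, by omega⟩ : Fin (N+2)), c) := by
    intro i
    induction i with
    | zero => intro hi; exact Op.base _ rfl (hnot _ _ (by omega) hi)
    | succ i ih =>
      intro hi
      exact Op.step _ _ (ih (by omega)) (Or.inl ⟨rfl, by simp; omega, fun _ _ => rfl⟩)
        (hnot _ _ (by omega) hi)
  exact ⟨_, by show a + (x - a) = x; omega, key (x - a) (by omega)⟩

theorem bg_hyp {N r : ℕ} (hr : 0 < r) : Hyp (blay N r) N r (2^r) where
  irr v h := lt_irrefl _ (brank_lt v v h)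
  le u v h := by
    unfold blay
    rcases h with ⟨h1, h2, _⟩ | ⟨h1, h2, _⟩ | ⟨h1, h2, h3⟩ <;> omega
  le_succ u v h := by
    unfold blay
    rcases h with ⟨h1, h2, _⟩ | ⟨h1, h2, _⟩ | ⟨h1, h2, h3⟩ <;> omega
  pred v h1 h2 := by
    have hlt := v.1.isLt
    unfold blay at *
    refine ⟨((⟨v.1.val - 1, by omega⟩ : Fin (N+2)), v.2), Or.inl ⟨?_, h2, fun _ _ => rfl⟩, ?_⟩
    · simp; omega
    · simp; omega
  conn := bg_conn hr
  cols := bg_cols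

theorem bg_pers {N r K : ℕ} (hr : 0 < r) (hD : D (K * 2^r) r K ≤ N) :
    K * 2^r ≤ (BG N r).pers (bz N r) := by
  have H := bg_hyp (N := N) hr
  refine pers_ge (brank N r) brank_lt _ fun P τ hP hz hall => ?_
  have hopen : ∀ i (hi : i < N + 2) (c : Fin r → Bool), i ≤ N →
      Op (G := BG N r) (blay N r) 0 ∅ ((⟨i, hi⟩ : Fin (N+2)), c) := by
    intro i
    induction i with
    | zero => intro hi c _; exact Op.base _ rfl (by simp)
    | succ i ih =>
      intro hi c h
      exact Op.step _ _ (ih (by omega) c (by omega)) (Or.inl ⟨rfl, h, fun _ _ => rfl⟩) (by simp)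
  have hpath : ∀ t ≤ τ, ReflTransGen (E (blay N r) (K * 2^r) 0 N) ∅ (P t) := by
    intro t
    induction t with
    | zero => intro _; rw [hP.1]
    | succ t ih =>
      intro ht
      refine (ih (by omega)).tail ⟨hP.2 t (by omega), ?_, ?_⟩
      · exact lt_of_le_of_lt (Finset.card_le_card (Finset.filter_subset _ _)) (hall t (by omega))
      · exact lt_of_le_of_lt (Finset.card_le_card (Finset.filter_subset _ _)) (hall _ ht)
  have hlast : ∀ t ≤ τ, ∀ c : Fin r → Bool, (((⟨N, by omega⟩ : Fin (N+2)), c) : Vt N r) ∉ P t := by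
    intro t ht c
    have h1 := hopen N (by omega) c le_rfl
    exact (main H K le_rfl 0 N (by omega) le_rfl ∅ (P t) (hpath t ht) ⟨_, rfl, h1⟩).1 _ rfl h1
  have htop : ∀ t ≤ τ, ∀ c : Fin r → Bool, (((⟨N+1, by omega⟩ : Fin (N+2)), c) : Vt N r) ∉ P t := by
    intro t
    induction t with
    | zero => intro _ c; rw [hP.1]; exact Finset.notMem_empty _
    | succ t ih =>
      intro ht c hmem
      rcases hP.2 t (by omega) with ⟨v, _, hp, he⟩ | ⟨v, _, hp, he⟩
      · rw [he] at hmem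
        rcases Finset.mem_insert.1 hmem with h | h
        · subst h
          exact hlast t (by omega) c (hp _ (Or.inr (Or.inl ⟨rfl, rfl, rfl⟩)))
        · exact ih (by omega) c h
      · rw [he] at hmem
        exact ih (by omega) c (Finset.mem_of_mem_erase hmem)
  exact htop τ le_rfl _ (by rw [hz]; exact Finset.mem_singleton_self _)

theorem bg_black {N r : ℕ} : (BG N r).black (bz N r) ≤ 2 * 2^r := by
  classical
  have hpos := Nat.two_pow_pos r
  let L : ℕ → Finset (BG N r).V := fun i => Finset.univ.filter (fun v => blay N r v = i)
  let T : ℕ → Finset (BG N r).V := fun j =>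
    Finset.univ.filter (fun v : Vt N r => v.1.val = N+1 ∧ (num r v.2).val < j)
  have hLm : ∀ i v, v ∈ L i → v.1.val = i := fun i v hv => (Finset.mem_filter.1 hv).2
  have hTm : ∀ j v, v ∈ T j → v.1.val = N + 1 ∧ (num r v.2).val < j :=
    fun j v hv => (Finset.mem_filter.1 hv).2
  have hL : ∀ i, (L i).card ≤ 2^r := by
    intro i
    have : (L i).card ≤ (Finset.univ : Finset (Fin r → Bool)).card := by
      refine Finset.card_le_card_of_injOn (fun v : Vt N r => v.2) (fun _ _ => by simp) ?_
      intro u hu v hv huv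
      have hu := hLm i u hu
      have hv := hLm i v hv
      exact Prod.ext (Fin.ext (by omega)) huv
    simpa using this
  have hTL : ∀ j, T j ⊆ L (N+1) := by
    intro j v hv
    exact Finset.mem_filter.2 ⟨Finset.mem_univ _, (hTm j v hv).1⟩
  have hLT : ∀ i j, (L i ∪ T j).card ≤ 2 * 2^r := by
    intro i j
    have h1 := Finset.card_union_le (L i) (T j)
    have h2 := Finset.card_le_card (hTL j)
    have h3 := hL i
    have h4 := hL (N+1)
    omega
  have hLL : ∀ i j, (L i ∪ L j).card ≤ 2 * 2^r := by
    intro i j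
    have h1 := Finset.card_union_le (L i) (L j)
    have h3 := hL i
    have h4 := hL j
    omega
  have hlay : ∀ i ≤ N, ReflTransGen (SR (BG N r) (2 * 2^r)) ∅ (L i) := by
    intro i
    induction i with
    | zero =>
      intro _
      have := sr_add (G := BG N r) (M := 2 * 2^r) ∅ (L 0) (fun v hv u hu => by
        exfalso
        have hv := hLm _ v hv
        rcases hu with ⟨h1, h2, _⟩ | ⟨h1, h2, _⟩ | ⟨h1, h2, h3⟩ <;> omega) (by
          rw [Finset.empty_union]; have := hL 0; omega)
      rwa [Finset.empty_union] at this
    | succ i ih =>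
      intro hi
      have h1 := sr_add (G := BG N r) (M := 2 * 2^r) (L i) (L (i+1)) (fun v hv u hu => by
        have hv := hLm _ v hv
        refine Finset.mem_filter.2 ⟨Finset.mem_univ _, ?_⟩
        show u.1.val = i
        rcases hu with ⟨h1, h2, _⟩ | ⟨h1, h2, _⟩ | ⟨h1, h2, h3⟩ <;> omega) (hLL _ _)
      exact ((ih (by omega)).trans h1).trans (sr_subset Finset.subset_union_right (hLL _ _))
  have htop : ∀ j, ReflTransGen (SR (BG N r) (2 * 2^r)) (L N) (L N ∪ T j) := by
    intro j
    induction j with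
    | zero =>
      have : T 0 = ∅ := Finset.eq_empty_of_forall_notMem fun v hv => absurd (hTm 0 v hv).2 (by omega)
      rw [this, Finset.union_empty]
    | succ j ih =>
      have hTT : L N ∪ T j ∪ T (j+1) = L N ∪ T (j+1) := by
        rw [Finset.union_assoc]
        congr 1
        apply Finset.union_eq_right.2
        intro v hv
        have hv := hTm _ v hv
        exact Finset.mem_filter.2 ⟨Finset.mem_univ _, hv.1, by omega⟩
      have h1 := sr_add (G := BG N r) (M := 2 * 2^r) (L N ∪ T j) (T (j+1)) (fun v hv u hu => by
        obtain ⟨hv1, hv2⟩ := hTm _ v hv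
        rcases hu with ⟨h1, h2, _⟩ | ⟨h1, h2, _⟩ | ⟨h1, h2, h3⟩
        · omega
        · exact Finset.mem_union_left _ (Finset.mem_filter.2 ⟨Finset.mem_univ _, h2⟩)
        · exact Finset.mem_union_right _
            (Finset.mem_filter.2 ⟨Finset.mem_univ _, h2, by omega⟩)) (by rw [hTT]; exact hLT _ _)
      rw [hTT] at h1
      exact ih.trans h1
  refine black_le (by omega) _ (((hlay N le_rfl).trans (htop (2^r))).trans (sr_subset ?_ (hLT _ _)))
  refine Finset.singleton_subset_iff.2 (Finset.mem_union_right _ (Finset.mem_filter.2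
    ⟨Finset.mem_univ _, rfl, Fin.isLt _⟩))

theorem D_eq (M r k : ℕ) : D M r k + (2 * (M * (r+1)) + 1) = 2^k * (2 * (M * (r+1)) + 1) := by
  induction k with
  | zero => simp [D]
  | succ k ih => rw [D, pow_succ]; nlinarith

end Sep

namespace Sep

theorem arith {ε C : ℝ} (hε : 0 < ε) (hC : 0 < C) {n s r : ℕ} (hn : 1 ≤ n)
    (hsC : (s : ℝ) ≤ C * (n : ℝ) ^ ((1 : ℝ) / 2 - ε)) (hl1 : 1 ≤ Real.logb 2 (n : ℝ))
    (hl2 : 2 / ε ≤ Real.logb 2 (n : ℝ))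
    (hA : C^2 * (4 * ε + 3) * (Real.logb 2 (n : ℝ))^2 ≤ (n : ℝ)^ε)
    (hws : 2^r ≤ s) (hsw : s < 2 * 2^r) :
    ∃ K : ℕ, (2^K * (2 * (K * 2^r * (r+1)) + 1) + 2) * 2^r ≤ n ∧
      ε / 4 * (s : ℝ) * Real.logb 2 (n : ℝ) ≤ ((K * 2^r : ℕ) : ℝ) := by
  set l := Real.logb 2 (n : ℝ) with hl
  have hn0 : (0 : ℝ) < n := by exact_mod_cast hn
  have hn1 : (1 : ℝ) ≤ n := by exact_mod_cast hn
  have hw1 : (1 : ℝ) ≤ (2:ℝ)^r := one_le_pow₀ (by norm_num)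
  have hws' : (2:ℝ)^r ≤ s := by exact_mod_cast hws
  have hsw' : (s:ℝ) ≤ 2 * (2:ℝ)^r := by exact_mod_cast hsw.le
  have hw2 : ((2:ℝ)^r)^2 * (n:ℝ)^ε ≤ C^2 * (n : ℝ)^(1 - ε) := by
    have h1 : ((2:ℝ)^r)^2 ≤ (C * (n : ℝ) ^ ((1 : ℝ) / 2 - ε))^2 := by
      have := hws'.trans hsC
      gcongr
    have h2 : (C * (n : ℝ) ^ ((1 : ℝ) / 2 - ε))^2 * (n:ℝ)^ε = C^2 * (n : ℝ)^(1 - ε) := by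
      rw [mul_pow, ← Real.rpow_natCast ((n : ℝ) ^ ((1 : ℝ) / 2 - ε)) 2, ← Real.rpow_mul hn0.le,
        mul_assoc, ← Real.rpow_add hn0]
      congr 2; push_cast; ring
    rw [← h2]; gcongr
  have hnn : (n : ℝ)^(1 - ε) * (n : ℝ)^ε = n := by
    rw [← Real.rpow_add hn0]; simp
  have hl_sq : 1 ≤ l^2 := one_le_pow₀ hl1
  have hpos : 0 < (n : ℝ)^(1 - ε) := Real.rpow_pos_of_pos hn0 _
  have hposε : 1 ≤ (n : ℝ)^ε := Real.one_le_rpow hn1 hε.le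
  have hbig : ((2:ℝ)^r)^2 * (n:ℝ)^ε * ((4 * ε + 3) * l^2) ≤ n := by
    calc _ ≤ C^2 * (n : ℝ)^(1 - ε) * ((4 * ε + 3) * l^2) := by gcongr
      _ = (n : ℝ)^(1 - ε) * (C^2 * (4 * ε + 3) * l^2) := by ring
      _ ≤ (n : ℝ)^(1 - ε) * (n : ℝ)^ε := by gcongr
      _ = n := hnn
  have hwn : (2:ℝ)^r ≤ n := by
    refine le_trans ?_ hbig
    have h1 : 1 ≤ (4 * ε + 3) * l^2 := by nlinarith
    calc (2:ℝ)^r ≤ ((2:ℝ)^r)^2 := by nlinarith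
      _ = ((2:ℝ)^r)^2 * 1 * 1 := by ring
      _ ≤ _ := by gcongr
  have hrl : (r : ℝ) ≤ l := by
    rw [hl, Real.le_logb_iff_rpow_le (by norm_num) hn0, Real.rpow_natCast]; exact hwn
  have hεl : 0 ≤ ε * l := by positivity
  refine ⟨⌊ε * l⌋₊, ?_, ?_⟩
  · have hK : ((⌊ε * l⌋₊ : ℕ) : ℝ) ≤ ε * l := Nat.floor_le hεl
    set K := ⌊ε * l⌋₊
    have h2K : (2:ℝ)^K ≤ (n:ℝ)^ε := by
      rw [← Real.rpow_natCast]
      calc (2:ℝ)^(K:ℝ) ≤ (2:ℝ)^(l * ε) :=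
            Real.rpow_le_rpow_of_exponent_le (by norm_num) (by linarith)
        _ = (n:ℝ)^ε := by
            rw [Real.rpow_mul (by norm_num), hl, Real.rpow_logb (by norm_num) (by norm_num) hn0]
    have h2K1 : (1:ℝ) ≤ (2:ℝ)^K := one_le_pow₀ (by norm_num)
    have hfac : 2 * ((K:ℝ) * (r+1)) + 3 ≤ (4 * ε + 3) * l^2 := by
      have : (K:ℝ) * (r+1) ≤ (ε * l) * (2 * l) := by
        apply mul_le_mul hK (by linarith) (by positivity) hεl
      nlinarith
    have : ((2:ℝ)^K * (2 * (K * (2:ℝ)^r * (r+1)) + 1) + 2) * (2:ℝ)^r ≤ n := by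
      refine le_trans ?_ hbig
      have e1 : (2:ℝ)^K * (2 * (K * (2:ℝ)^r * (r+1)) + 1) + 2
          ≤ (2:ℝ)^K * ((2:ℝ)^r * (2 * ((K:ℝ) * (r+1)) + 3)) := by
        have : 1 ≤ (2:ℝ)^K * (2:ℝ)^r := by nlinarith
        have : (2:ℝ)^K ≤ (2:ℝ)^K * (2:ℝ)^r := by nlinarith
        nlinarith
      calc _ ≤ (2:ℝ)^K * ((2:ℝ)^r * (2 * ((K:ℝ) * (r+1)) + 3)) * (2:ℝ)^r := by gcongr
        _ = ((2:ℝ)^r)^2 * (2:ℝ)^K * (2 * ((K:ℝ) * (r+1)) + 3) := by ring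
        _ ≤ _ := by gcongr
    exact_mod_cast this
  · have hK : ε * l / 2 ≤ ((⌊ε * l⌋₊ : ℕ) : ℝ) := by
      have h1 := Nat.lt_floor_add_one (ε * l)
      have h2 : 2 ≤ ε * l := by
        rw [div_le_iff₀ hε] at hl2; linarith
      linarith
    push_cast
    calc ε / 4 * (s:ℝ) * l ≤ ε / 4 * (2 * (2:ℝ)^r) * l := by gcongr
      _ = ε * l / 2 * (2:ℝ)^r := by ring
      _ ≤ _ := by gcongr

end Sep

/-- Separation between standard and reversible pebbling
(Theorem 1.1 / `th:separation-standard-reversible`). -/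
theorem separation_standard_reversible
    (ε : ℝ) (hε : 0 < ε) (s : ℕ → ℕ) (hs : ∀ n, 2 ≤ s n)
    (hupper : ∃ C : ℝ, 0 < C ∧ ∃ n₁ : ℕ, ∀ n : ℕ, n₁ ≤ n →
      (s n : ℝ) ≤ C * (n : ℝ) ^ ((1 : ℝ) / 2 - ε)) :
    ∃ c₁ c₂ c₃ c₄ : ℝ, 0 < c₁ ∧ 0 < c₂ ∧ 0 < c₃ ∧ 0 < c₄ ∧
      ∃ (n₀ : ℕ) (G : ℕ → Dgraph) (z : (n : ℕ) → (G n).V),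
        ∀ n : ℕ, n₀ ≤ n →
          (G n).Acyclic ∧ (G n).UniqueSink (z n) ∧ (G n).InDegLe2 ∧
          c₁ * (n : ℝ) ≤ (Fintype.card (G n).V : ℝ) ∧
          (Fintype.card (G n).V : ℝ) ≤ c₂ * (n : ℝ) ∧
          ((G n).black (z n) : ℝ) ≤ c₃ * (s n : ℝ) ∧
          c₄ * (s n : ℝ) * Real.logb 2 (n : ℝ) ≤ ((G n).pers (z n) : ℝ) := by
  obtain ⟨C, hC, n₁, hsC⟩ := hupper
  have hev : ∀ᶠ n : ℕ in Filter.atTop, n₁ ≤ n ∧ 1 ≤ n ∧ 1 ≤ Real.logb 2 (n : ℝ) ∧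
      2 / ε ≤ Real.logb 2 (n : ℝ) ∧
      C^2 * (4 * ε + 3) * (Real.logb 2 (n : ℝ))^2 ≤ (n : ℝ)^ε := by
    have hlog : Filter.Tendsto (fun n : ℕ => Real.logb 2 (n : ℝ)) Filter.atTop Filter.atTop :=
      (Real.tendsto_logb_atTop (by norm_num)).comp tendsto_natCast_atTop_atTop
    have ho := (isLittleO_log_rpow_rpow_atTop 2 hε).comp_tendsto
      (tendsto_natCast_atTop_atTop (R := ℝ))
    have hL : 0 < Real.log 2 := Real.log_pos (by norm_num)
    have hA : 0 < C^2 * (4 * ε + 3) / (Real.log 2)^2 := by positivity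
    have hb := ho.bound (inv_pos.2 hA)
    filter_upwards [Filter.eventually_ge_atTop n₁, Filter.eventually_ge_atTop 1,
      hlog.eventually_ge_atTop 1, hlog.eventually_ge_atTop (2/ε), hb] with n h1 h2 h3 h4 h5
    refine ⟨h1, h2, h3, h4, ?_⟩
    simp only [Function.comp] at h5
    rw [Real.norm_of_nonneg (by positivity), Real.rpow_two, Real.norm_of_nonneg (by positivity)] at h5
    have h6 := mul_le_mul_of_nonneg_left h5 hA.le
    rw [mul_inv_cancel_left₀ hA.ne'] at h6
    refine le_trans (le_of_eq ?_) h6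
    unfold Real.logb
    field_simp
  obtain ⟨n₀, hn₀⟩ := Filter.eventually_atTop.1 hev
  refine ⟨1/2, 1, 2, ε/4, by norm_num, by norm_num, by norm_num, by positivity, n₀,
    fun n => Sep.BG (n / 2^(Nat.log 2 (s n)) - 2) (Nat.log 2 (s n)),
    fun n => Sep.bz _ _, fun n hn => ?_⟩
  obtain ⟨h1, h2, h3, h4, h5⟩ := hn₀ n hn
  have hr : 0 < Nat.log 2 (s n) := Nat.log_pos (by norm_num) (hs n)
  have hws : 2 ^ Nat.log 2 (s n) ≤ s n := Nat.pow_log_le_self 2 (by have := hs n; omega)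
  have hsw : s n < 2 * 2 ^ Nat.log 2 (s n) := by
    have := Nat.lt_pow_succ_log_self (b := 2) (by norm_num) (s n)
    rw [Nat.succ_eq_add_one, pow_succ] at this; omega
  obtain ⟨K, hK1, hK2⟩ := Sep.arith hε hC h2 (hsC n h1) h3 h4 h5 hws hsw
  set r := Nat.log 2 (s n)
  have hwpos := Nat.two_pow_pos r
  have hdiv := (Nat.le_div_iff_mul_le hwpos).2 hK1
  have hDK := Sep.D_eq (K * 2^r) r K
  have hge3 : 3 ≤ n / 2^r := by
    have : 0 < 2^K * (2 * (K * 2^r * (r+1)) + 1) := by positivity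
    omega
  have hcard : Fintype.card (Sep.BG (n / 2^r - 2) r).V = n / 2^r * 2^r := by
    rw [Sep.bg_card]; congr 1; omega
  have hcle : n / 2^r * 2^r ≤ n := Nat.div_mul_le_self n _
  have hcge : n ≤ 2 * (n / 2^r * 2^r) := by
    have e1 := Nat.div_add_mod n (2^r)
    have e2 := Nat.mod_lt n hwpos
    have e3 : 3 * 2^r ≤ n / 2^r * 2^r := Nat.mul_le_mul_right _ hge3
    rw [mul_comm (2^r)] at e1
    omega
  refine ⟨Sep.bg_acyclic _ _, Sep.bg_sink _ _, Sep.bg_indeg hr, ?_, ?_, ?_, ?_⟩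
  · rw [hcard]
    have : (n : ℝ) ≤ 2 * ((n / 2^r * 2^r : ℕ) : ℝ) := by exact_mod_cast hcge
    linarith
  · rw [hcard, one_mul]; exact_mod_cast hcle
  · have : (Sep.BG (n / 2^r - 2) r).black (Sep.bz _ _) ≤ 2 * s n := Sep.bg_black.trans (by omega)
    exact_mod_cast this
  · refine hK2.trans ?_
    have : K * 2^r ≤ (Sep.BG (n / 2^r - 2) r).pers (Sep.bz _ _) := Sep.bg_pers hr (by omega)
    exact_mod_cast this
end

section
/- Let G be a DAG with a unique sink z. If G has an unconditional standard pebbling (P₀ = ∅, …, P_τ) with z ∈ P_τ, of space p and time τ ≥ 2, then Pers(G) ≤ p·⌈log₂ τ⌉. -/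
namespace Dgraph

/-- A reversible step between configurations of size at most `s`. -/
def BStep (G : Dgraph) (s : ℕ) (A B : Finset G.V) : Prop :=
  G.RevStep A B ∧ A.card ≤ s ∧ B.card ≤ s

/-- Reversible reachability within space `s`. -/
def Reach (G : Dgraph) (s : ℕ) (A B : Finset G.V) : Prop :=
  Relation.ReflTransGen (G.BStep s) A B

theorem RevStep.symm' {G : Dgraph} (hG : G.Acyclic) {A B : Finset G.V} (h : G.RevStep A B) :
    G.RevStep B A := by
  rcases h with ⟨v, hv, hp, rfl⟩ | ⟨v, hv, hp, rfl⟩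
  · right
    refine ⟨v, Finset.mem_insert_self _ _, fun u hu => Finset.mem_insert_of_mem (hp u hu), ?_⟩
    rw [Finset.erase_insert hv]
  · left
    refine ⟨v, Finset.notMem_erase _ _, fun u hu => Finset.mem_erase.2 ⟨?_, hp u hu⟩, ?_⟩
    · rintro rfl
      exact hG _ (Relation.TransGen.single hu)
    · rw [Finset.insert_erase hv]

theorem Reach.symm' {G : Dgraph} (hG : G.Acyclic) {s : ℕ} {A B : Finset G.V}
    (h : G.Reach s A B) : G.Reach s B A := by
  induction h with
  | refl => exact Relation.ReflTransGen.refl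
  | tail _ h2 ih =>
    exact Relation.ReflTransGen.head ⟨h2.1.symm' hG, h2.2.2, h2.2.1⟩ ih

theorem Reach.mono {G : Dgraph} {s t : ℕ} (hst : s ≤ t) {A B : Finset G.V}
    (h : G.Reach s A B) : G.Reach t A B :=
  Relation.ReflTransGen.mono (fun _ _ h => ⟨h.1, h.2.1.trans hst, h.2.2.trans hst⟩) _ _ h

theorem RevStep.union {G : Dgraph} {A B : Finset G.V} (h : G.RevStep A B) (C : Finset G.V) :
    A ∪ C = B ∪ C ∨ G.RevStep (A ∪ C) (B ∪ C) := by
  rcases h with ⟨v, hv, hp, rfl⟩ | ⟨v, hv, hp, rfl⟩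
  · by_cases hC : v ∈ C
    · left; ext x; simp only [Finset.mem_union, Finset.mem_insert]; grind
    · right; left
      refine ⟨v, by simp [hv, hC], fun u hu => Finset.mem_union_left _ (hp u hu), ?_⟩
      rw [Finset.insert_union]
  · by_cases hC : v ∈ C
    · left; ext x; simp only [Finset.mem_union, Finset.mem_erase]; grind
    · right; right
      refine ⟨v, by simp [hv], fun u hu => Finset.mem_union_left _ (hp u hu), ?_⟩
      ext x; simp only [Finset.mem_union, Finset.mem_erase]; grind

theorem Reach.union {G : Dgraph} {s p : ℕ} {A B : Finset G.V} (h : G.Reach s A B)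
    (C : Finset G.V) (hC : C.card ≤ p) : G.Reach (s + p) (A ∪ C) (B ∪ C) := by
  induction h with
  | refl => exact Relation.ReflTransGen.refl
  | @tail X Y _ h2 ih =>
    rcases h2.1.union C with he | hs
    · rw [← he]; exact ih
    · refine Relation.ReflTransGen.tail ih ⟨hs, ?_, ?_⟩
      · exact (Finset.card_union_le _ _).trans (add_le_add h2.2.1 hC)
      · exact (Finset.card_union_le _ _).trans (add_le_add h2.2.2 hC)

/-- Sequences of configurations whose consecutive unions are one placement away. -/
structure Good (G : Dgraph) (p : ℕ) (Q : ℕ → Finset G.V) : Prop where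
  card : ∀ i, (Q i ∪ Q (i + 1)).card ≤ p
  step : ∀ i, Q i ∪ Q (i + 1) = Q i ∨
    ∃ v, v ∉ Q i ∧ (∀ u, G.edge u v → u ∈ Q i) ∧ Q i ∪ Q (i + 1) = insert v (Q i)

theorem Good.card' {G : Dgraph} {p : ℕ} {Q : ℕ → Finset G.V} (h : G.Good p Q) (i : ℕ) :
    (Q i).card ≤ p :=
  (Finset.card_le_card Finset.subset_union_left).trans (h.card i)

theorem Good.reach_one {G : Dgraph} {p : ℕ} {Q : ℕ → Finset G.V} (h : G.Good p Q) (i : ℕ) :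
    G.Reach p (Q i) (Q i ∪ Q (i + 1)) := by
  rcases h.step i with he | ⟨v, hv, hp, he⟩
  · rw [he]; exact Relation.ReflTransGen.refl
  · exact Relation.ReflTransGen.single ⟨Or.inl ⟨v, hv, hp, he⟩, h.card' i, h.card i⟩

theorem Good.reach_pow {G : Dgraph} (hG : G.Acyclic) {p : ℕ} {Q : ℕ → Finset G.V}
    (h : G.Good p Q) (d : ℕ) :
    ∀ a, G.Reach (p * (d + 1)) (Q a) (Q a ∪ Q (a + 2 ^ d)) := by
  induction d with
  | zero => intro a; simpa using h.reach_one a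
  | succ d ih =>
    intro a
    have h1 := ih a
    have h2 := ih (a + 2 ^ d)
    have hb : a + 2 ^ d + 2 ^ d = a + 2 ^ (d + 1) := by ring
    rw [hb] at h2
    have hs : p * (d + 1) + p = p * (d + 1 + 1) := by ring
    have h2' := h2.union (Q a) (h.card' a)
    have h3' := (h1.symm' hG).union (Q (a + 2 ^ (d + 1))) (h.card' _)
    rw [hs] at h2' h3'
    have e1 : Q (a + 2 ^ d) ∪ Q a = Q a ∪ Q (a + 2 ^ d) := Finset.union_comm _ _
    have e2 : Q (a + 2 ^ d) ∪ Q (a + 2 ^ (d + 1)) ∪ Q a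
        = Q a ∪ Q (a + 2 ^ d) ∪ Q (a + 2 ^ (d + 1)) := by
      ext x; simp only [Finset.mem_union]; tauto
    rw [e1, e2] at h2'
    exact ((h1.mono (by rw [← hs]; omega)).trans h2').trans h3'

theorem Good.reach_zero {G : Dgraph} (hG : G.Acyclic) {p : ℕ} {Q : ℕ → Finset G.V}
    (h : G.Good p Q) (h0 : Q 0 = ∅) (d : ℕ) :
    G.Reach (p * (d + 1)) ∅ (Q (2 ^ (d + 1))) := by
  induction d with
  | zero =>
    have h1 := h.reach_one 0
    have h2 := h.reach_one 1
    have hst := h.step 0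
    have hc := h.card 1
    have hc2 := h.card' 2
    rw [h0] at h1 hst
    simp only [Finset.empty_union, Nat.reduceAdd, zero_add, mul_one, pow_one] at *
    refine (h1.trans h2).trans ?_
    rcases hst with he | ⟨v, -, hp, he⟩
    · rw [he, Finset.empty_union]
    · have he' : Q 1 ∪ Q 2 = insert v (Q 2) := by
        rw [he]; ext x; simp
      by_cases hv : v ∈ Q 2
      · rw [he', Finset.insert_eq_of_mem hv]
      · rw [he'] at hc ⊢
        refine Relation.ReflTransGen.single ⟨Or.inr ⟨v, Finset.mem_insert_self _ _, ?_, ?_⟩, hc, hc2⟩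
        · intro u hu; exact absurd (hp u hu) (Finset.notMem_empty _)
        · rw [Finset.erase_insert hv]
  | succ d ih =>
    have h2 := h.reach_pow hG (d + 1) (2 ^ (d + 1))
    have hb : 2 ^ (d + 1) + 2 ^ (d + 1) = 2 ^ (d + 1 + 1) := by ring
    rw [hb] at h2
    have hs : p * (d + 1) + p = p * (d + 1 + 1) := by ring
    have h3 := (ih.symm' hG).union (Q (2 ^ (d + 1 + 1))) (h.card' _)
    rw [hs, Finset.empty_union] at h3
    exact ((ih.mono (by rw [← hs]; omega)).trans h2).trans h3

theorem Reach.exists_pebbling {G : Dgraph} {s : ℕ} {B : Finset G.V} (h : G.Reach s ∅ B) :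
    ∃ P τ, G.IsRevPebbling P τ ∧ P τ = B ∧ G.space P τ ≤ s := by
  induction h with
  | refl => exact ⟨fun _ => ∅, 0, ⟨rfl, fun t ht => absurd ht (Nat.not_lt_zero t)⟩, rfl, by simp [space]⟩
  | @tail X Y _ h2 ih =>
    obtain ⟨P, τ, ⟨hP0, hP⟩, rfl, hs⟩ := ih
    refine ⟨fun t => if t ≤ τ then P t else Y, τ + 1, ⟨by simp [hP0], ?_⟩, by simp, ?_⟩
    · intro t ht
      rcases Nat.lt_succ_iff_lt_or_eq.1 ht with h | rfl
      · have h' : t + 1 ≤ τ := h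
        simp only [h.le, h', if_true]; exact hP t h
      · simpa using h2.1
    · refine Finset.sup_le fun t ht => ?_
      by_cases h : t ≤ τ
      · simp only [h, if_true]
        exact (Finset.le_sup (f := fun t => (P t).card)
          (Finset.mem_range.2 (Nat.lt_succ_of_le h))).trans hs
      · simp only [h, if_false]; exact h2.2.2

theorem good_of_std {G : Dgraph} {z : G.V} {P : ℕ → Finset G.V} {τ p : ℕ}
    (hP : G.IsStdPebbling P τ) (hzP : z ∈ P τ) (hspace : G.space P τ = p) :
    G.Good p (fun t => if t < τ then P t else {z}) := by
  have hcard : ∀ t ≤ τ, (P t).card ≤ p := fun t ht => by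
    rw [← hspace]
    exact Finset.le_sup (f := fun t => (P t).card) (Finset.mem_range.2 (Nat.lt_succ_of_le ht))
  have key : ∀ t, t < τ → ∀ R ⊆ P (t + 1), (P t ∪ R).card ≤ p ∧ (P t ∪ R = P t ∨
      ∃ v, v ∉ P t ∧ (∀ u, G.edge u v → u ∈ P t) ∧ P t ∪ R = insert v (P t)) := by
    intro t ht R hR
    rcases hP.2 t ht with ⟨v, hv, hp, he⟩ | ⟨v, hv, he⟩
    · refine ⟨(Finset.card_le_card ?_).trans (hcard (t + 1) ht), ?_⟩
      · refine Finset.union_subset ?_ hR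
        rw [he]; exact Finset.subset_insert _ _
      · by_cases hvR : v ∈ R
        · right
          refine ⟨v, hv, hp, ?_⟩
          ext x
          have := @hR x
          rw [he] at this
          simp only [Finset.mem_union, Finset.mem_insert] at *
          grind
        · left
          refine Finset.union_eq_left.2 fun x hx => ?_
          have := hR hx
          rw [he, Finset.mem_insert] at this
          grind
    · have hsub : P t ∪ R = P t := by
        refine Finset.union_eq_left.2 fun x hx => ?_
        have := hR hx
        rw [he] at this
        exact Finset.mem_of_mem_erase this
      exact ⟨by rw [hsub]; exact hcard t ht.le, Or.inl hsub⟩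
  have all : ∀ i, ((if i < τ then P i else {z}) ∪ (if i + 1 < τ then P (i + 1) else {z})).card ≤ p ∧
      ((if i < τ then P i else {z}) ∪ (if i + 1 < τ then P (i + 1) else {z})
        = (if i < τ then P i else {z}) ∨
      ∃ v, v ∉ (if i < τ then P i else {z}) ∧
        (∀ u, G.edge u v → u ∈ (if i < τ then P i else {z})) ∧
        (if i < τ then P i else {z}) ∪ (if i + 1 < τ then P (i + 1) else {z})
          = insert v (if i < τ then P i else {z})) := by
    intro i
    by_cases h : i < τ
    · by_cases h' : i + 1 < τ
      · simp only [h, h', if_true]; exact key i h _ subset_rfl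
      · simp only [h, h', if_true, if_false]
        have : i + 1 = τ := by omega
        exact key i h _ (by rw [this]; simpa using hzP)
    · have h' : ¬ i + 1 < τ := by omega
      simp only [h, h', if_false, Finset.union_self]
      refine ⟨?_, Or.inl trivial⟩
      exact (Finset.card_le_card (by simpa using hzP)).trans (hcard τ le_rfl)
  exact ⟨fun i => (all i).1, fun i => (all i).2⟩

end Dgraph

/-- From a standard pebbling of space `p` and time `τ` one gets a reversible pebbling of
space at most `p·⌈log₂ τ⌉` (Theorem `th:reversible-from-standard`). -/
theorem reversible_from_standard
    (G : Dgraph) (hG : G.Acyclic) (z : G.V) (hz : G.UniqueSink z)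
    (P : ℕ → Finset G.V) (τ p : ℕ) (hP : G.IsStdPebbling P τ) (hzP : z ∈ P τ)
    (hspace : G.space P τ = p) (hτ : 2 ≤ τ) :
    G.pers z ≤ p * Nat.clog 2 τ := by
  have hgood := Dgraph.good_of_std hP hzP hspace
  obtain ⟨d, hd⟩ : ∃ d, Nat.clog 2 τ = d + 1 :=
    Nat.exists_eq_add_of_lt (Nat.clog_pos one_lt_two hτ) |>.imp fun d hd => by omega
  have hle : τ ≤ 2 ^ (d + 1) := by rw [← hd]; exact Nat.le_pow_clog one_lt_two τ
  have hr := hgood.reach_zero hG (by simp [hP.1, show 0 < τ by omega]) d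
  rw [if_neg (by omega)] at hr
  obtain ⟨R, σ, hR, hRz, hs⟩ := hr.exists_pebbling
  rw [hd]
  refine le_trans (Nat.sInf_le ?_) hs
  exact ⟨R, σ, hR, hRz, rfl⟩
end

section
/- For every integer h ≥ 0, the persistent pebbling price of the pyramid of height h equals h + g⁻¹(h), and the persistent pebbling price of the complete binary tree of height h equals h + g⁻¹(h). -/
/-! ## Concrete graph families -/

/-- The function `g` with `g 1 = 0` and `g Δ = 2^(g (Δ-1) + Δ - 2) + g (Δ-1)` for `Δ ≥ 2`. -/
def g : ℕ → ℕ
  | 0 => 0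
  | 1 => 0
  | (n+2) => 2 ^ (g (n+1) + n) + g (n+1)

/-- `ginv h = min {Δ ≥ 1 | g Δ ≥ h}`. -/
noncomputable def ginv (h : ℕ) : ℕ := sInf { Δ : ℕ | 1 ≤ Δ ∧ h ≤ g Δ }

/-- The pyramid of height `h`: vertices `(i,j)` with `i ≤ j ≤ h`, vertex `(i,j)` is
at level `i`, with edges `(i,j) → (i+1,j)` and `(i,j) → (i+1,j+1)` (when the target
is a vertex). -/
def pyramid (h : ℕ) : Dgraph where
  V := {p : Fin (h+1) × Fin (h+1) // (p.1 : ℕ) ≤ (p.2 : ℕ)}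
  edge u v := (v.1.1 : ℕ) = (u.1.1 : ℕ) + 1 ∧
    ((v.1.2 : ℕ) = (u.1.2 : ℕ) ∨ (v.1.2 : ℕ) = (u.1.2 : ℕ) + 1)

/-- The sink `(h,h)` of the pyramid of height `h`. -/
def pyramidSink (h : ℕ) : (pyramid h).V := ⟨(Fin.last h, Fin.last h), le_refl _⟩

/-- The complete binary tree of height `h`, with edges directed towards the root:
the vertex `⟨k, j⟩` is the `j`-th node at depth `k`, and its parent is `⟨k-1, j/2⟩`. -/
def bintree (h : ℕ) : Dgraph where
  V := Σ k : Fin (h+1), Fin (2 ^ (k : ℕ))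
  edge u v := (u.1 : ℕ) = (v.1 : ℕ) + 1 ∧ (u.2 : ℕ) / 2 = (v.2 : ℕ)

/-- The root (unique sink) of the complete binary tree. -/
def bintreeRoot (h : ℕ) : (bintree h).V := ⟨0, ⟨0, by positivity⟩⟩

/-- The chain of width `w` and length `ℓ`: layers `0,…,ℓ` of `w` vertices each, where the
`j`-th vertex of layer `i ≥ 1` has incoming edges from the `j`-th and `(j+1 mod w)`-th
vertices of layer `i-1`. -/
def chainDag (w ℓ : ℕ) : Dgraph where
  V := Fin (ℓ+1) × Fin w
  edge u v := (v.1 : ℕ) = (u.1 : ℕ) + 1 ∧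
    ((u.2 : ℕ) = (v.2 : ℕ) ∨ (u.2 : ℕ) = ((v.2 : ℕ) + 1) % w)

/-- The road of width `w` and length `ℓ`: a chain of width `w` and length `ℓ-w+1`
(layers `0,…,ℓ-w+1`) followed by a pyramid of height `w-1` whose sources are the vertices
of layer `ℓ-w+1`; layer `i` consists of the vertices `(i,j)` with `i + j ≤ ℓ`, `j < w`. -/
def road (w ℓ : ℕ) : Dgraph where
  V := {p : Fin (ℓ+1) × Fin w // (p.1 : ℕ) + (p.2 : ℕ) ≤ ℓ}
  edge u v := (v.1.1 : ℕ) = (u.1.1 : ℕ) + 1 ∧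
    ((u.1.2 : ℕ) = (v.1.2 : ℕ) ∨ (u.1.2 : ℕ) = ((v.1.2 : ℕ) + 1) % w)

/-- The sink of the road: the single vertex on the last layer. -/
def roadSink (w ℓ : ℕ) (hw : 0 < w) : (road w ℓ).V :=
  ⟨(Fin.last ℓ, ⟨0, hw⟩), by simp⟩

/-- The directed path of length `h`: vertices `0,…,h` and edges `i → i+1`. -/
def pathDag (h : ℕ) : Dgraph where
  V := Fin (h+1)
  edge u v := (v : ℕ) = (u : ℕ) + 1

/-- The sink of the directed path. -/
def pathSink (h : ℕ) : (pathDag h).V := Fin.last h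

/-- The `(h,ℓ)`-teabag: the pyramid of height `h` with a directed path of length `ℓ`
appended to its sink.  Layer `t ≤ h` consists of the pyramid vertices `(t,j)`, `t ≤ j ≤ h`,
and layer `t > h` consists of the single path vertex `(t,h)`. -/
def teabag (h ℓ : ℕ) : Dgraph where
  V := {p : Fin (h+ℓ+1) × Fin (h+1) //
          ((p.1 : ℕ) ≤ h → (p.1 : ℕ) ≤ (p.2 : ℕ)) ∧ (h ≤ (p.1 : ℕ) → (p.2 : ℕ) = h)}
  edge u v := (v.1.1 : ℕ) = (u.1.1 : ℕ) + 1 ∧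
    ((v.1.2 : ℕ) = (u.1.2 : ℕ) ∨ (v.1.2 : ℕ) = (u.1.2 : ℕ) + 1)

/-- The sink of the `(h,ℓ)`-teabag: the final path vertex. -/
def teabagSink (h ℓ : ℕ) : (teabag h ℓ).V :=
  ⟨(Fin.last (h+ℓ), Fin.last h), by refine ⟨fun hh => ?_, fun _ => ?_⟩ <;> simp_all⟩

/-- The molding `mold G` of a graph `G`: vertices `s` (= `none`), `v^in` (= `some (v,false)`)
and `v^out` (= `some (v,true)`) for `v ∈ V(G)`, with edges `v^in → v^out`,
`u^out → v^in` for every edge `(u,v)` of `G`, and `s → v^out` for every `v`. -/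
def mold (G : Dgraph) : Dgraph where
  V := Option (G.V × Bool)
  edge u v :=
    match u, v with
    | none, some (_, true) => True
    | some (a, false), some (b, true) => a = b
    | some (a, true), some (b, false) => G.edge a b
    | _, _ => False

/-- The special source `s` of `mold G`. -/
def moldSrc (G : Dgraph) : (mold G).V := none

/-- The vertex `v^out` of `mold G`. -/
def moldOut (G : Dgraph) (v : G.V) : (mold G).V := some (v, true)

/-! ## Lower bound: generic facts about walks -/

namespace PebLow

/-- A walk along a relation. -/
def Walk {σ : Type} (S : σ → σ → Prop) (X : ℕ → σ) : Prop := ∀ t, S (X t) (X (t+1))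

/-- `t` lies between `a` and `b` (in either order). -/
def Btw (a b t : ℕ) : Prop := (a ≤ t ∧ t ≤ b) ∨ (b ≤ t ∧ t ≤ a)

lemma rev_walk {σ : Type} {S : σ → σ → Prop} (hs : ∀ x y, S x y → S y x) (hr : ∀ x, S x x)
    {X : ℕ → σ} (hX : Walk S X) (a : ℕ) : Walk S (fun t => X (a - t)) := by
  intro t
  by_cases h : t + 1 ≤ a
  · have : a - t = a - (t+1) + 1 := by omega
    simp only [this]
    exact hs _ _ (hX _)
  · have h1 : a - t = 0 := by omega
    have h2 : a - (t+1) = 0 := by omega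
    simp only [h1, h2]
    exact hr _

lemma bidir {σ : Type} {S : σ → σ → Prop} (hs : ∀ x y, S x y → S y x) (hr : ∀ x, S x x)
    {A B C : σ → Prop}
    (H : ∀ X : ℕ → σ, Walk S X → ∀ a b, a ≤ b → A (X a) → B (X b) →
      ∃ t, a < t ∧ t ≤ b ∧ C (X t))
    (X : ℕ → σ) (hX : Walk S X) (a b : ℕ) (hA : A (X a)) (hB : B (X b)) :
    ∃ t, Btw a b t ∧ t ≠ a ∧ C (X t) := by
  rcases le_total a b with h | h
  · obtain ⟨t, h1, h2, h3⟩ := H X hX a b h hA hB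
    exact ⟨t, Or.inl ⟨h1.le, h2⟩, by omega, h3⟩
  · obtain ⟨t, h1, h2, h3⟩ := H (fun t => X (a - t)) (rev_walk hs hr hX a) 0 (a - b) (by omega)
      (by simpa using hA) (by have : a - (a - b) = b := by omega
                              simpa [this] using hB)
    exact ⟨a - t, Or.inr ⟨by omega, by omega⟩, by omega, h3⟩

lemma last_time (Q : ℕ → Prop) (a b : ℕ) (hab : a ≤ b) (ha : Q a) (hb : ¬ Q b) :
    ∃ t, a ≤ t ∧ t < b ∧ Q t ∧ ∀ s, t < s → s ≤ b → ¬ Q s := by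
  induction b, hab using Nat.le_induction with
  | base => exact absurd ha hb
  | succ b hab ih =>
    by_cases h : Q b
    · exact ⟨b, hab, by omega, h, fun s h1 h2 => by
        have : s = b + 1 := by omega
        rw [this]; exact hb⟩
    · obtain ⟨t, h1, h2, h3, h4⟩ := ih h
      refine ⟨t, h1, by omega, h3, fun s h5 h6 => ?_⟩
      rcases Nat.lt_or_ge b s with h7 | h7
      · have : s = b + 1 := by omega
        rw [this]; exact hb
      · exact h4 s h5 h7

/-! ## The path -/

/-- Parallel reversible steps on the infinite path. -/
def PStep (X Y : Set ℕ) : Prop :=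
  ∀ p, ¬ (p+1 ∈ X ↔ p+1 ∈ Y) → p ∈ X ∧ p ∈ Y

lemma PStep.symm (X Y : Set ℕ) (h : PStep X Y) : PStep Y X := fun p hp =>
  (h p (fun h' => hp h'.symm)).symm

lemma PStep.refl (X : Set ℕ) : PStep X X := fun _ hp => absurd Iff.rfl hp

open Classical in
/-- Number of pebbles in positions `q+1, …, q+l`. -/
noncomputable def pc (X : Set ℕ) (q l : ℕ) : ℕ := ((Finset.Ioc q (q+l)).filter (· ∈ X)).card

lemma pc_add (X : Set ℕ) (q l l' : ℕ) : pc X q (l + l') = pc X q l + pc X (q+l) l' := by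
  classical
  unfold pc
  rw [← Finset.card_union_of_disjoint]
  · congr 1
    ext x
    simp only [Finset.mem_filter, Finset.mem_Ioc, Finset.mem_union]
    constructor
    · rintro ⟨h1, h2⟩
      rcases Nat.lt_or_ge (q+l) x with h | h
      · right; exact ⟨by omega, h2⟩
      · left; exact ⟨by omega, h2⟩
    · rintro (⟨h1, h2⟩ | ⟨h1, h2⟩)
      · exact ⟨by omega, h2⟩
      · exact ⟨by omega, h2⟩
  · rw [Finset.disjoint_left]
    intro x hx hx'
    simp only [Finset.mem_filter, Finset.mem_Ioc] at hx hx'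
    omega

lemma pc_pos {X : Set ℕ} {q l p : ℕ} (h1 : q < p) (h2 : p ≤ q + l) (h : p ∈ X) :
    1 ≤ pc X q l := by
  classical
  exact Finset.card_pos.mpr ⟨p, by simp [h, h1, h2]⟩

lemma pc_zero {X : Set ℕ} {q l : ℕ} (h : ∀ p, q < p → p ≤ q + l → p ∉ X) : pc X q l = 0 := by
  classical
  refine Finset.card_eq_zero.mpr (Finset.filter_eq_empty_iff.mpr ?_)
  intro x hx
  rw [Finset.mem_Ioc] at hx
  exact h x hx.1 hx.2

lemma path_lower (m : ℕ) : ∀ (q : ℕ) (X : ℕ → Set ℕ), Walk PStep X → ∀ a b,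
    (∀ p, q < p → p ≤ q + 2^m → p ∉ X a) → q + 2^m ∈ X b →
    ∃ t, Btw a b t ∧ t ≠ a ∧ m < pc (X t) q (2^m) := by
  induction m with
  | zero =>
    intro q X hX a b h1 h2
    refine ⟨b, ?_, ?_, pc_pos (p := q + 2^0) (by simp) le_rfl h2⟩
    · unfold Btw; omega
    · rintro rfl
      exact h1 _ (by simp) le_rfl h2
  | succ m ih =>
    intro q
    refine bidir (A := fun Y => ∀ p, q < p → p ≤ q + 2^(m+1) → p ∉ Y)
      (B := fun Y => q + 2^(m+1) ∈ Y) (C := fun Y => m + 1 < pc Y q (2^(m+1)))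
      PStep.symm PStep.refl ?_
    intro X hX a b hab hA hB
    have h2 : 2^(m+1) = 2^m + 2^m := by ring
    have hpos : 0 < 2^m := by positivity
    by_contra hcon
    push Not at hcon
    obtain ⟨t1, h3, h4, h5, h6⟩ := last_time
      (fun t => ∀ p, q + 2^m < p → p ≤ q + 2^m + 2^m → p ∉ X t) a b hab
      (fun p hp hp' => hA p (by omega) (by omega))
      (fun h => h _ (by omega) le_rfl (by rw [h2, ← add_assoc] at hB; exact hB))
    have hup : ∀ s, t1 < s → s ≤ b → 1 ≤ pc (X s) (q+2^m) (2^m) := by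
      intro s hs hs'
      have := h6 s hs hs'
      push Not at this
      obtain ⟨p, hp1, hp2, hp3⟩ := this
      exact pc_pos hp1 hp2 hp3
    have hmid : q + 2^m ∈ X (t1+1) := by
      have := h6 (t1+1) (by omega) (by omega)
      push Not at this
      obtain ⟨p, hp1, hp2, hp3⟩ := this
      obtain ⟨p, rfl⟩ : ∃ p', p = p' + 1 := ⟨p - 1, by omega⟩
      have hst := hX t1 p (fun h => h5 _ hp1 hp2 (h.mpr hp3))
      by_cases hpp : q + 2^m < p
      · exact absurd hst.1 (h5 p hpp (by omega))
      · have : p = q + 2^m := by omega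
        rw [← this]; exact hst.2
    by_cases hlow : ∃ s, t1 < s ∧ s ≤ b ∧ ∀ p, q < p → p ≤ q + 2^m → p ∉ X s
    · obtain ⟨s, hs1, hs2, hs3⟩ := hlow
      obtain ⟨t, ht1, ht2, ht3⟩ := ih q X hX s (t1+1) hs3 hmid
      have ht : t1 < t ∧ t ≤ b := by unfold Btw at ht1; omega
      have := hup t ht.1 ht.2
      have hc := hcon t (by omega) ht.2
      rw [h2, pc_add] at hc
      omega
    · push Not at hlow
      obtain ⟨t, ht1, ht2, ht3⟩ := ih (q+2^m) X hX t1 b h5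
        (by rw [h2, ← add_assoc] at hB; exact hB)
      have ht : t1 < t ∧ t ≤ b := by unfold Btw at ht1; omega
      obtain ⟨p, hp1, hp2, hp3⟩ := hlow t ht.1 ht.2
      have := pc_pos hp1 hp2 hp3
      have hc := hcon t (by omega) ht.2
      rw [h2, pc_add] at hc
      omega

/-! ## The infinite pyramid

The vertex `(n, d)` is at level `n`; the predecessors of `(n+1, d)` are `(n, d)` and `(n, d+1)`. -/

/-- Parallel reversible steps. -/
def GStep (P Q : Finset (ℕ × ℕ)) : Prop :=
  ∀ n d, ¬ ((n+1, d) ∈ P ↔ (n+1, d) ∈ Q) →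
    ((n, d) ∈ P ∧ (n, d) ∈ Q) ∧ ((n, d+1) ∈ P ∧ (n, d+1) ∈ Q)

lemma GStep.symm (P Q : Finset (ℕ × ℕ)) (h : GStep P Q) : GStep Q P := fun n d hp =>
  ⟨(h n d (fun h' => hp h'.symm)).1.symm, (h n d (fun h' => hp h'.symm)).2.symm⟩

lemma GStep.refl (P : Finset (ℕ × ℕ)) : GStep P P := fun _ _ hp => absurd Iff.rfl hp

/-- There is a pebble-free path from a source to `(n, d)`. -/
def Op (P : Finset (ℕ × ℕ)) : ℕ → ℕ → Prop
  | 0, d => (0, d) ∉ P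
  | n+1, d => (n+1, d) ∉ P ∧ (Op P n d ∨ Op P n (d+1))

lemma Op.notMem {P : Finset (ℕ × ℕ)} {n d : ℕ} (h : Op P n d) : (n, d) ∉ P := by
  cases n with
  | zero => exact h
  | succ n => exact h.1

/-- Paths towards sources, as functions of the level. -/
def IsPath (e : ℕ → ℕ) : Prop := ∀ i, e i = e (i+1) ∨ e i = e (i+1) + 1

lemma Op.path {P : Finset (ℕ × ℕ)} {n d : ℕ} (h : Op P n d) :
    ∃ e : ℕ → ℕ, IsPath e ∧ (∀ i, n ≤ i → e i = d) ∧ ∀ i, i ≤ n → (i, e i) ∉ P := by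
  induction n generalizing d with
  | zero =>
    refine ⟨fun _ => d, fun i => Or.inl rfl, fun _ _ => rfl, fun i hi => ?_⟩
    have : i = 0 := by omega
    subst this; exact h
  | succ n ih =>
    have key : ∀ d', (d' = d ∨ d' = d + 1) → Op P n d' → ∃ e : ℕ → ℕ, IsPath e ∧
        (∀ i, n + 1 ≤ i → e i = d) ∧ ∀ i, i ≤ n + 1 → (i, e i) ∉ P := by
      intro d' hd' ho
      obtain ⟨e, h1, h2, h3⟩ := ih ho
      refine ⟨fun i => if i ≤ n then e i else d, ?_, ?_, ?_⟩
      · intro i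
        by_cases hi : i + 1 ≤ n
        · simp only [hi, (by omega : i ≤ n), if_true]; exact h1 i
        · by_cases hi' : i ≤ n
          · have : i = n := by omega
            subst this
            simp [h2 i le_rfl, hd']
          · simp [hi, hi']
      · intro i hi
        simp [show ¬ i ≤ n by omega]
      · intro i hi
        by_cases hi' : i ≤ n
        · simp only [hi', if_true]; exact h3 i hi'
        · have : i = n + 1 := by omega
          subst this
          simp only [hi', if_false]
          exact h.1
    rcases h.2 with h' | h'
    · exact key d (Or.inl rfl) h'
    · exact key (d+1) (Or.inr rfl) h'

lemma Op.up {P : Finset (ℕ × ℕ)} {e : ℕ → ℕ} (he : IsPath e) {i n : ℕ} (hin : i ≤ n)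
    (h : Op P i (e i)) (h' : ∀ j, i < j → j ≤ n → (j, e j) ∉ P) : Op P n (e n) := by
  induction n, hin using Nat.le_induction with
  | base => exact h
  | succ n hn ih =>
    have h1 := ih (fun j hj hj' => h' j hj (by omega))
    refine ⟨h' _ (by omega) le_rfl, ?_⟩
    rcases he n with h2 | h2
    · left; rw [← h2]; exact h1
    · right; rw [← h2]; exact h1

/-- Membership in the sub-pyramid with apex `(n, d)`. -/
def InP (n d : ℕ) (v : ℕ × ℕ) : Prop := d ≤ v.2 ∧ v.2 + v.1 ≤ d + n

instance (n d : ℕ) (v : ℕ × ℕ) : Decidable (InP n d v) := by unfold InP; infer_instance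

/-- Number of pebbles in the pyramid with apex `(n, d)`. -/
def N (P : Finset (ℕ × ℕ)) (n d : ℕ) : ℕ := (P.filter (InP n d)).card

/-- Number of pebbles strictly below the apex `(n, d)`. -/
def R (P : Finset (ℕ × ℕ)) (n d : ℕ) : ℕ := ((P.filter (InP n d)).erase (n, d)).card

lemma N_of_mem {P : Finset (ℕ × ℕ)} {n d : ℕ} (h : (n, d) ∈ P) : N P n d = R P n d + 1 := by
  unfold N R
  rw [Finset.card_erase_add_one]
  simp [h, InP]

lemma R_le_N (P : Finset (ℕ × ℕ)) (n d : ℕ) : R P n d ≤ N P n d :=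
  Finset.card_le_card (Finset.erase_subset _ _)

/-- A pebble on the side line added when going from apex `(n, d')` to apex `(n+1, d)`. -/
def Sig (P : Finset (ℕ × ℕ)) (n d d' : ℕ) : Prop :=
  ∃ v ∈ P, InP (n+1) d v ∧ ¬ InP n d' v ∧ v ≠ (n+1, d)

lemma not_sig {P : Finset (ℕ × ℕ)} {n d d' : ℕ} (hd : d' = d ∨ d' = d + 1)
    (h : ¬ Sig P n d d') : Op P n d ∨ Op P n (d+1) := by
  unfold Sig at h
  push Not at h
  rcases hd with rfl | rfl
  · right
    have key : ∀ k, k ≤ n → Op P k (d' + 1 + (n - k)) := by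
      intro k
      induction k with
      | zero =>
        intro _ hm
        have := h _ hm (by unfold InP; simp; omega) (by unfold InP; simp)
        simp at this
      | succ k ih =>
        intro hk
        refine ⟨fun hm => ?_, Or.inr ?_⟩
        · have := h _ hm (by unfold InP; simp; omega) (by unfold InP; simp; omega)
          simp at this; omega
        · have := ih (by omega)
          have e : d' + 1 + (n - (k+1)) + 1 = d' + 1 + (n - k) := by omega
          rw [e]; exact this
    simpa using key n le_rfl
  · left
    have key : ∀ k, k ≤ n → Op P k d := by
      intro k
      induction k with
      | zero =>
        intro _ hm
        have := h _ hm (by unfold InP; simp) (by unfold InP; simp)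
        simp at this
      | succ k ih =>
        intro hk
        refine ⟨fun hm => ?_, Or.inl (ih (by omega))⟩
        have := h _ hm (by unfold InP; simp; omega) (by unfold InP; simp)
        simp at this; omega
    exact key n le_rfl

lemma N_sig {P : Finset (ℕ × ℕ)} {n d d' : ℕ} (hd : d' = d ∨ d' = d + 1)
    (h : Sig P n d d') : N P n d' + 1 ≤ R P (n+1) d := by
  obtain ⟨v, h1, h2, h3, h4⟩ := h
  unfold N R
  rw [← Finset.card_insert_of_notMem (a := v) (by simp [h3])]
  apply Finset.card_le_card
  intro w hw
  rw [Finset.mem_insert] at hw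
  rcases hw with rfl | hw
  · simp [h1, h2, h4]
  · rw [Finset.mem_filter] at hw
    have h5 := hw.2
    rw [Finset.mem_erase, Finset.mem_filter]
    refine ⟨?_, hw.1, ?_⟩
    · rintro rfl
      unfold InP at h5; simp at h5; omega
    · unfold InP at h5 ⊢; omega

lemma pc_le (X : Set ℕ) (q l : ℕ) : pc X q l ≤ l := by
  classical
  unfold pc
  refine (Finset.card_filter_le _ _).trans ?_
  simp

lemma N_path {P : Finset (ℕ × ℕ)} {e : ℕ → ℕ} (he : IsPath e) (i l : ℕ)
    (h : ∀ j, i ≤ j → j < i + l → Sig P j (e (j+1)) (e j)) :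
    N P i (e i) + l + pc {p | (p, e p) ∈ P} i l ≤ N P (i+l) (e (i+l)) := by
  classical
  induction l with
  | zero => simp [pc]
  | succ l ih =>
    have h1 := ih (fun j hj hj' => h j hj (by omega))
    have h2 := N_sig (he (i+l)) (h (i+l) (by omega) (by omega))
    rw [pc_add]
    by_cases hm : (i + l + 1, e (i+l+1)) ∈ P
    · have h3 := N_of_mem hm
      have h4 : pc {p | (p, e p) ∈ P} (i+l) 1 ≤ 1 := by
        exact pc_le _ _ _
      change _ ≤ N P (i+l+1) (e (i+l+1))
      omega
    · have h3 := R_le_N P (i+l+1) (e (i+l+1))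
      have h4 : pc {p | (p, e p) ∈ P} (i+l) 1 = 0 := by
        apply pc_zero
        intro p hp hp'
        have : p = i + l + 1 := by omega
        subst this; exact hm
      change _ ≤ N P (i+l+1) (e (i+l+1))
      omega

/-- Visiting lower bound. -/
def VB (D n : ℕ) : Prop := ∀ d (X : ℕ → Finset (ℕ × ℕ)), Walk GStep X → ∀ a b,
  Op (X a) n d → (n, d) ∈ X b → ∃ t, Btw a b t ∧ t ≠ a ∧ n + D ≤ N (X t) n d

/-- Surrounding lower bound for an apex at level `n+1`. -/
def AB (D n : ℕ) : Prop := ∀ d (X : ℕ → Finset (ℕ × ℕ)), Walk GStep X → ∀ a b,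
  (Op (X a) n d ∨ Op (X a) n (d+1)) → ((n, d) ∈ X b ∧ (n, d+1) ∈ X b) →
  ∃ t, Btw a b t ∧ t ≠ a ∧ n + D + 1 ≤ R (X t) (n+1) d

lemma AB_of_VB {D n : ℕ} (h : VB D n) : AB D n := by
  intro d
  refine bidir (A := fun Y => Op Y n d ∨ Op Y n (d+1)) (B := fun Y => (n, d) ∈ Y ∧ (n, d+1) ∈ Y)
    (C := fun Y => n + D + 1 ≤ R Y (n+1) d) GStep.symm GStep.refl ?_
  intro X hX a b hab hA hB
  obtain ⟨t0, h1, h2, h3, h4⟩ := last_time (fun t => Op (X t) n d ∨ Op (X t) n (d+1)) a b hab hA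
    (fun h => h.elim (fun h => h.notMem hB.1) (fun h => h.notMem hB.2))
  have key : ∀ d', (d' = d ∨ d' = d+1) → Op (X t0) n d' → (n, d') ∈ X b →
      ∃ t, a < t ∧ t ≤ b ∧ n + D + 1 ≤ R (X t) (n+1) d := by
    intro d' hd' ho hm
    obtain ⟨t, h5, h6, h7⟩ := h d' X hX t0 b ho hm
    have ht : t0 < t ∧ t ≤ b := by unfold Btw at h5; omega
    refine ⟨t, by omega, ht.2, ?_⟩
    have h8 : Sig (X t) n d d' := by
      by_contra hc
      exact h4 t ht.1 ht.2 (not_sig hd' hc)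
    have := N_sig hd' h8
    omega
  rcases h3 with h3 | h3
  · exact key d (Or.inl rfl) h3 hB.1
  · exact key (d+1) (Or.inr rfl) h3 hB.2

lemma VB_succ {D n : ℕ} (h : VB D n) : VB D (n+1) := by
  intro d
  refine bidir (A := fun Y => Op Y (n+1) d) (B := fun Y => (n+1, d) ∈ Y)
    (C := fun Y => n + 1 + D ≤ N Y (n+1) d) GStep.symm GStep.refl ?_
  intro X hX a b hab hA hB
  obtain ⟨t0, h1, h2, h3, h4⟩ := last_time (fun t => (n+1, d) ∉ X t) a b hab hA.notMem
    (fun h => h hB)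
  have h5 := h4 (t0+1) (by omega) (by omega)
  push Not at h5
  have h6 := hX t0 n d (fun h => h3 (h.mpr h5))
  obtain ⟨t, h7, h8, h9⟩ := AB_of_VB h d X hX a (t0+1) hA.2 ⟨h6.1.2, h6.2.2⟩
  have ht : a < t ∧ t ≤ b := by unfold Btw at h7; omega
  refine ⟨t, ht.1, ht.2, ?_⟩
  have := R_le_N (X t) (n+1) d
  omega

lemma VB_of_le {D m n : ℕ} (h : VB D m) (hmn : m ≤ n) : VB D n := by
  induction n, hmn using Nat.le_induction with
  | base => exact h
  | succ n _ ih => exact VB_succ ih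

/-- The last moment at which the upper part of the path was empty. -/
lemma excursion {X : ℕ → Finset (ℕ × ℕ)} (hX : Walk GStep X) {e : ℕ → ℕ} (he : IsPath e)
    {i h t0 t : ℕ} (ht : t0 ≤ t)
    (h0 : ∀ m, i + 1 ≤ m → m ≤ h → (m, e m) ∉ X t0)
    (h1 : ∃ m, i + 1 ≤ m ∧ m ≤ h ∧ (m, e m) ∈ X t) :
    ∃ t', t0 ≤ t' ∧ t' < t ∧ ((i, e (i+1)) ∈ X (t'+1) ∧ (i, e (i+1) + 1) ∈ X (t'+1)) ∧
      ∀ s, t' < s → s ≤ t → ∃ m, i + 1 ≤ m ∧ m ≤ h ∧ (m, e m) ∈ X s := by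
  obtain ⟨t', h2, h3, h4, h5⟩ := last_time (fun s => ∀ m, i + 1 ≤ m → m ≤ h → (m, e m) ∉ X s)
    t0 t ht h0 (fun hh => by obtain ⟨m, hm1, hm2, hm3⟩ := h1; exact hh m hm1 hm2 hm3)
  have h6 : ∀ s, t' < s → s ≤ t → ∃ m, i + 1 ≤ m ∧ m ≤ h ∧ (m, e m) ∈ X s := by
    intro s hs hs'
    have := h5 s hs hs'
    push Not at this
    exact this
  refine ⟨t', h2, h3, ?_, h6⟩
  obtain ⟨m, hm1, hm2, hm3⟩ := h6 (t'+1) (by omega) (by omega)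
  obtain ⟨m, rfl⟩ : ∃ m', m = m' + 1 := ⟨m - 1, by omega⟩
  have h7 := hX t' m (e (m+1)) (fun hh => h4 _ hm1 hm2 (hh.mpr hm3))
  by_cases hmi : m = i
  · subst hmi
    exact ⟨h7.1.2, h7.2.2⟩
  · exfalso
    refine h4 m (by omega) (by omega) ?_
    rcases he m with h8 | h8
    · rw [h8]; exact h7.1.1
    · rw [h8]; exact h7.2.1

lemma VB_main {D g0 k : ℕ} (hV : VB D g0) (hk : k + 1 = g0 + D) :
    VB (D+1) (g0 + 2^k) := by
  intro d
  set h := g0 + 2^k with hh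
  have hpos : 0 < 2^k := by positivity
  refine bidir (A := fun Y => Op Y h d) (B := fun Y => (h, d) ∈ Y)
    (C := fun Y => h + (D + 1) ≤ N Y h d) GStep.symm GStep.refl ?_
  intro X hX a b hab hA hB
  by_contra hcon
  push Not at hcon
  obtain ⟨t0, h1, h2, h3, h4⟩ := last_time (fun t => Op (X t) h d) a b hab hA
    (fun h => h.notMem hB)
  obtain ⟨e, he, hed, hep⟩ := h3.path
  have heh : e h = d := hed h le_rfl
  rw [← heh] at h4
  -- the side lines are always pebbled
  have claim1 : ∀ r i, g0 ≤ i → i < h → h ≤ i + r → ∀ t, t0 < t → t ≤ b →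
      Sig (X t) i (e (i+1)) (e i) := by
    intro r
    induction r with
    | zero => intro i _ hi hi'; omega
    | succ r ih =>
      intro i hgi hih _ t ht htb
      by_contra hs
      have ho := not_sig (he i) hs
      have hex : ∃ m, i + 1 ≤ m ∧ m ≤ h ∧ (m, e m) ∈ X t := by
        by_contra hno
        push Not at hno
        refine h4 t ht htb (Op.up he (i := i+1) (by omega) ⟨hno _ le_rfl (by omega), ho⟩ ?_)
        intro j hj hj'
        exact hno j (by omega) hj'
      obtain ⟨t', h5, h6, h7, h8⟩ := excursion hX he ht.le
        (fun m _ hm => hep m hm) hex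
      obtain ⟨s, hs1, hs2, hs3⟩ := AB_of_VB (VB_of_le hV hgi) (e (i+1)) X hX t (t'+1) ho h7
      have hst : t' < s ∧ s ≤ t := by unfold Btw at hs1; omega
      obtain ⟨m, hm1, hm2, hm3⟩ := h8 s hst.1 hst.2
      have hN := N_path (P := X s) he (i+1) (h - (i+1)) (fun j hj hj' =>
        ih j (by omega) (by omega) (by omega) s (by omega) (by omega))
      rw [show i + 1 + (h - (i+1)) = h by omega, heh] at hN
      have hc := hcon s (by omega) (by omega)
      by_cases hmi : m = i + 1
      · subst hmi
        have := N_of_mem hm3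
        omega
      · have h9 := R_le_N (X s) (i+1) (e (i+1))
        have h10 := pc_pos (X := {p | (p, e p) ∈ X s}) (q := i+1) (l := h - (i+1)) (p := m)
          (by omega) (by omega) hm3
        omega
  have claim1' : ∀ t, t0 < t → t ≤ b → N (X t) g0 (e g0) + 2^k +
      pc {p | (p, e p) ∈ X t} g0 (2^k) < h + (D+1) := by
    intro t ht htb
    have hN := N_path (P := X t) he g0 (2^k) (fun j hj hj' =>
        claim1 h j hj hj' (by omega) t ht htb)
    rw [← hh, heh] at hN
    have := hcon t (by omega) htb
    omega
  -- the small pyramid is always blocked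
  have claim2 : ∀ t, t0 < t → t ≤ b → ¬ Op (X t) g0 (e g0) := by
    intro t ht htb ho
    have hex : ∃ m, g0 + 1 ≤ m ∧ m ≤ h ∧ (m, e m) ∈ X t := by
      by_contra hno
      push Not at hno
      exact h4 t ht htb (Op.up he (i := g0) (by omega) ho (fun j hj hj' => hno j hj hj'))
    obtain ⟨t', h5, h6, h7, h8⟩ := excursion hX he ht.le
      (fun m _ hm => hep m hm) hex
    have h9 : (g0, e g0) ∈ X (t'+1) := by
      rcases he g0 with h | h
      · rw [h]; exact h7.1
      · rw [h]; exact h7.2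
    obtain ⟨s, hs1, hs2, hs3⟩ := hV (e g0) X hX t (t'+1) ho h9
    have hst : t' < s ∧ s ≤ t := by unfold Btw at hs1; omega
    obtain ⟨m, hm1, hm2, hm3⟩ := h8 s hst.1 hst.2
    have h10 := pc_pos (X := {p | (p, e p) ∈ X s}) (q := g0) (l := 2^k) (p := m)
      (by omega) (by omega) hm3
    have := claim1' s (by omega) (by omega)
    omega
  -- path pebbling
  obtain ⟨t, ht1, ht2, ht3⟩ := path_lower k g0 (fun t => {p | (p, e p) ∈ X t}) (by
      intro t p hp
      have hst := hX t p (e (p+1)) hp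
      rcases he p with h | h
      · simp only [Set.mem_ofPred_eq]; rw [h]; exact hst.1
      · simp only [Set.mem_ofPred_eq]; rw [h]; exact hst.2) t0 b
    (fun p _ hp => hep p hp) (by
      simp only [Set.mem_ofPred_eq]
      rw [← hh, heh]; exact hB)
  have ht : t0 < t ∧ t ≤ b := by unfold Btw at ht1; omega
  have h11 := claim1' t ht.1 ht.2
  have h12 : 1 ≤ N (X t) g0 (e g0) := by
    by_contra hn
    apply claim2 t ht.1 ht.2
    have hz : (X t).filter (InP g0 (e g0)) = ∅ := by
      rw [← Finset.card_eq_zero]; unfold N at hn; omega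
    rw [Finset.filter_eq_empty_iff] at hz
    have key : ∀ n, n ≤ g0 → Op (X t) n (e g0) := by
      intro n
      induction n with
      | zero => intro _ hm; exact hz hm (by unfold InP; simp)
      | succ n ih =>
        intro hn
        exact ⟨fun hm => hz hm (by unfold InP; simp; omega), Or.inl (ih (by omega))⟩
    exact key g0 le_rfl
  omega

lemma VB_g (n : ℕ) : VB (n+1) (g (n+1)) := by
  induction n with
  | zero =>
    intro d X hX a b ha hb
    refine ⟨b, by unfold Btw; omega, ?_, ?_⟩
    · rintro rfl; exact ha.notMem hb
    · have := N_of_mem hb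
      simp only [g] at *
      omega
  | succ n ih =>
    have := VB_main ih (k := g (n+1) + n) (by omega)
    rw [show g (n+1+1) = g (n+1) + 2^(g (n+1) + n) by simp only [g]; omega]
    exact this

/-! ## Transfer to the finite pyramid -/

lemma revStep_changed {G : Dgraph} (hirr : ∀ v, ¬ G.edge v v) {P P' : Finset G.V}
    (h : G.RevStep P P') {v : G.V} (hv : ¬ (v ∈ P ↔ v ∈ P')) {u : G.V} (hu : G.edge u v) :
    u ∈ P ∧ u ∈ P' := by
  have huv : u ≠ v := by rintro rfl; exact hirr _ hu
  rcases h with ⟨w, h1, h2, rfl⟩ | ⟨w, h1, h2, rfl⟩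
  · have : v = w := by
      by_contra hne
      exact hv (by simp [hne])
    subst this
    exact ⟨h2 u hu, Finset.mem_insert_of_mem (h2 u hu)⟩
  · have : v = w := by
      by_contra hne
      exact hv (by simp [hne])
    subst this
    exact ⟨h2 u hu, Finset.mem_erase.mpr ⟨huv, h2 u hu⟩⟩

/-- Embedding of the pyramid into the infinite one. -/
def emb (h : ℕ) (v : (pyramid h).V) : ℕ × ℕ := ((v.1.1 : ℕ), (v.1.2 : ℕ) - (v.1.1 : ℕ))

lemma emb_inj (h : ℕ) : Function.Injective (emb h) := by
  rintro ⟨⟨a, b⟩, hab⟩ ⟨⟨c, d⟩, hcd⟩ heq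
  simp only [emb, Prod.mk.injEq] at heq hab hcd
  apply Subtype.ext
  apply Prod.ext
  · exact Fin.ext heq.1
  · apply Fin.ext
    change (b : ℕ) = d
    omega

lemma pyramid_irr (h : ℕ) (v : (pyramid h).V) : ¬ (pyramid h).edge v v := by
  intro hh
  have := hh.1
  omega

lemma emb_step {h : ℕ} {P P' : Finset (pyramid h).V} (hs : (pyramid h).RevStep P P') :
    GStep (P.image (emb h)) (P'.image (emb h)) := by
  intro n d hch
  obtain ⟨v, hv⟩ : ∃ v, emb h v = (n+1, d) := by
    by_contra hno
    push Not at hno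
    apply hch
    simp only [Finset.mem_image]
    constructor
    · rintro ⟨x, _, hx⟩; exact absurd hx (hno x)
    · rintro ⟨x, _, hx⟩; exact absurd hx (hno x)
  rw [← hv, (emb_inj h).mem_finset_image, (emb_inj h).mem_finset_image] at hch
  obtain ⟨⟨i, j⟩, hij⟩ := v
  simp only [emb, Prod.mk.injEq] at hv hij
  have hj := j.2
  have key : ∀ d', (d' = d ∨ d' = d + 1) →
      (n, d') ∈ P.image (emb h) ∧ (n, d') ∈ P'.image (emb h) := by
    intro d' hd'
    let u : (pyramid h).V := ⟨(⟨n, by omega⟩, ⟨n + d', by omega⟩), by simp⟩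
    have hu : emb h u = (n, d') := by simp [emb, u]
    have hedge : (pyramid h).edge u ⟨⟨i, j⟩, hij⟩ := by
      refine ⟨hv.1, ?_⟩
      change (j : ℕ) = n + d' ∨ (j : ℕ) = n + d' + 1
      omega
    have := revStep_changed (pyramid_irr h) hs hch hedge
    rw [← hu]
    exact ⟨Finset.mem_image_of_mem _ this.1, Finset.mem_image_of_mem _ this.2⟩
  exact ⟨key d (Or.inl rfl), key (d+1) (Or.inr rfl)⟩

lemma card_le_space {G : Dgraph} (P : ℕ → Finset G.V) {τ t : ℕ} (ht : t ≤ τ) :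
    (P t).card ≤ G.space P τ :=
  Finset.le_sup (f := fun t => (P t).card) (Finset.mem_range.mpr (by omega))

lemma pyr_lower {m n : ℕ} (hg : g (n+1) ≤ m) {P : ℕ → Finset (pyramid (m+1)).V} {τ : ℕ}
    (hP : (pyramid (m+1)).IsRevPebbling P τ) (hτ : P τ = {pyramidSink (m+1)}) :
    m + 1 + (n + 2) ≤ (pyramid (m+1)).space P τ := by
  set X : ℕ → Finset (ℕ × ℕ) := fun t => (P (min t τ)).image (emb (m+1)) with hXdef
  have hX : Walk GStep X := by
    intro t
    by_cases ht : t < τ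
    · have h1 : min t τ = t := by omega
      have h2 : min (t+1) τ = t + 1 := by omega
      simp only [hXdef, h1, h2]
      exact emb_step (hP.2 t ht)
    · have h1 : min t τ = τ := by omega
      have h2 : min (t+1) τ = τ := by omega
      simp only [hXdef, h1, h2]
      exact GStep.refl _
  have hsink : emb (m+1) (pyramidSink (m+1)) = (m+1, 0) := by simp [emb, pyramidSink]
  have hX0 : X 0 = ∅ := by simp [hXdef, hP.1]
  have hXτ : X τ = {(m+1, 0)} := by simp [hXdef, hτ, hsink]
  obtain ⟨t1, h1, h2, h3, h4⟩ := last_time (fun t => (m+1, 0) ∉ X t) 0 τ (by omega)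
    (by simp [hX0]) (by simp [hXτ])
  have h5 : ∀ s, t1 < s → s ≤ τ → (m+1, 0) ∈ X s := by
    intro s hs hs'
    have := h4 s hs hs'
    push Not at this
    exact this
  have h6 := hX t1 m 0 (fun hh => h3 (hh.mpr (h5 (t1+1) (by omega) (by omega))))
  have hop : ∀ k, k ≤ m → Op (X τ) k 0 := by
    intro k
    induction k with
    | zero => intro _; simp [Op, hXτ]
    | succ k ih =>
      intro hk
      refine ⟨?_, Or.inl (ih (by omega))⟩
      simp [hXτ]; omega
  obtain ⟨t, ht1, ht2, ht3⟩ := AB_of_VB (VB_of_le (VB_g n) hg) 0 X hX τ (t1+1)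
    (Or.inl (hop m le_rfl)) ⟨h6.1.2, h6.2.2⟩
  have ht : t1 < t ∧ t ≤ τ := by unfold Btw at ht1; omega
  have h7 := N_of_mem (h5 t ht.1 ht.2)
  have h8 : N (X t) (m+1) 0 ≤ (P (min t τ)).card :=
    (Finset.card_filter_le _ _).trans Finset.card_image_le
  have h9 := card_le_space (G := pyramid (m+1)) P (t := min t τ) (τ := τ) (by omega)
  omega

lemma g_ge (n : ℕ) : n ≤ g (n+1) := by
  induction n with
  | zero => simp
  | succ n ih =>
    have : 0 < 2^(g (n+1) + n) := by positivity
    simp only [g]; omega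

lemma ginv_spec (h : ℕ) : 1 ≤ ginv h ∧ h ≤ g (ginv h) :=
  Nat.sInf_mem (s := { Δ : ℕ | 1 ≤ Δ ∧ h ≤ g Δ }) ⟨h+1, by omega, g_ge h⟩

lemma ginv_min {h Δ : ℕ} (h1 : 1 ≤ Δ) (h2 : Δ < ginv h) : g Δ < h := by
  have := Nat.notMem_of_lt_sInf h2
  by_contra hc
  exact this ⟨h1, by omega⟩

lemma pyr_lower' (h : ℕ) {P : ℕ → Finset (pyramid h).V} {τ : ℕ}
    (hP : (pyramid h).IsRevPebbling P τ) (hτ : P τ = {pyramidSink h}) :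
    h + ginv h ≤ (pyramid h).space P τ := by
  have hs := ginv_spec h
  by_cases h1 : ginv h = 1
  · rw [h1] at hs ⊢
    have h0 : h = 0 := by have := hs.2; simp only [g] at this; omega
    have := card_le_space (G := pyramid h) P (le_refl τ)
    rw [hτ, Finset.card_singleton] at this
    omega
  · obtain ⟨n, hn⟩ : ∃ n, ginv h = n + 2 := ⟨ginv h - 2, by omega⟩
    have h2 := ginv_min (h := h) (Δ := n+1) (by omega) (by omega)
    obtain ⟨m, rfl⟩ : ∃ m, h = m + 1 := ⟨h - 1, by omega⟩
    rw [hn]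
    exact pyr_lower (by omega) hP hτ

end PebLow

/-! ## Upper bound -/

namespace PebUp

/-- Reachability with space at most `s`. -/
def Reach (G : Dgraph) (s : ℕ) : Finset G.V → Finset G.V → Prop :=
  Relation.ReflTransGen (fun A B => G.RevStep A B ∧ A.card ≤ s ∧ B.card ≤ s)

lemma Reach.mono {G : Dgraph} {s s' : ℕ} (hs : s ≤ s') {A B : Finset G.V} (h : Reach G s A B) :
    Reach G s' A B := by
  induction h with
  | refl => exact Relation.ReflTransGen.refl
  | tail _ h ih => exact Relation.ReflTransGen.tail ih ⟨h.1, h.2.1.trans hs, h.2.2.trans hs⟩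

lemma revStep_symm {G : Dgraph} (hirr : ∀ v, ¬ G.edge v v) {A B : Finset G.V}
    (h : G.RevStep A B) : G.RevStep B A := by
  rcases h with ⟨v, h1, h2, rfl⟩ | ⟨v, h1, h2, rfl⟩
  · right
    exact ⟨v, Finset.mem_insert_self _ _, fun u hu => Finset.mem_insert_of_mem (h2 u hu),
      (Finset.erase_insert h1).symm⟩
  · left
    refine ⟨v, Finset.notMem_erase _ _, fun u hu => Finset.mem_erase.mpr ⟨?_, h2 u hu⟩,
      (Finset.insert_erase h1).symm⟩
    rintro rfl
    exact hirr _ hu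

lemma Reach.symm {G : Dgraph} (hirr : ∀ v, ¬ G.edge v v) {s : ℕ} {A B : Finset G.V}
    (h : Reach G s A B) : Reach G s B A := by
  induction h with
  | refl => exact Relation.ReflTransGen.refl
  | tail _ h ih => exact Relation.ReflTransGen.head ⟨revStep_symm hirr h.1, h.2.2, h.2.1⟩ ih

lemma Reach.trans {G : Dgraph} {s : ℕ} {A B C : Finset G.V}
    (h : Reach G s A B) (h' : Reach G s B C) : Reach G s A C :=
  Relation.ReflTransGen.trans h h'

lemma Reach.place {G : Dgraph} {s : ℕ} {A : Finset G.V} {v : G.V}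
    (hv : v ∉ A) (hp : ∀ u, G.edge u v → u ∈ A) (hs : A.card + 1 ≤ s) :
    Reach G s A (insert v A) :=
  Relation.ReflTransGen.single ⟨Or.inl ⟨v, hv, hp, rfl⟩, by omega, by
    rw [Finset.card_insert_of_notMem hv]; exact hs⟩

lemma Reach.pebbling {G : Dgraph} {s : ℕ} {A : Finset G.V} (h : Reach G s ∅ A) :
    ∃ P τ, G.IsRevPebbling P τ ∧ P τ = A ∧ G.space P τ ≤ s := by
  suffices H : ∃ P τ, G.IsRevPebbling P τ ∧ P τ = A ∧ ∀ t ≤ τ, (P t).card ≤ s by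
    obtain ⟨P, τ, h1, h2, h3⟩ := H
    refine ⟨P, τ, h1, h2, Finset.sup_le ?_⟩
    intro t ht
    exact h3 t (by rw [Finset.mem_range] at ht; omega)
  induction h with
  | refl => exact ⟨fun _ => ∅, 0, ⟨rfl, by intro t ht; omega⟩, rfl, by simp⟩
  | @tail B C _ hBC ih =>
    obtain ⟨P, τ, h1, h2, h3⟩ := ih
    refine ⟨fun t => if t ≤ τ then P t else C, τ + 1, ⟨?_, ?_⟩, ?_, ?_⟩
    · simpa using h1.1
    · intro t ht
      by_cases htt : t < τ
      · simp only [htt.le, if_true, show t + 1 ≤ τ by omega]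
        exact h1.2 t htt
      · have : t = τ := by omega
        subst this
        simpa [h2] using hBC.1
    · simp
    · intro t ht
      by_cases htt : t ≤ τ
      · simpa [htt] using h3 t htt
      · simpa [htt] using hBC.2.2

lemma reach_of_pebbling {G : Dgraph} {P : ℕ → Finset G.V} {τ : ℕ} (h : G.IsRevPebbling P τ) :
    Reach G (G.space P τ) ∅ (P τ) := by
  have key : ∀ t, t ≤ τ → Reach G (G.space P τ) ∅ (P t) := by
    intro t
    induction t with
    | zero => intro _; rw [h.1]; exact Relation.ReflTransGen.refl
    | succ t ih =>
      intro ht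
      exact Relation.ReflTransGen.tail (ih (by omega)) ⟨h.2 t (by omega),
        PebLow.card_le_space P (by omega), PebLow.card_le_space P ht⟩
  exact key τ le_rfl

lemma pers_eq {G : Dgraph} {v : G.V} {s : ℕ} (h1 : Reach G s ∅ {v})
    (h2 : ∀ P τ, G.IsRevPebbling P τ → P τ = {v} → s ≤ G.space P τ) : G.pers v = s := by
  obtain ⟨P, τ, h3, h4, h5⟩ := h1.pebbling
  apply le_antisymm
  · refine le_trans (Nat.sInf_le ?_) h5
    exact ⟨P, τ, h3, h4, rfl⟩
  · apply le_csInf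
    · exact ⟨_, P, τ, h3, h4, rfl⟩
    · rintro _ ⟨P, τ, h6, h7, rfl⟩
      exact h2 P τ h6 h7

/-- Projecting pebblings along a map that lifts predecessors. -/
lemma Reach.image {G H : Dgraph} (φ : G.V → H.V)
    (hφ : ∀ x u, H.edge u (φ x) → ∃ y, G.edge y x ∧ φ y = u) (hirr : ∀ v, ¬ H.edge v v)
    {s : ℕ} {A B : Finset G.V} (h : Reach G s A B) :
    Reach H s (A.image φ) (B.image φ) := by
  have place : ∀ (A : Finset G.V) (v : G.V), (∀ u, G.edge u v → u ∈ A) →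
      (insert v A).card ≤ s → Reach H s (A.image φ) ((insert v A).image φ) := by
    intro A v hp hc
    rw [Finset.image_insert]
    by_cases hv : φ v ∈ A.image φ
    · rw [Finset.insert_eq_of_mem hv]; exact Relation.ReflTransGen.refl
    · apply Reach.place hv
      · intro u hu
        obtain ⟨y, hy, rfl⟩ := hφ v u hu
        exact Finset.mem_image_of_mem _ (hp y hy)
      · rw [← Finset.card_insert_of_notMem hv, ← Finset.image_insert]
        exact Finset.card_image_le.trans hc
  induction h with
  | refl => exact Relation.ReflTransGen.refl
  | @tail B C _ hBC ih =>
    refine ih.trans ?_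
    obtain ⟨hst, hc1, hc2⟩ := hBC
    rcases hst with ⟨v, h1, h2, rfl⟩ | ⟨v, h1, h2, rfl⟩
    · exact place _ v h2 hc2
    · by_cases hv : φ v ∈ (B.erase v).image φ
      · have : B.image φ = (B.erase v).image φ := by
          conv_lhs => rw [← Finset.insert_erase h1, Finset.image_insert]
          exact Finset.insert_eq_of_mem hv
        rw [this]; exact Relation.ReflTransGen.refl
      · refine Reach.symm hirr ?_
        have e : B.image φ = insert (φ v) ((B.erase v).image φ) := by
          conv_lhs => rw [← Finset.insert_erase h1, Finset.image_insert]
        have hc : (B.image φ).card ≤ s := Finset.card_image_le.trans hc1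
        rw [e] at hc ⊢
        apply Reach.place hv
        · intro u hu
          have hne : u ≠ φ v := by rintro rfl; exact hirr _ hu
          obtain ⟨y, hy, rfl⟩ := hφ v u hu
          refine Finset.mem_image_of_mem _ (Finset.mem_erase.mpr ⟨?_, h2 y hy⟩)
          rintro rfl
          exact hne rfl
        · rw [Finset.card_insert_of_notMem hv] at hc; exact hc

/-- Reversible pebbling of a path whose side inputs are pebbled. -/
lemma path_upper {G : Dgraph} (hirr : ∀ v, ¬ G.edge v v) {p : ℕ → G.V} {W : Finset G.V} {L : ℕ}
    (hp : ∀ i < L, ∀ u, G.edge u (p (i+1)) → u = p i ∨ u ∈ W)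
    (hinj : ∀ i ≤ L, ∀ j ≤ L, p i = p j → i = j) (m : ℕ) :
    ∀ (i l : ℕ) (Q : Finset G.V), i + l ≤ L → 1 ≤ l → l ≤ 2^m → W ⊆ Q → p i ∈ Q →
      (∀ j, i < j → j ≤ i + l → p j ∉ Q) → Reach G (Q.card + m + 1) Q (insert (p (i+l)) Q) := by
  induction m with
  | zero =>
    intro i l Q h1 h2 h3 h4 h5 h6
    have : l = 1 := by simp at h3; omega
    subst this
    apply Reach.place (h6 _ (by omega) le_rfl) _ le_rfl
    intro u hu
    rcases hp i (by omega) u hu with rfl | h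
    · exact h5
    · exact h4 h
  | succ m ih =>
    intro i l Q h1 h2 h3 h4 h5 h6
    by_cases hl : l ≤ 2^m
    · exact (ih i l Q h1 h2 hl h4 h5 h6).mono (by omega)
    · have hpos : 0 < 2^m := by positivity
      have h2m : 2^(m+1) = 2^m + 2^m := by ring
      set c := 2^m with hc
      have hmid : p (i+c) ∉ Q := h6 _ (by omega) (by omega)
      have htop : p (i+l) ∉ Q := h6 _ (by omega) (by omega)
      have hne : ∀ j j', j ≤ L → j' ≤ L → j ≠ j' → p j ≠ p j' :=
        fun j j' hj hj' hn h => hn (hinj j hj j' hj' h)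
      have s1 := ih i c Q (by omega) (by omega) le_rfl h4 h5
        (fun j hj hj' => h6 j hj (by omega))
      have s2 := ih (i+c) (l-c) (insert (p (i+c)) Q) (by omega) (by omega) (by omega)
        (h4.trans (Finset.subset_insert _ _)) (Finset.mem_insert_self _ _) (by
          intro j hj hj'
          rw [Finset.mem_insert, not_or]
          exact ⟨hne _ _ (by omega) (by omega) (by omega), h6 j (by omega) (by omega)⟩)
      have s3 := ih i c (insert (p (i+l)) Q) (by omega) (by omega) le_rfl
        (h4.trans (Finset.subset_insert _ _)) (Finset.mem_insert_of_mem h5) (by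
          intro j hj hj'
          rw [Finset.mem_insert, not_or]
          exact ⟨hne _ _ (by omega) (by omega) (by omega), h6 j (by omega) (by omega)⟩)
      rw [Finset.card_insert_of_notMem hmid, show i + c + (l - c) = i + l by omega] at s2
      rw [Finset.card_insert_of_notMem htop, Finset.insert_comm] at s3
      exact ((s1.mono (by omega)).trans (s2.mono (by omega))).trans
        ((s3.symm hirr).mono (by omega))

/-- `v` is the root of a complete binary tree of height `n` with vertex set `S`. -/
def TreeAt (G : Dgraph) : ℕ → G.V → Finset G.V → Prop
  | 0, v, S => S = {v} ∧ ∀ u, ¬ G.edge u v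
  | n+1, v, S => ∃ a b Sa Sb, (∀ u, G.edge u v → u = a ∨ u = b) ∧ TreeAt G n a Sa ∧
      TreeAt G n b Sb ∧ Disjoint Sa Sb ∧ v ∉ Sa ∧ v ∉ Sb ∧ S = insert v (Sa ∪ Sb)

lemma TreeAt.mem {G : Dgraph} {n : ℕ} {v : G.V} {S : Finset G.V} (h : TreeAt G n v S) :
    v ∈ S := by
  cases n with
  | zero => rw [h.1]; simp
  | succ n =>
    obtain ⟨a, b, Sa, Sb, _, _, _, _, _, _, rfl⟩ := h
    simp

/-- Persistent upper bound for trees of height `n` with overhead `D`. -/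
def UB (G : Dgraph) (D n : ℕ) : Prop := ∀ v S, TreeAt G n v S → ∀ Q, Disjoint Q S →
  Reach G (Q.card + n + D) Q (insert v Q)

lemma descend {G : Dgraph} {D g0 : ℕ} (l : ℕ)
    (hU : ∀ n, g0 ≤ n → n < g0 + l → UB G (D+1) n) :
    ∀ v S, TreeAt G (g0+l) v S → ∃ (p : ℕ → G.V) (W S0 : Finset G.V),
      p l = v ∧ W.card = l ∧ W ⊆ S ∧ S0 ⊆ S ∧ (∀ i ≤ l, p i ∈ S) ∧ (∀ i ≤ l, p i ∉ W) ∧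
      (∀ i < l, ∀ u, G.edge u (p (i+1)) → u = p i ∨ u ∈ W) ∧
      (∀ i ≤ l, ∀ j ≤ l, p i = p j → i = j) ∧ TreeAt G g0 (p 0) S0 ∧ Disjoint W S0 ∧
      (∀ i < l, p (i+1) ∉ S0) ∧
      ∀ Q, Disjoint Q (S.erase v) → Reach G (Q.card + g0 + l + D) (Q) (Q ∪ W) := by
  induction l with
  | zero =>
    intro v S hT
    refine ⟨fun _ => v, ∅, S, rfl, rfl, by simp, by simp, fun _ _ => hT.mem, by simp, by simp,
      by intros; omega, hT, by simp, by simp, ?_⟩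
    intro Q _
    rw [Finset.union_empty]
    exact Relation.ReflTransGen.refl
  | succ l ih =>
    intro v S hT
    obtain ⟨a, b, Sa, Sb, hpre, hTa, hTb, hdis, hva, hvb, rfl⟩ := hT
    obtain ⟨p, W, S0, h1, h2, h3, h4, h5, h6, h7, h8, h9, h10, h11, h12⟩ :=
      ih (fun n hn hn' => hU n hn (by omega)) a Sa hTa
    have hb := hTb.mem
    have hbSa : b ∉ Sa := fun h => Finset.disjoint_left.mp hdis h hb
    have hbW : b ∉ W := fun h => hbSa (h3 h)
    have hvW : v ∉ W := fun h => hva (h3 h)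
    have hvb' : v ≠ b := by rintro rfl; exact hvb hb
    refine ⟨fun i => if i ≤ l then p i else v, insert b W, S0, ?_, ?_, ?_, ?_, ?_, ?_, ?_, ?_,
      ?_, ?_, ?_, ?_⟩
    · simp
    · rw [Finset.card_insert_of_notMem hbW, h2]
    · intro x hx
      rw [Finset.mem_insert] at hx
      rcases hx with rfl | hx
      · simp [hb]
      · simp [h3 hx]
    · intro x hx
      simp [h4 hx]
    · intro i hi
      by_cases hil : i ≤ l
      · simp [hil, h5 i hil]
      · simp [hil]
    · intro i hi
      by_cases hil : i ≤ l
      · simp only [hil, if_true, Finset.mem_insert, not_or]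
        refine ⟨?_, h6 i hil⟩
        intro h
        exact hbSa (h ▸ h5 i hil)
      · simp [hil, hvb', hvW]
    · intro i hi u hu
      by_cases hil : i + 1 ≤ l
      · simp only [hil, if_true, show i ≤ l by omega] at hu ⊢
        rcases h7 i (by omega) u hu with h | h
        · exact Or.inl h
        · exact Or.inr (Finset.mem_insert_of_mem h)
      · have : i = l := by omega
        subst this
        simp only [hil, if_false] at hu
        simp only [le_refl, if_true, h1]
        rcases hpre u hu with rfl | rfl
        · exact Or.inl rfl
        · exact Or.inr (Finset.mem_insert_self _ _)
    · intro i hi j hj hij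
      by_cases hil : i ≤ l
      · by_cases hjl : j ≤ l
        · simp only [hil, hjl, if_true] at hij
          exact h8 i hil j hjl hij
        · simp only [hil, hjl, if_true, if_false] at hij
          exact absurd (hij ▸ h5 i hil) hva
      · by_cases hjl : j ≤ l
        · simp only [hil, hjl, if_true, if_false] at hij
          exact absurd (hij ▸ h5 j hjl) hva
        · omega
    · simpa using h9
    · rw [Finset.disjoint_insert_left]
      exact ⟨fun h => hbSa (h4 h), h10⟩
    · intro i hi
      by_cases hil : i + 1 ≤ l
      · simp only [hil, if_true]; exact h11 i (by omega)
      · simp only [hil, if_false]; exact fun h => hva (h4 h)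
    · intro Q hQ
      have hQ' : ∀ x ∈ Q, x ∉ Sa ∧ x ∉ Sb := by
        intro x hx
        rw [Finset.erase_insert (by simp [hva, hvb])] at hQ
        have := Finset.disjoint_left.mp hQ hx
        simpa using this
      have hbQ : b ∉ Q := fun h => (hQ' b h).2 hb
      have s1 := hU (g0 + l) (by omega) (by omega) b Sb hTb Q
        (Finset.disjoint_left.mpr fun x hx => (hQ' x hx).2)
      have s2 := h12 (insert b Q) (by
        rw [Finset.disjoint_left]
        intro x hx hx'
        have hx' := Finset.mem_of_mem_erase hx'
        rw [Finset.mem_insert] at hx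
        rcases hx with rfl | hx
        · exact hbSa hx'
        · exact (hQ' x hx).1 hx')
      rw [Finset.card_insert_of_notMem hbQ] at s2
      have e : insert b Q ∪ W = Q ∪ insert b W := by
        ext x; simp only [Finset.mem_union, Finset.mem_insert]; tauto
      rw [e] at s2
      exact (s1.mono (by omega)).trans (s2.mono (by omega))

lemma UB_step {G : Dgraph} (hirr : ∀ v, ¬ G.edge v v) {D g0 k l : ℕ} (hU0 : UB G D g0)
    (hk : k + 1 = g0 + D) (hl1 : 1 ≤ l) (hl : l ≤ 2^k)
    (hU : ∀ n, g0 ≤ n → n < g0 + l → UB G (D+1) n) : UB G (D+1) (g0+l) := by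
  intro v S hT P hPS
  obtain ⟨p, W, S0, h1, h2, h3, h4, h5, h6, h7, h8, h9, h10, h11, h12⟩ := descend l hU v S hT
  have hP : ∀ x ∈ P, x ∉ S := fun x hx => Finset.disjoint_left.mp hPS hx
  have hcard : (P ∪ W).card = P.card + l := by
    rw [Finset.card_union_of_disjoint, h2]
    rw [Finset.disjoint_left]
    exact fun x hx hx' => hP x hx (h3 hx')
  have hpPW : ∀ i ≤ l, p i ∉ P ∪ W := by
    intro i hi
    rw [Finset.mem_union, not_or]
    exact ⟨fun h => hP _ h (h5 i hi), h6 i hi⟩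
  have hp0 := hpPW 0 (by omega)
  have hvPW : v ∉ P ∪ W := h1 ▸ hpPW l le_rfl
  have hvS0 : v ∉ S0 := by
    have := h11 (l-1) (by omega)
    rw [show l - 1 + 1 = l by omega, h1] at this
    exact this
  have hvP : v ∉ P := fun h => hvPW (Finset.mem_union_left _ h)
  have hdis : Disjoint (P ∪ W) S0 := by
    rw [Finset.disjoint_union_left]
    exact ⟨Finset.disjoint_of_subset_right h4 hPS, h10⟩
  have s1 := h12 P (Finset.disjoint_of_subset_right (Finset.erase_subset _ _) hPS)
  have s2 := hU0 (p 0) S0 h9 (P ∪ W) hdis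
  have s3 := path_upper hirr h7 h8 k 0 l (insert (p 0) (P ∪ W)) (by omega) hl1 hl
    (Finset.subset_union_right.trans (Finset.subset_insert _ _)) (Finset.mem_insert_self _ _) (by
      intro j hj hj'
      rw [Finset.mem_insert, not_or]
      refine ⟨fun h => ?_, hpPW j (by omega)⟩
      have := h8 j (by omega) 0 (by omega) h
      omega)
  have s4 := hU0 (p 0) S0 h9 (insert v (P ∪ W)) (by
    rw [Finset.disjoint_insert_left]
    exact ⟨hvS0, hdis⟩)
  have s5 := h12 (insert v P) (by
    rw [Finset.disjoint_insert_left]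
    exact ⟨Finset.notMem_erase _ _,
      Finset.disjoint_of_subset_right (Finset.erase_subset _ _) hPS⟩)
  rw [Finset.card_insert_of_notMem hp0, hcard, zero_add, h1] at s3
  rw [Finset.card_insert_of_notMem hvPW, hcard, Finset.insert_comm] at s4
  rw [Finset.card_insert_of_notMem hvP, Finset.insert_union] at s5
  rw [hcard] at s2
  refine (s1.mono (by omega)).trans ((s2.mono (by omega)).trans ((s3.mono (by omega)).trans ?_))
  exact ((s4.symm hirr).mono (by omega)).trans ((s5.symm hirr).mono (by omega))

lemma UB_mono {G : Dgraph} {D D' n : ℕ} (h : UB G D n) (hD : D ≤ D') : UB G D' n :=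
  fun v S hT Q hQ => (h v S hT Q hQ).mono (by omega)

lemma UB_all {G : Dgraph} (hirr : ∀ v, ¬ G.edge v v) (D : ℕ) :
    ∀ n, n ≤ g (D+1) → UB G (D+1) n := by
  induction D with
  | zero =>
    intro n hn
    have : n = 0 := by simp only [g] at hn; omega
    subst this
    intro v S hT Q hQ
    have hv := hT.mem
    apply Reach.place
    · exact fun h => Finset.disjoint_left.mp hQ h hv
    · intro u hu
      exact absurd hu (hT.2 u)
    · omega
  | succ D ih =>
    intro n
    induction n using Nat.strong_induction_on with
    | _ n ihn =>
      intro hn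
      by_cases hle : n ≤ g (D+1)
      · exact UB_mono (ih n hle) (by omega)
      · obtain ⟨l, rfl⟩ : ∃ l, n = g (D+1) + l := ⟨n - g (D+1), by omega⟩
        have hg : g (D+1+1) = 2^(g (D+1) + D) + g (D+1) := by simp only [g]
        exact UB_step hirr (ih _ le_rfl) (k := g (D+1) + D) (by omega) (by omega) (by omega)
          (fun m hm hm' => ihn m hm' (by omega))

/-! ## The binary tree -/

lemma bintree_irr (h : ℕ) (v : (bintree h).V) : ¬ (bintree h).edge v v := by
  intro hh
  have := hh.1
  omega

lemma bintree_treeAt (h n : ℕ) : ∀ v : (bintree h).V, (v.1 : ℕ) + n = h →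
    ∃ S, TreeAt (bintree h) n v S ∧ ∀ u ∈ S, (v.1 : ℕ) ≤ (u.1 : ℕ) ∧
      (u.2 : ℕ) / 2 ^ ((u.1 : ℕ) - (v.1 : ℕ)) = (v.2 : ℕ) := by
  induction n with
  | zero =>
    intro v hv
    refine ⟨{v}, ⟨rfl, ?_⟩, ?_⟩
    · intro u hu
      have h1 := hu.1
      have h2 := u.1.2
      omega
    · intro u hu
      rw [Finset.mem_singleton] at hu
      subst hu
      simp
  | succ n ih =>
    rintro ⟨⟨k, hk⟩, ⟨j, hj⟩⟩ hv
    simp only at hv hj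
    have hk' : k + 1 < h + 1 := by omega
    have hpow : 2^(k+1) = 2 * 2^k := by ring
    let a : (bintree h).V := ⟨⟨k+1, hk'⟩, ⟨2*j, by simp only; omega⟩⟩
    let b : (bintree h).V := ⟨⟨k+1, hk'⟩, ⟨2*j+1, by simp only; omega⟩⟩
    obtain ⟨Sa, hTa, hSa⟩ := ih a (by change k + 1 + n = h; omega)
    obtain ⟨Sb, hTb, hSb⟩ := ih b (by change k + 1 + n = h; omega)
    simp only [a] at hSa
    simp only [b] at hSb
    refine ⟨_, ⟨a, b, Sa, Sb, ?_, hTa, hTb, ?_, ?_, ?_, rfl⟩, ?_⟩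
    · rintro ⟨⟨k', hk''⟩, ⟨j', hj'⟩⟩ ⟨h1, h2⟩
      simp only at h1 h2
      subst h1
      have : j' = 2 * j ∨ j' = 2 * j + 1 := by omega
      rcases this with rfl | rfl
      · exact Or.inl rfl
      · exact Or.inr rfl
    · rw [Finset.disjoint_left]
      intro u hu hu'
      have h1 := (hSa u hu).2
      have h2 := (hSb u hu').2
      omega
    · intro hh
      have := (hSa _ hh).1
      simp at this
    · intro hh
      have := (hSb _ hh).1
      simp at this
    · intro u hu
      have key : k + 1 ≤ (u.1 : ℕ) ∧ (u.2 : ℕ) / 2 ^ ((u.1 : ℕ) - (k+1)) / 2 = j →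
          k ≤ (u.1 : ℕ) ∧ (u.2 : ℕ) / 2 ^ ((u.1 : ℕ) - k) = j := by
        rintro ⟨h1, h2⟩
        refine ⟨by omega, ?_⟩
        rw [show (u.1 : ℕ) - k = (u.1 : ℕ) - (k+1) + 1 by omega, pow_succ,
          ← Nat.div_div_eq_div_mul]
        exact h2
      rcases (Finset.mem_insert.mp hu).imp_right Finset.mem_union.mp with hu | hu | hu
      · subst hu
        simp
      · have := hSa u hu
        exact key ⟨this.1, by omega⟩
      · have := hSb u hu
        exact key ⟨this.1, by omega⟩

lemma bintree_reach (h : ℕ) : Reach (bintree h) (h + ginv h) ∅ {bintreeRoot h} := by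
  obtain ⟨S, hT, -⟩ := bintree_treeAt h h (bintreeRoot h) (by simp [bintreeRoot])
  have hs := PebLow.ginv_spec h
  obtain ⟨D, hD⟩ : ∃ D, ginv h = D + 1 := ⟨ginv h - 1, by omega⟩
  rw [hD] at hs ⊢
  have := UB_all (bintree_irr h) D h hs.2 (bintreeRoot h) S hT ∅ (by simp)
  simpa using this

/-- Number of ones in the first `k` binary digits. -/
def ones : ℕ → ℕ → ℕ
  | 0, _ => 0
  | k+1, j => ones k (j / 2) + j % 2

lemma ones_le (k j : ℕ) : ones k j ≤ k := by
  induction k generalizing j with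
  | zero => simp [ones]
  | succ k ih =>
    have := ih (j/2)
    simp only [ones]; omega

/-- Folding the binary tree onto the pyramid. -/
def fold (h : ℕ) (x : (bintree h).V) : (pyramid h).V :=
  ⟨(⟨h - (x.1 : ℕ), by omega⟩, ⟨h - ones x.1 x.2, by omega⟩), by
    have := ones_le x.1 x.2
    simp only
    omega⟩

lemma fold_lift (h : ℕ) (x : (bintree h).V) (u : (pyramid h).V)
    (hu : (pyramid h).edge u (fold h x)) : ∃ y, (bintree h).edge y x ∧ fold h y = u := by
  obtain ⟨⟨k, hk⟩, ⟨j, hj⟩⟩ := x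
  obtain ⟨⟨⟨i, hi⟩, ⟨c, hc⟩⟩, hic⟩ := u
  obtain ⟨h1, h2⟩ := hu
  simp only [fold] at h1 h2 hic hj
  have ho := ones_le k j
  have hpow : 2^(k+1) = 2 * 2^k := by ring
  have key : ∀ r, r ≤ 1 → c = h - (ones k j + r) → ∃ y, (bintree h).edge y ⟨⟨k, hk⟩, ⟨j, hj⟩⟩ ∧
      fold h y = ⟨⟨⟨i, hi⟩, ⟨c, hc⟩⟩, hic⟩ := by
    intro r hr hcr
    refine ⟨⟨⟨k+1, by omega⟩, ⟨2*j+r, by simp only; omega⟩⟩, ⟨rfl, ?_⟩, ?_⟩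
    · change (2*j+r)/2 = j
      omega
    · apply Subtype.ext
      apply Prod.ext
      · apply Fin.ext
        change h - (k+1) = i
        omega
      · apply Fin.ext
        change h - (ones k ((2*j+r)/2) + (2*j+r) % 2) = c
        rw [show (2*j+r)/2 = j by omega, show (2*j+r)%2 = r by omega, hcr]
  rcases h2 with h2 | h2
  · exact key 0 (by omega) (by omega)
  · exact key 1 (by omega) (by omega)

lemma fold_root (h : ℕ) : fold h (bintreeRoot h) = pyramidSink h := by
  apply Subtype.ext
  apply Prod.ext
  · apply Fin.ext
    simp [fold, bintreeRoot, pyramidSink]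
  · apply Fin.ext
    simp [fold, bintreeRoot, pyramidSink, ones]

lemma proj {h s : ℕ} (hr : Reach (bintree h) s ∅ {bintreeRoot h}) :
    Reach (pyramid h) s ∅ {pyramidSink h} := by
  have := hr.image (fold h) (fold_lift h) (PebLow.pyramid_irr h)
  rw [Finset.image_singleton, fold_root, Finset.image_empty] at this
  exact this

end PebUp

/-- Exact persistent pebbling price of pyramids and complete binary trees
(Theorem `th:exact-trees-pyramids`). -/
theorem exact_trees_pyramids (h : ℕ) :
    (pyramid h).pers (pyramidSink h) = h + ginv h ∧
    (bintree h).pers (bintreeRoot h) = h + ginv h := by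
  constructor
  · exact PebUp.pers_eq (PebUp.proj (PebUp.bintree_reach h))
      (fun P τ hP hτ => PebLow.pyr_lower' h hP hτ)
  · refine PebUp.pers_eq (PebUp.bintree_reach h) ?_
    intro P τ hP hτ
    have h1 := PebUp.reach_of_pebbling hP
    rw [hτ] at h1
    obtain ⟨P', τ', h2, h3, h4⟩ := (PebUp.proj h1).pebbling
    exact (PebLow.pyr_lower' h h2 h3).trans h4
end

section
/- For any two DAGs G₁ and G₂, each having a unique sink and in-degree at most 2, such that Black(G₁) ≥ 3 and Black(G₂) ≥ 3, there exists a DAG B with exactly |V(G₁)|·(2·|V(G₁)| + |V(G₂)|) vertices, a unique sink, and in-degree at most 2, such that Black(B) = Black(G₁) + Black(G₂) − 1. -/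
namespace Dgraph

/-- Configurations reachable from the empty one in space `s`. -/
inductive Reach_s5 (G : Dgraph) (s : ℕ) : Finset G.V → Prop
  | nil : Reach_s5 G s ∅
  | step {P P' : Finset G.V} : Reach_s5 G s P → G.StdStep P P' → P'.card ≤ s → Reach_s5 G s P'

theorem Reach_s5.card_le {G : Dgraph} {s : ℕ} {P : Finset G.V} (h : G.Reach_s5 s P) : P.card ≤ s := by
  cases h with
  | nil => simp
  | step _ _ h => exact h

theorem reach_of_pebbling {G : Dgraph} {s : ℕ} {P : ℕ → Finset G.V} {τ : ℕ}
    (h : G.IsStdPebbling P τ) (hs : G.space P τ ≤ s) : ∀ t ≤ τ, G.Reach_s5 s (P t) := by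
  intro t
  induction t with
  | zero => intro _; rw [h.1]; exact Reach_s5.nil
  | succ t ih =>
    intro ht
    refine Reach_s5.step (ih (by omega)) (h.2 t (by omega)) (le_trans ?_ hs)
    exact Finset.le_sup (f := fun t => (P t).card) (Finset.mem_range.2 (by omega))

theorem pebbling_of_reach {G : Dgraph} {s : ℕ} {P : Finset G.V} (h : G.Reach_s5 s P) :
    ∃ Q τ, G.IsStdPebbling Q τ ∧ Q τ = P ∧ G.space Q τ ≤ s := by
  induction h with
  | nil => exact ⟨fun _ => ∅, 0, ⟨rfl, by simp⟩, rfl, by simp [space]⟩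
  | @step P P' h1 h2 h3 ih =>
    obtain ⟨Q, τ, hQ, hτ, hs⟩ := ih
    refine ⟨fun t => if t ≤ τ then Q t else P', τ + 1, ⟨by simp [hQ.1], ?_⟩, by simp, ?_⟩
    · intro t ht
      rcases Nat.lt_or_ge t τ with h | h
      · have := hQ.2 t h
        simp only [show t ≤ τ by omega, show t + 1 ≤ τ by omega, if_true]
        exact this
      · have : t = τ := by omega
        subst this
        simp [hτ, h2]
    · unfold space
      apply Finset.sup_le
      intro t ht
      by_cases h : t ≤ τ
      · simp only [h, if_true]
        exact le_trans (Finset.le_sup (f := fun t => (Q t).card)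
          (Finset.mem_range.2 (by omega))) hs
      · simp only [h, if_false]; exact h3

theorem Reach_s5.subset {G : Dgraph} {s : ℕ} {P Q : Finset G.V} (h : G.Reach_s5 s P) (hQ : Q ⊆ P) :
    G.Reach_s5 s Q := by
  have key : ∀ n, ∀ P : Finset G.V, G.Reach_s5 s P → Q ⊆ P → (P \ Q).card = n → G.Reach_s5 s Q := by
    intro n
    induction n with
    | zero =>
      intro P h hQ hc
      have : P ⊆ Q := by
        rw [Finset.card_eq_zero, Finset.sdiff_eq_empty_iff_subset] at hc; exact hc
      rwa [Finset.Subset.antisymm hQ this]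
    | succ n ih =>
      intro P h hQ hc
      obtain ⟨v, hv⟩ : (P \ Q).Nonempty := by rw [← Finset.card_pos]; omega
      rw [Finset.mem_sdiff] at hv
      refine ih (P.erase v) (Reach_s5.step h (Or.inr ⟨v, hv.1, rfl⟩)
        (le_trans (Finset.card_erase_le) h.card_le)) ?_ ?_
      · intro x hx
        rw [Finset.mem_erase]
        refine ⟨?_, hQ hx⟩
        rintro rfl; exact hv.2 hx
      · have : P.erase v \ Q = (P \ Q).erase v := by
          ext x; simp only [Finset.mem_sdiff, Finset.mem_erase]; tauto
        rw [this, Finset.card_erase_of_mem (Finset.mem_sdiff.2 hv)]; omega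
  exact key _ P h hQ rfl

theorem black_le_of_reach {G : Dgraph} {s : ℕ} {P : Finset G.V} {z : G.V}
    (h : G.Reach_s5 s P) (hz : z ∈ P) : G.black z ≤ s := by
  obtain ⟨Q, τ, hQ, hτ, hs⟩ := pebbling_of_reach (h.subset (Finset.singleton_subset_iff.2 hz))
  exact le_trans (Nat.sInf_le ⟨Q, τ, hQ, hτ, rfl⟩) hs

theorem black_attained {G : Dgraph} {s : ℕ} {z : G.V} (h : G.Reach_s5 s {z}) :
    ∃ P τ, G.IsStdPebbling P τ ∧ P τ = {z} ∧ G.space P τ = G.black z := by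
  obtain ⟨Q, τ, hQ, hτ, hs⟩ := pebbling_of_reach h
  exact Nat.sInf_mem (s := { s : ℕ | ∃ P τ, G.IsStdPebbling P τ ∧ P τ = {z} ∧ G.space P τ = s })
    ⟨_, Q, τ, hQ, hτ, rfl⟩

theorem black_attained_of_pos {G : Dgraph} {z : G.V} (h : 0 < G.black z) :
    ∃ P τ, G.IsStdPebbling P τ ∧ P τ = {z} ∧ G.space P τ = G.black z := by
  have hne : { s : ℕ | ∃ P τ, G.IsStdPebbling P τ ∧ P τ = {z} ∧ G.space P τ = s }.Nonempty := by
    by_contra hc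
    rw [Set.not_nonempty_iff_eq_empty] at hc
    unfold black at h
    rw [hc] at h
    simp at h
  exact Nat.sInf_mem hne

theorem reach_of_pos {G : Dgraph} {z : G.V} (h : 0 < G.black z) : G.Reach_s5 (G.black z) {z} := by
  obtain ⟨P, τ, hP, hτ, hs⟩ := black_attained_of_pos h
  rw [← hτ]
  exact reach_of_pebbling hP hs.le τ le_rfl

theorem black_le_card {G : Dgraph} {z : G.V} (h : 0 < G.black z) :
    G.black z ≤ Fintype.card G.V := by
  obtain ⟨P, τ, hP, hτ, hs⟩ := black_attained_of_pos h
  rw [← hs]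
  exact Finset.sup_le fun t _ => Finset.card_le_univ _

/-! ### Padding by one vertex -/

/-- Add a new sink after `z`. -/
@[reducible] def pad (G : Dgraph) (z : G.V) : Dgraph where
  V := Option G.V
  edge u v := match u, v with
    | some u, some v => G.edge u v
    | some u, none => u = z
    | none, _ => False

theorem pad_acyclic {G : Dgraph} {z : G.V} (h : G.Acyclic) : (G.pad z).Acyclic := by
  have h1 : ∀ (u w : Option G.V), Relation.TransGen (G.pad z).edge u w →
      ∃ a, u = some a ∧ (w = none ∨ ∃ c, w = some c ∧ Relation.TransGen G.edge a c) := by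
    intro u w huw
    induction huw with
    | @single c e =>
      cases u with
      | none => exact e.elim
      | some a =>
        refine ⟨a, rfl, ?_⟩
        cases c with
        | none => exact Or.inl rfl
        | some c => exact Or.inr ⟨c, rfl, Relation.TransGen.single e⟩
    | @tail c d _ e ih =>
      obtain ⟨a, rfl, ih⟩ := ih
      refine ⟨a, rfl, ?_⟩
      cases d with
      | none => exact Or.inl rfl
      | some d =>
        rcases ih with rfl | ⟨c, rfl, hc⟩
        · exact e.elim
        · exact Or.inr ⟨d, rfl, hc.tail e⟩
  intro v hv
  obtain ⟨a, rfl, hx | ⟨c, hc, hc'⟩⟩ := h1 v v hv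
  · exact absurd hx (by simp)
  · cases hc; exact h a hc'

theorem pad_sink {G : Dgraph} {z : G.V} (h : G.UniqueSink z) :
    (G.pad z).UniqueSink (none : Option G.V) := by
  refine ⟨fun u hu => hu, ?_⟩
  intro w hw
  cases w with
  | none => rfl
  | some w =>
    have : w = z := h.2 w fun u hu => hw (some u) hu
    exact (hw (none : Option G.V) this).elim

theorem pad_indeg {G : Dgraph} {z : G.V} (h : G.InDegLe2) : (G.pad z).InDegLe2 := by
  intro v
  cases v with
  | none =>
    have : {u : (G.pad z).V | (G.pad z).edge u (none : Option G.V)} ⊆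
        ({(some z : Option G.V)} : Set (Option G.V)) := by
      intro u hu
      cases u with
      | none => exact hu.elim
      | some u => exact congrArg some hu
    refine le_trans (Set.ncard_le_ncard this (Set.toFinite _)) ?_
    exact le_of_eq_of_le (Set.ncard_singleton (some z : Option G.V)) (by omega)
  | some v =>
    have : {u : (G.pad z).V | (G.pad z).edge u (some v : Option G.V)} ⊆
        (some '' {u : G.V | G.edge u v} : Set (Option G.V)) := by
      intro u hu
      cases u with
      | none => exact hu.elim
      | some u => exact ⟨u, hu, rfl⟩
    refine le_trans (Set.ncard_le_ncard this (Set.toFinite _)) ?_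
    exact le_trans (Set.ncard_image_le (Set.toFinite _)) (h v)

theorem pad_reach {G : Dgraph} {z : G.V} {s : ℕ} {P : Finset G.V} (h : G.Reach_s5 s P) :
    (G.pad z).Reach_s5 s (P.map Function.Embedding.some : Finset (Option G.V)) := by
  induction h with
  | nil => exact Reach_s5.nil
  | @step P P' h1 h2 h3 ih =>
    refine Reach_s5.step ih ?_ ((Finset.card_map _).trans_le h3)
    rcases h2 with ⟨v, hv, hp, rfl⟩ | ⟨v, hv, rfl⟩
    · refine Or.inl ⟨(some v : Option G.V), ?_, ?_, ?_⟩
      · intro hc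
        obtain ⟨a, ha, hav⟩ := Finset.mem_map.1 hc
        cases hav; exact hv ha
      · intro u hu
        cases u with
        | none => exact hu.elim
        | some u => exact Finset.mem_map.2 ⟨u, hp u hu, rfl⟩
      · exact Finset.map_insert _ _ _
    · exact Or.inr ⟨(some v : Option G.V), Finset.mem_map.2 ⟨v, hv, rfl⟩, Finset.map_erase _ _ _⟩

theorem pad_reach_inv {G : Dgraph} {z : G.V} {s : ℕ} {Q : Finset (G.pad z).V}
    (h : (G.pad z).Reach_s5 s Q) :
    G.Reach_s5 s (Finset.univ.filter fun u => (some u : Option G.V) ∈ Q) ∧ ((none : Option G.V) ∈ Q → G.black z ≤ s) := by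
  induction h with
  | nil =>
    refine ⟨?_, fun h => absurd h (Finset.notMem_empty _)⟩
    convert Reach_s5.nil
    ext u
    simp only [Finset.mem_filter, Finset.mem_univ, true_and]
    exact iff_of_false (Finset.notMem_empty _) (Finset.notMem_empty _)
  | @step P P' h1 h2 h3 ih =>
    have hc : (Finset.univ.filter fun u : G.V => (some u : Option G.V) ∈ P').card ≤ s := by
      refine le_trans (Finset.card_le_card_of_injOn (fun u => (some u : Option G.V)) ?_ ?_) h3
      · intro u hu
        simpa using hu
      · intro a _ c _ hac
        exact Option.some.inj hac
    rcases h2 with ⟨v, hv, hp, rfl⟩ | ⟨v, hv, rfl⟩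
    · cases v with
      | none =>
        have hb : G.black z ≤ s :=
          black_le_of_reach ih.1 (by simpa using hp (some z : Option G.V) rfl)
        refine ⟨?_, fun _ => hb⟩
        convert ih.1 using 1
        ext u
        simp only [Finset.mem_filter, Finset.mem_univ, true_and]
        exact Finset.mem_insert.trans (or_iff_right (by rintro ⟨⟩))
      | some v =>
        refine ⟨Reach_s5.step ih.1 (Or.inl ⟨v, ?_, ?_, ?_⟩) hc, ?_⟩
        · simpa using hv
        · intro u hu
          simpa using hp (some u : Option G.V) hu
        · ext u
          simp only [Finset.mem_filter, Finset.mem_univ, true_and, Finset.mem_insert]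
          exact or_congr_left Option.some_inj
        · intro hn
          refine ih.2 ((Finset.mem_insert.1 hn).resolve_left (by rintro ⟨⟩))
    · refine ⟨ih.1.subset ?_, fun hn => ih.2 (Finset.mem_of_mem_erase hn)⟩
      intro u hu
      simp only [Finset.mem_filter, Finset.mem_univ, true_and] at hu ⊢
      exact Finset.mem_of_mem_erase hu

theorem pad_black {G : Dgraph} {z : G.V} (h : 2 ≤ G.black z) :
    (G.pad z).black (none : Option G.V) = G.black z := by
  have hr : (G.pad z).Reach_s5 (G.black z) ({none, some z} : Finset (Option G.V)) := by
    refine Reach_s5.step (pad_reach (reach_of_pos (by omega : 0 < G.black z)))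
      (Or.inl ⟨(none : Option G.V), ?_, ?_, ?_⟩) ?_
    · intro hc
      obtain ⟨a, ha, hav⟩ := Finset.mem_map.1 hc
      cases hav
    · intro u hu
      cases u with
      | none => exact hu.elim
      | some u => exact Finset.mem_map.2 ⟨u, Finset.mem_singleton.2 hu, rfl⟩
    · rw [Finset.map_singleton]; rfl
    · exact le_trans (Finset.card_le_two) h
  have hr1 : (G.pad z).Reach_s5 (G.black z) ({none} : Finset (Option G.V)) :=
    hr.subset (by intro x hx; rw [Finset.mem_singleton] at hx; subst hx; exact Finset.mem_insert_self _ _)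
  apply le_antisymm
  · exact black_le_of_reach hr1 (Finset.mem_singleton_self _)
  · obtain ⟨P, τ, hP, hτ, hs⟩ := black_attained hr1
    have := reach_of_pebbling hP hs.le τ le_rfl
    rw [hτ] at this
    exact (pad_reach_inv this).2 (Finset.mem_singleton_self _)

theorem pad_many (p : ℕ) (hp : 2 ≤ p) (k : ℕ) : ∀ (G : Dgraph) (z : G.V), G.Acyclic →
    G.UniqueSink z → G.InDegLe2 → G.black z = p →
    ∃ (B : Dgraph) (zB : B.V), B.Acyclic ∧ B.UniqueSink zB ∧ B.InDegLe2 ∧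
      Fintype.card B.V = Fintype.card G.V + k ∧ B.black zB = p := by
  induction k with
  | zero => intro G z h1 h2 h3 h4; exact ⟨G, z, h1, h2, h3, rfl, h4⟩
  | succ k ih =>
    intro G z h1 h2 h3 h4
    obtain ⟨B, zB, a, b, c, d, e⟩ := ih (G.pad z) (none : Option G.V) (pad_acyclic h1) (pad_sink h2)
      (pad_indeg h3) ((pad_black (by omega)).trans h4)
    refine ⟨B, zB, a, b, c, ?_, e⟩
    rw [d]
    have : Fintype.card (G.pad z).V = Fintype.card G.V + 1 := by
      have h := Fintype.card_option (α := G.V)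
      rw [← h]
    omega

/-! ### Combinatorics of paths in a pyramid -/

/-- `π` describes a path of a pyramid with `b` sources, ending at the apex. -/
def PyrPath (b : ℕ) (π : ℕ → ℕ) : Prop :=
  π (b - 1) = 0 ∧ ∀ r, r + 1 < b → π (r + 1) = π r ∨ π r = π (r + 1) + 1

theorem PyrPath.bound {b : ℕ} {π : ℕ → ℕ} (h : PyrPath b π) : ∀ r < b, π r + r < b := by
  have key : ∀ d r, r + d + 1 = b → π r + r < b := by
    intro d
    induction d with
    | zero =>
      intro r hr
      have : r = b - 1 := by omega
      rw [this, h.1]; omega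
    | succ d ih =>
      intro r hr
      have h1 := ih (r + 1) (by omega)
      have h2 := h.2 r (by omega)
      omega
  intro r hr
  exact key (b - 1 - r) r (by omega)

theorem pyr_blocking (b : ℕ) (hb : 0 < b) (S : ℕ → ℕ → Prop)
    (hS : ∀ π, PyrPath b π → ∃ r < b, S r (π r)) (π : ℕ → ℕ) (hπ : PyrPath b π)
    (hopen : ∀ r, 0 < r → r < b → ¬ S r (π r)) (j : ℕ) (hj : j < b) (hjne : j ≠ π 0) :
    ∃ r c, S r c ∧ ((c = j ∧ c < π r) ∨ (c + r = j ∧ π r < c)) := by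
  classical
  rcases Nat.lt_or_gt_of_ne hjne with hlt | hgt
  · have hex : ∃ r, π r ≤ j := ⟨b - 1, by rw [hπ.1]; omega⟩
    obtain ⟨r0, h0, hmin⟩ : ∃ r0, π r0 ≤ j ∧ ∀ r < r0, j < π r :=
      ⟨Nat.find hex, Nat.find_spec hex, fun r hr => by have := Nat.find_min hex hr; omega⟩
    have hr0b : r0 < b := by
      by_contra hc
      have := hmin (b - 1) (by omega)
      rw [hπ.1] at this; omega
    have hr0 : 0 < r0 := by
      rcases Nat.eq_zero_or_pos r0 with h | h
      · subst h; omega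
      · exact h
    have heq : π r0 = j := by
      have h1 := hmin (r0 - 1) (by omega)
      have h2 := hπ.2 (r0 - 1) (by omega)
      rw [show r0 - 1 + 1 = r0 by omega] at h2
      omega
    obtain ⟨r, hr, hSr⟩ := hS (fun r => if r < r0 then j else π r) (by
      refine ⟨?_, ?_⟩
      · simp only [show ¬ (b - 1 < r0) by omega, if_false, hπ.1]
      · intro r hr
        rcases Nat.lt_trichotomy (r + 1) r0 with h | h | h
        · simp [h, show r < r0 by omega]
        · simp [h, show r < r0 by omega, heq]
        · simp only [show ¬ (r + 1 < r0) by omega, show ¬ (r < r0) by omega, if_false]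
          exact hπ.2 r hr)
    by_cases h : r < r0
    · simp only [h, if_true] at hSr
      exact ⟨r, j, hSr, Or.inl ⟨rfl, hmin r h⟩⟩
    · simp only [h, if_false] at hSr
      exact absurd hSr (hopen r (by omega) hr)
  · have hex : ∃ r, j ≤ π r + r := ⟨b - 1, by rw [hπ.1]; omega⟩
    obtain ⟨r0, h0, hmin⟩ : ∃ r0, j ≤ π r0 + r0 ∧ ∀ r < r0, π r + r < j :=
      ⟨Nat.find hex, Nat.find_spec hex, fun r hr => by have := Nat.find_min hex hr; omega⟩
    have hr0b : r0 < b := by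
      by_contra hc
      have := hmin (b - 1) (by omega)
      rw [hπ.1] at this; omega
    have hr0 : 0 < r0 := by
      rcases Nat.eq_zero_or_pos r0 with h | h
      · subst h; omega
      · exact h
    have heq : π r0 + r0 = j := by
      have h1 := hmin (r0 - 1) (by omega)
      have h2 := hπ.2 (r0 - 1) (by omega)
      rw [show r0 - 1 + 1 = r0 by omega] at h2
      omega
    obtain ⟨r, hr, hSr⟩ := hS (fun r => if r < r0 then j - r else π r) (by
      refine ⟨?_, ?_⟩
      · simp only [show ¬ (b - 1 < r0) by omega, if_false, hπ.1]
      · intro r hr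
        rcases Nat.lt_trichotomy (r + 1) r0 with h | h | h
        · simp only [h, show r < r0 by omega, if_true]; omega
        · simp only [h, show r < r0 by omega, if_true, lt_irrefl, if_false]; omega
        · simp only [show ¬ (r + 1 < r0) by omega, show ¬ (r < r0) by omega, if_false]
          exact hπ.2 r hr)
    by_cases h : r < r0
    · simp only [h, if_true] at hSr
      have := hmin r h
      exact ⟨r, j - r, hSr, Or.inr ⟨by omega, by omega⟩⟩
    · simp only [h, if_false] at hSr
      exact absurd hSr (hopen r (by omega) hr)

/-! ### The pyramid over copies of a graph -/

/-- Non-source positions of a pyramid with `b` sources: row and column. -/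
abbrev PyrPos (b : ℕ) : Type := {p : Fin b × Fin b // 0 < p.1.val ∧ p.1.val + p.2.val < b}

/-- A pyramid whose `b` sources are the sinks of `b` disjoint copies of `G`. -/
@[reducible] def pyr (b : ℕ) (G : Dgraph) (z : G.V) : Dgraph where
  V := (Fin b × G.V) ⊕ PyrPos b
  edge u v := match u, v with
    | Sum.inl p, Sum.inl q => p.1 = q.1 ∧ G.edge p.2 q.2
    | Sum.inl p, Sum.inr q => p.2 = z ∧ q.1.1.val = 1 ∧
        (p.1.val = q.1.2.val ∨ p.1.val = q.1.2.val + 1)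
    | Sum.inr p, Sum.inr q => q.1.1.val = p.1.1.val + 1 ∧
        (p.1.2.val = q.1.2.val ∨ p.1.2.val = q.1.2.val + 1)
    | Sum.inr _, Sum.inl _ => False

section
variable {b : ℕ} {G : Dgraph} {z : G.V}

theorem pyr_card : Fintype.card (pyr b G z).V ≤ b * Fintype.card G.V + b * b := by
  have h : Fintype.card (pyr b G z).V = Fintype.card ((Fin b × G.V) ⊕ PyrPos b) :=
    Fintype.card_congr (Equiv.refl _)
  rw [h, Fintype.card_sum, Fintype.card_prod, Fintype.card_fin]
  have h2 := Fintype.card_subtype_le (fun p : Fin b × Fin b => 0 < p.1.val ∧ p.1.val + p.2.val < b)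
  rw [Fintype.card_prod, Fintype.card_fin] at h2
  exact Nat.add_le_add_left h2 _

theorem pyr_acyclic (h : G.Acyclic) : (pyr b G z).Acyclic := by
  have h1 : ∀ (p : PyrPos b) (w : (Fin b × G.V) ⊕ PyrPos b),
      Relation.TransGen (pyr b G z).edge (Sum.inr p) w →
      ∃ q, w = Sum.inr q ∧ p.1.1.val < q.1.1.val := by
    intro p w hw
    induction hw with
    | @single c e =>
      rcases c with c | c
      · exact e.elim
      · have := e.1
        exact ⟨c, rfl, by omega⟩
    | @tail c d _ e ih =>
      obtain ⟨q, rfl, hq⟩ := ih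
      rcases d with d | d
      · exact e.elim
      · have := e.1
        exact ⟨d, rfl, by omega⟩
  have h2 : ∀ (p : Fin b × G.V) (w : (Fin b × G.V) ⊕ PyrPos b),
      Relation.TransGen (pyr b G z).edge (Sum.inl p) w →
      ∀ q, w = Sum.inl q → Relation.TransGen G.edge p.2 q.2 := by
    intro p w hw
    induction hw with
    | @single c e =>
      rintro q rfl
      exact Relation.TransGen.single e.2
    | @tail c d _ e ih =>
      rintro q rfl
      rcases c with c | c
      · exact (ih c rfl).tail e.2
      · exact e.elim
  intro v hv
  rcases v with v | v
  · exact h _ (h2 v _ hv v rfl)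
  · obtain ⟨q, hq, hlt⟩ := h1 v _ hv
    cases hq
    omega

/-- The apex. -/
def pyrTop (hb : 2 ≤ b) : PyrPos b :=
  ⟨(⟨b - 1, by omega⟩, ⟨0, by omega⟩), by dsimp only; omega, by dsimp only; omega⟩

/-- Position in row `r`, column `j`. -/
def pyrPos (r j : ℕ) (h0 : 0 < r) (h : r + j < b) : PyrPos b :=
  ⟨(⟨r, by omega⟩, ⟨j, by omega⟩), h0, h⟩

theorem pyr_sink (hb : 2 ≤ b) (hz : G.UniqueSink z) :
    (pyr b G z).UniqueSink (Sum.inr (pyrTop hb) : (Fin b × G.V) ⊕ PyrPos b) := by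
  refine ⟨?_, ?_⟩
  · intro u hu
    rcases u with u | u
    · exact hu
    · have h1 : u.1.1.val = b - 1 + 1 := hu.1
      have := u.1.1.isLt
      omega
  · intro w hw
    rcases w with ⟨i, u⟩ | ⟨⟨⟨r, hr⟩, ⟨j, hj⟩⟩, h0, h⟩
    · exfalso
      have hu : u = z := hz.2 u fun u' hu' => hw (Sum.inl (i, u')) ⟨rfl, hu'⟩
      have hi := i.isLt
      by_cases h : i.val + 1 < b
      · exact hw (Sum.inr (pyrPos 1 i.val (by omega) (by omega))) ⟨hu, rfl, Or.inl rfl⟩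
      · refine hw (Sum.inr (pyrPos 1 (i.val - 1) (by omega) (by omega))) ⟨hu, rfl, Or.inr ?_⟩
        show i.val = i.val - 1 + 1
        omega
    · dsimp only at h0 h
      by_cases hrb : r = b - 1
      · have : j = 0 := by omega
        subst this; subst hrb; rfl
      · exfalso
        by_cases h' : r + 1 + j < b
        · exact hw (Sum.inr (pyrPos (r + 1) j (by omega) h')) ⟨rfl, Or.inl rfl⟩
        · refine hw (Sum.inr (pyrPos (r + 1) (j - 1) (by omega) (by omega))) ⟨rfl, Or.inr ?_⟩
          show j = j - 1 + 1
          omega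

theorem ncard_le_two_of_inj {α : Type} (s : Set α) (f : α → ℕ) (k : ℕ)
    (hf : ∀ x ∈ s, f x = k ∨ f x = k + 1) (hi : Set.InjOn f s) : s.ncard ≤ 2 := by
  have h1 : (f '' s).ncard = s.ncard := hi.ncard_image
  have h2 : f '' s ⊆ {k, k + 1} := by
    rintro _ ⟨x, hx, rfl⟩
    exact hf x hx
  rw [← h1]
  exact le_trans (Set.ncard_le_ncard h2 (Set.toFinite _)) (Set.ncard_insert_le _ _ |>.trans (by rw [Set.ncard_singleton]))

theorem pyr_indeg (h : G.InDegLe2) : (pyr b G z).InDegLe2 := by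
  intro v
  rcases v with ⟨i, v⟩ | q
  · have : {u : (pyr b G z).V | (pyr b G z).edge u (Sum.inl (i, v) : (Fin b × G.V) ⊕ PyrPos b)} ⊆
        ((fun u => Sum.inl (i, u)) '' {u : G.V | G.edge u v} : Set ((Fin b × G.V) ⊕ PyrPos b)) := by
      intro u hu
      rcases u with ⟨i', u⟩ | u
      · obtain ⟨h1, h2⟩ := hu
        dsimp only at h1 h2
        subst h1
        exact ⟨u, h2, rfl⟩
      · exact hu.elim
    refine le_trans (Set.ncard_le_ncard this (Set.toFinite _)) ?_
    exact le_trans (Set.ncard_image_le (Set.toFinite _)) (h v)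
  · refine ncard_le_two_of_inj _ (fun u : (Fin b × G.V) ⊕ PyrPos b => match u with
      | Sum.inl p => p.1.val
      | Sum.inr p => p.1.2.val) q.1.2.val ?_ ?_
    · intro u hu
      rcases u with u | u
      · exact hu.2.2
      · exact hu.2
    · intro u hu u' hu' he
      rcases u with ⟨i, u⟩ | ⟨⟨⟨r, hr⟩, ⟨j, hj⟩⟩, h0, h⟩ <;>
        rcases u' with ⟨i', u'⟩ | ⟨⟨⟨r', hr'⟩, ⟨j', hj'⟩⟩, h0', h'⟩
      · have e1 : u = z := hu.1
        have e2 : u' = z := hu'.1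
        have e3 : i = i' := Fin.ext he
        rw [e1, e2, e3]
      · have e1 : q.1.1.val = 1 := hu.2.1
        have e2 : q.1.1.val = r' + 1 := hu'.1
        dsimp only at h0'
        omega
      · have e1 : q.1.1.val = 1 := hu'.2.1
        have e2 : q.1.1.val = r + 1 := hu.1
        dsimp only at h0
        omega
      · have e1 : q.1.1.val = r + 1 := hu.1
        have e2 : q.1.1.val = r' + 1 := hu'.1
        have e3 : j = j' := he
        have e4 : r = r' := by omega
        subst e3; subst e4; rfl

/-- Row and column of a vertex. -/
def pyrNode (v : (Fin b × G.V) ⊕ PyrPos b) : ℕ × ℕ := match v with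
  | Sum.inl p => (0, p.1.val)
  | Sum.inr p => (p.1.1.val, p.1.2.val)

/-! #### Lower bound -/

/-- The part of a configuration in copy `i`. -/
def pyrPart (P : Finset ((Fin b × G.V) ⊕ PyrPos b)) (i : Fin b) : Finset G.V :=
  Finset.univ.filter fun u => Sum.inl (i, u) ∈ P

theorem mem_pyrPart {P : Finset ((Fin b × G.V) ⊕ PyrPos b)} {i : Fin b} {u : G.V} :
    u ∈ pyrPart P i ↔ Sum.inl (i, u) ∈ P := by
  simp [pyrPart]

theorem pyrPart_step {P P' : Finset ((Fin b × G.V) ⊕ PyrPos b)} (i : Fin b)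
    (h : (pyr b G z).StdStep P P') :
    pyrPart P' i = pyrPart P i ∨ G.StdStep (pyrPart P i) (pyrPart P' i) := by
  rcases h with ⟨v, hv, hp, rfl⟩ | ⟨v, hv, rfl⟩
  · by_cases hvi : ∃ u, v = Sum.inl (i, u)
    · obtain ⟨u, rfl⟩ := hvi
      refine Or.inr (Or.inl ⟨u, fun h => hv (mem_pyrPart.1 h), ?_, ?_⟩)
      · intro w hw
        exact mem_pyrPart.2 (hp (Sum.inl (i, w)) ⟨rfl, hw⟩)
      · ext w
        refine mem_pyrPart.trans (Finset.mem_insert.trans ?_)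
        refine Iff.trans ?_ Finset.mem_insert.symm
        refine or_congr ?_ mem_pyrPart.symm
        constructor
        · intro h; cases h; rfl
        · rintro rfl; rfl
    · refine Or.inl ?_
      ext w
      rw [mem_pyrPart, mem_pyrPart]
      refine Finset.mem_insert.trans (or_iff_right ?_)
      intro h; exact hvi ⟨w, h.symm⟩
  · by_cases hvi : ∃ u, v = Sum.inl (i, u)
    · obtain ⟨u, rfl⟩ := hvi
      refine Or.inr (Or.inr ⟨u, mem_pyrPart.2 hv, ?_⟩)
      ext w
      refine mem_pyrPart.trans (Finset.mem_erase.trans ?_)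
      refine Iff.trans ?_ Finset.mem_erase.symm
      refine and_congr (not_congr ?_) mem_pyrPart.symm
      constructor
      · intro h; cases h; rfl
      · rintro rfl; rfl
    · refine Or.inl ?_
      ext w
      rw [mem_pyrPart, mem_pyrPart]
      refine Finset.mem_erase.trans (and_iff_right ?_)
      intro h; exact hvi ⟨w, h.symm⟩

/-- Occupied positions; a copy counts as one position. -/
def pyrOcc (P : Finset ((Fin b × G.V) ⊕ PyrPos b)) (r c : ℕ) : Prop :=
  ∃ v ∈ P, pyrNode v = (r, c)

theorem pyr_card_ge (hb : 0 < b) (P : Finset ((Fin b × G.V) ⊕ PyrPos b))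
    (hS : ∀ π, PyrPath b π → ∃ r < b, pyrOcc P r (π r)) (π : ℕ → ℕ) (hπ : PyrPath b π)
    (hopen : ∀ r, 0 < r → r < b → ¬ pyrOcc P r (π r)) (i : Fin b) (hi : i.val = π 0) :
    (pyrPart P i).card + (b - 1) ≤ P.card := by
  classical
  have key := pyr_blocking b hb (pyrOcc P) hS π hπ hopen
  have key2 : ∀ j, ∃ v, j < b → j ≠ π 0 → v ∈ P ∧
      (((pyrNode v).2 = j ∧ (pyrNode v).2 < π (pyrNode v).1) ∨
        ((pyrNode v).2 + (pyrNode v).1 = j ∧ π (pyrNode v).1 < (pyrNode v).2)) := by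
    intro j
    by_cases h : j < b ∧ j ≠ π 0
    · obtain ⟨r, c, ⟨v, hv, hn⟩, hrc⟩ := key j h.1 h.2
      refine ⟨v, fun _ _ => ⟨hv, ?_⟩⟩
      rw [hn]; exact hrc
    · have : Nonempty ((Fin b × G.V) ⊕ PyrPos b) := by
        obtain ⟨r, _, v, _⟩ := hS π hπ
        exact ⟨v⟩
      exact ⟨Classical.choice this, fun h1 h2 => absurd ⟨h1, h2⟩ h⟩
  choose f hf using key2
  set A := P.filter fun v => pyrNode v = (0, π 0) with hA
  set C := P.filter fun v => ¬ pyrNode v = (0, π 0) with hC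
  have hsum : A.card + C.card = P.card := Finset.card_filter_add_card_filter_not _
  have h1 : (pyrPart P i).card ≤ A.card := by
    refine Finset.card_le_card_of_injOn (fun u => Sum.inl (i, u)) ?_ ?_
    · intro u hu
      have := mem_pyrPart.1 hu
      simp only [hA, Finset.coe_filter, Set.mem_ofPred_eq]
      exact ⟨this, by simp [pyrNode, hi]⟩
    · intro u _ w _ h
      simpa using h
  have h2 : b - 1 ≤ C.card := by
    have hcard : ((Finset.range b).erase (π 0)).card = b - 1 := by
      rw [Finset.card_erase_of_mem (Finset.mem_range.2 (by rw [← hi]; exact i.isLt)),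
        Finset.card_range]
    rw [← hcard]
    refine Finset.card_le_card_of_injOn f ?_ ?_
    · intro j hj
      have hj' := Finset.mem_erase.1 hj
      obtain ⟨a1, a2⟩ := hf j (Finset.mem_range.1 hj'.2) hj'.1
      simp only [hC, Finset.coe_filter, Set.mem_ofPred_eq]
      refine ⟨a1, fun hn => ?_⟩
      rw [hn] at a2
      dsimp only at a2
      omega
    · intro j hj k hk hjk
      have hj' := Finset.mem_erase.1 hj
      have hk' := Finset.mem_erase.1 hk
      obtain ⟨_, a2⟩ := hf j (Finset.mem_range.1 hj'.2) hj'.1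
      obtain ⟨_, b2⟩ := hf k (Finset.mem_range.1 hk'.2) hk'.1
      rw [← hjk] at b2
      omega
  omega

theorem pyr_path_empty {P : ℕ → Finset ((Fin b × G.V) ⊕ PyrPos b)} {τ T : ℕ}
    (hP : (pyr b G z).IsStdPebbling P τ) {π : ℕ → ℕ} (hπ : PyrPath b π)
    (hT : ∀ r, 0 < r → r < b → ¬ pyrOcc (P T) r (π r)) (i : Fin b) (hi : i.val = π 0) :
    ∀ d, T + d ≤ τ → (∀ d' < d, Sum.inl (i, z) ∉ P (T + d')) →
      ∀ r, 0 < r → r < b → ¬ pyrOcc (P (T + d)) r (π r) := by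
  intro d
  induction d with
  | zero => intro _ _; exact hT
  | succ d ih =>
    intro hd hz r hr0 hrb hocc
    have ih' := ih (by omega) (fun d' hd' => hz d' (by omega))
    obtain ⟨v, hv, hn⟩ := hocc
    rcases hP.2 (T + d) (by omega) with ⟨w, hw, hp, he⟩ | ⟨w, hw, he⟩
    · rw [← Nat.add_assoc, he] at hv
      rcases Finset.mem_insert.1 hv with rfl | hv
      · rcases v with v | q
        · have : (0 : ℕ) = r := congrArg Prod.fst hn
          omega
        · have e1 : q.1.1.val = r := congrArg Prod.fst hn
          have e2 : q.1.2.val = π r := congrArg Prod.snd hn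
          have hs := hπ.2 (r - 1) (by omega)
          rw [show r - 1 + 1 = r by omega] at hs
          by_cases h1 : r = 1
          · subst h1
            simp only [Nat.sub_self] at hs
            exact hz d (by omega) (hp (Sum.inl (i, z)) ⟨rfl, e1, by dsimp only; omega⟩)
          · have hbd := hπ.bound (r - 1) (by omega)
            refine ih' (r - 1) (by omega) (by omega)
              ⟨Sum.inr (pyrPos (r - 1) (π (r - 1)) (by omega) (by omega)), ?_, rfl⟩
            refine hp _ ⟨?_, ?_⟩
            · show q.1.1.val = r - 1 + 1
              omega
            · show π (r - 1) = q.1.2.val ∨ π (r - 1) = q.1.2.val + 1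
              omega
      · exact ih' r hr0 hrb ⟨v, hv, hn⟩
    · rw [← Nat.add_assoc, he] at hv
      exact ih' r hr0 hrb ⟨v, Finset.mem_of_mem_erase hv, hn⟩

theorem pyr_lower (hb : 2 ≤ b) (hz : 0 < G.black z)
    {P : ℕ → Finset ((Fin b × G.V) ⊕ PyrPos b)} {τ : ℕ}
    (hP : (pyr b G z).IsStdPebbling P τ) (hτ : Sum.inr (pyrTop hb) ∈ P τ) :
    ∃ t ≤ τ, G.black z + (b - 1) ≤ (P t).card := by
  classical
  set Op : ℕ → Prop := fun t => ∃ π, PyrPath b π ∧ ∀ r < b, ¬ pyrOcc (P t) r (π r) with hOp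
  have hOp0 : Op 0 := by
    refine ⟨fun r => 0, ⟨rfl, fun _ _ => Or.inl rfl⟩, ?_⟩
    rintro r _ ⟨v, hv, _⟩
    have h0 : P 0 = ∅ := hP.1
    rw [h0] at hv
    exact absurd hv (Finset.notMem_empty _)
  obtain ⟨T, hTτ, hT, hTmax⟩ : ∃ T ≤ τ, Op T ∧ ∀ t, T < t → t ≤ τ → ¬ Op t :=
    ⟨Nat.findGreatest Op τ, Nat.findGreatest_le _, Nat.findGreatest_spec (Nat.zero_le _) hOp0,
      fun t h1 h2 => Nat.findGreatest_is_greatest h1 h2⟩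
  obtain ⟨π, hπ, hopen⟩ := hT
  have hb0 := hπ.bound 0 (by omega)
  obtain ⟨i, hi⟩ : ∃ i : Fin b, i.val = π 0 := ⟨⟨π 0, by omega⟩, rfl⟩
  have hempty := pyr_path_empty hP hπ (fun r _ hr => hopen r hr) i hi
  have hex : ∃ d, T + d ≤ τ ∧ Sum.inl (i, z) ∈ P (T + d) := by
    by_contra hc
    push Not at hc
    refine hempty (τ - T) (by omega) (fun d' hd' => hc d' (by omega)) (b - 1) (by omega)
      (by omega) ?_
    rw [show T + (τ - T) = τ by omega, hπ.1]
    exact ⟨_, hτ, rfl⟩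
  obtain ⟨d1, ⟨hd1, hzd⟩, hmin⟩ : ∃ d, (T + d ≤ τ ∧ Sum.inl (i, z) ∈ P (T + d)) ∧
      ∀ d' < d, ¬ (T + d' ≤ τ ∧ Sum.inl (i, z) ∈ P (T + d')) :=
    ⟨Nat.find hex, Nat.find_spec hex, fun d' hd' => Nat.find_min hex hd'⟩
  have hTempty : pyrPart (P T) i = ∅ := by
    rw [Finset.eq_empty_iff_forall_notMem]
    intro u hu
    exact hopen 0 (by omega) ⟨_, mem_pyrPart.1 hu, by simp [pyrNode, hi]⟩
  obtain ⟨d, hd, hcd⟩ : ∃ d ≤ d1, G.black z ≤ (pyrPart (P (T + d)) i).card := by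
    by_contra hc
    push Not at hc
    have hreach : ∀ d ≤ d1, G.Reach_s5 (G.black z - 1) (pyrPart (P (T + d)) i) := by
      intro d
      induction d with
      | zero => intro _; rw [Nat.add_zero, hTempty]; exact Reach_s5.nil
      | succ d ih =>
        intro hd
        have h1 := ih (by omega)
        rcases pyrPart_step i (hP.2 (T + d) (by omega)) with h | h
        · rw [← Nat.add_assoc, h]; exact h1
        · have := hc (d + 1) hd
          exact Reach_s5.step h1 h (Nat.le_sub_one_of_lt this)
    have := black_le_of_reach (hreach d1 le_rfl) (mem_pyrPart.2 hzd)
    omega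
  have hdpos : 0 < d := by
    rcases Nat.eq_zero_or_pos d with h | h
    · subst h
      rw [Nat.add_zero, hTempty] at hcd
      simp at hcd
      omega
    · exact h
  refine ⟨T + d, by omega, ?_⟩
  have hblk : ∀ π, PyrPath b π → ∃ r < b, pyrOcc (P (T + d)) r (π r) := by
    intro ρ hρ
    by_contra hc
    push Not at hc
    exact hTmax (T + d) (by omega) (by omega) ⟨ρ, hρ, hc⟩
  have := pyr_card_ge (by omega) (P (T + d)) hblk π hπ
    (hempty d (by omega) fun d' hd' hm => hmin d' (by omega) ⟨by omega, hm⟩) i hi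
  omega

/-! #### Upper bound -/

/-- Sinks of the first `k` copies. -/
def pyrBase (b : ℕ) (z : G.V) (k : ℕ) : Finset ((Fin b × G.V) ⊕ PyrPos b) :=
  (Finset.univ.filter fun i : Fin b => i.val < k).image fun i => Sum.inl (i, z)

theorem mem_pyrBase {k : ℕ} {v : (Fin b × G.V) ⊕ PyrPos b} :
    v ∈ pyrBase b z k ↔ ∃ i : Fin b, i.val < k ∧ v = Sum.inl (i, z) := by
  simp [pyrBase, eq_comm]

theorem pyrBase_card (k : ℕ) : (pyrBase b z k).card ≤ k := by
  refine le_trans Finset.card_image_le ?_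
  rw [← Finset.card_range k]
  refine Finset.card_le_card_of_injOn (fun i => i.val) ?_ ?_
  · intro i hi
    simpa using hi
  · intro i _ j _ h
    exact Fin.ext h

theorem pyr_base_reach (hz : 0 < G.black z) :
    ∀ k ≤ b, (pyr b G z).Reach_s5 (b + G.black z - 1) (pyrBase b z k) := by
  intro k
  induction k with
  | zero =>
    intro _
    have : pyrBase b z 0 = ∅ := by
      rw [Finset.eq_empty_iff_forall_notMem]
      intro v hv
      obtain ⟨i, hi, _⟩ := mem_pyrBase.1 hv
      omega
    rw [this]; exact Reach_s5.nil
  | succ k ih =>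
    intro hk
    have h1 := ih (by omega)
    have h2 : ∀ Q, G.Reach_s5 (G.black z) Q → (pyr b G z).Reach_s5 (b + G.black z - 1)
        (pyrBase b z k ∪ Q.image fun u => Sum.inl ((⟨k, hk⟩ : Fin b), u)) := by
      intro Q hQ
      have hnot : ∀ u, (Sum.inl ((⟨k, hk⟩ : Fin b), u) : (Fin b × G.V) ⊕ PyrPos b) ∉
          pyrBase b z k := by
        intro u hu
        obtain ⟨i, hi, he⟩ := mem_pyrBase.1 hu
        cases he
        simp at hi
      have hinj : ∀ u w : G.V, (Sum.inl ((⟨k, hk⟩ : Fin b), u) : (Fin b × G.V) ⊕ PyrPos b) =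
          Sum.inl ((⟨k, hk⟩ : Fin b), w) → u = w := by
        intro u w h; simpa using h
      induction hQ with
      | nil => simpa using h1
      | @step Q Q' _ hs hc ih2 =>
        refine Reach_s5.step ih2 ?_ ?_
        · rcases hs with ⟨v, hv, hp, rfl⟩ | ⟨v, hv, rfl⟩
          · refine Or.inl ⟨Sum.inl ((⟨k, hk⟩ : Fin b), v), ?_, ?_, ?_⟩
            · intro hm
              rcases Finset.mem_union.1 hm with hm | hm
              · exact hnot _ hm
              · obtain ⟨w, hw, he⟩ := Finset.mem_image.1 hm
                exact hv (hinj _ _ he ▸ hw)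
            · intro u hu
              rcases u with ⟨i, u⟩ | u
              · obtain ⟨e1, e2⟩ := hu
                dsimp only at e1 e2
                subst e1
                exact Finset.mem_union_right _ (Finset.mem_image.2 ⟨u, hp u e2, rfl⟩)
              · exact hu.elim
            · rw [Finset.image_insert, Finset.union_insert]
          · refine Or.inr ⟨Sum.inl ((⟨k, hk⟩ : Fin b), v),
              Finset.mem_union_right _ (Finset.mem_image.2 ⟨v, hv, rfl⟩), ?_⟩
            rw [Finset.image_erase (fun u w h => hinj u w h)]
            ext x
            refine Iff.trans ?_ Finset.mem_erase.symm
            rw [Finset.mem_union, Finset.mem_erase]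
            refine Iff.trans ?_ (and_congr_right fun _ => Finset.mem_union.symm)
            constructor
            · rintro (h | ⟨h, h'⟩)
              · refine ⟨?_, Or.inl h⟩
                rintro rfl; exact hnot _ h
              · exact ⟨h, Or.inr h'⟩
            · rintro ⟨h, h' | h'⟩
              · exact Or.inl h'
              · exact Or.inr ⟨h, h'⟩
        · refine le_trans (Finset.card_union_le _ _) ?_
          have a1 := pyrBase_card (b := b) (z := z) k
          have a2 : (Q'.image fun u =>
            (Sum.inl ((⟨k, hk⟩ : Fin b), u) : (Fin b × G.V) ⊕ PyrPos b)).card ≤ Q'.card :=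
            Finset.card_image_le
          omega
    refine (h2 {z} (reach_of_pos hz)).subset ?_
    intro v hv
    obtain ⟨i, hi, rfl⟩ := mem_pyrBase.1 hv
    by_cases h : i.val < k
    · exact Finset.mem_union_left _ (mem_pyrBase.2 ⟨i, h, rfl⟩)
    · have : i = ⟨k, hk⟩ := Fin.ext (by simp; omega)
      subst this
      exact Finset.mem_union_right _ (by simp)

/-- Row `r + 1` up to column `k`, and row `r` from column `k` on. -/
def pyrLayer (b : ℕ) (z : G.V) (r k : ℕ) : Finset ((Fin b × G.V) ⊕ PyrPos b) :=
  Finset.univ.filter fun v => (∀ p, v = Sum.inl p → p.2 = z) ∧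
    (((pyrNode v).1 = r + 1 ∧ (pyrNode v).2 < k) ∨ ((pyrNode v).1 = r ∧ k ≤ (pyrNode v).2))

theorem mem_pyrLayer {r k : ℕ} {v : (Fin b × G.V) ⊕ PyrPos b} :
    v ∈ pyrLayer b z r k ↔ (∀ p, v = Sum.inl p → p.2 = z) ∧
    (((pyrNode v).1 = r + 1 ∧ (pyrNode v).2 < k) ∨ ((pyrNode v).1 = r ∧ k ≤ (pyrNode v).2)) := by
  simp only [pyrLayer, Finset.mem_filter, Finset.mem_univ, true_and]

theorem pyrNode_bound (v : (Fin b × G.V) ⊕ PyrPos b) : (pyrNode v).1 + (pyrNode v).2 < b := by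
  rcases v with ⟨i, u⟩ | q
  · simp [pyrNode]
  · exact q.2.2

theorem pyrNode_inj {v w : (Fin b × G.V) ⊕ PyrPos b} (hv : ∀ p, v = Sum.inl p → p.2 = z)
    (hw : ∀ p, w = Sum.inl p → p.2 = z) (h : pyrNode v = pyrNode w) : v = w := by
  rcases v with ⟨i, u⟩ | ⟨⟨⟨r, hr⟩, ⟨j, hj⟩⟩, h0, hh⟩ <;>
    rcases w with ⟨i', u'⟩ | ⟨⟨⟨r', hr'⟩, ⟨j', hj'⟩⟩, h0', hh'⟩
  · have e1 : u = z := hv _ rfl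
    have e2 : u' = z := hw _ rfl
    have e3 : i = i' := Fin.ext (congrArg Prod.snd h)
    rw [e1, e2, e3]
  · have : 0 = r' := congrArg Prod.fst h
    dsimp only at h0'
    omega
  · have : r = 0 := congrArg Prod.fst h
    dsimp only at h0
    omega
  · have e1 : r = r' := congrArg Prod.fst h
    have e2 : j = j' := congrArg Prod.snd h
    subst e1; subst e2; rfl

theorem pyrLayer_card (r k : ℕ) : (pyrLayer b z r k).card ≤ b := by
  refine le_of_le_of_eq ?_ (Finset.card_range b)
  refine Finset.card_le_card_of_injOn (fun v => (pyrNode v).2) ?_ ?_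
  · intro v _
    have := pyrNode_bound v
    simp only [Finset.coe_range, Set.mem_Iio]
    omega
  · intro v hv w hw h
    have hv' := mem_pyrLayer.1 hv
    have hw' := mem_pyrLayer.1 hw
    dsimp only at h
    refine pyrNode_inj hv'.1 hw'.1 (Prod.ext ?_ h)
    omega

theorem pyr_layer_step {s : ℕ} (hs : b + 1 ≤ s) (r k : ℕ) (hk : r + 1 + k < b)
    (h : (pyr b G z).Reach_s5 s (pyrLayer b z r k)) :
    (pyr b G z).Reach_s5 s (pyrLayer b z r (k + 1)) := by
  have hstep : (pyr b G z).Reach_s5 s (insert (Sum.inr (pyrPos (r + 1) k (by omega) hk))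
      (pyrLayer b z r k) : Finset ((Fin b × G.V) ⊕ PyrPos b)) := by
    refine Reach_s5.step h (Or.inl ⟨Sum.inr (pyrPos (r + 1) k (by omega) hk), ?_, ?_, rfl⟩) ?_
    · intro hm
      have := (mem_pyrLayer.1 hm).2
      simp only [pyrNode, pyrPos] at this
      omega
    · intro u hu
      refine mem_pyrLayer.2 ?_
      rcases u with ⟨i, u⟩ | u
      · obtain ⟨e1, e2, e3⟩ := hu
        have e2' : r + 1 = 1 := e2
        have e3' : i.val = k ∨ i.val = k + 1 := e3
        refine ⟨?_, Or.inr ⟨?_, ?_⟩⟩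
        · rintro p hp; cases hp; exact e1
        · show 0 = r
          omega
        · show k ≤ i.val
          omega
      · obtain ⟨e2, e3⟩ := hu
        have e2' : r + 1 = u.1.1.val + 1 := e2
        have e3' : u.1.2.val = k ∨ u.1.2.val = k + 1 := e3
        refine ⟨?_, Or.inr ⟨?_, ?_⟩⟩
        · rintro p hp; cases hp
        · show u.1.1.val = r
          omega
        · show k ≤ u.1.2.val
          omega
    · refine le_trans (Finset.card_insert_le _ _) ?_
      have := pyrLayer_card (b := b) (z := z) r k
      omega
  refine hstep.subset ?_
  intro v hv
  obtain ⟨h1, h2⟩ := mem_pyrLayer.1 hv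
  by_cases he : (pyrNode v).1 = r + 1 ∧ (pyrNode v).2 = k
  · refine Finset.mem_insert.2 (Or.inl ?_)
    exact pyrNode_inj h1 (by rintro p hp; cases hp) (Prod.ext he.1 he.2)
  · refine Finset.mem_insert.2 (Or.inr (mem_pyrLayer.2 ⟨h1, ?_⟩))
    omega

theorem pyr_layer_row {s : ℕ} (hs : b + 1 ≤ s) (r : ℕ)
    (h : (pyr b G z).Reach_s5 s (pyrLayer b z r 0)) : ∀ k, r + k < b →
    (pyr b G z).Reach_s5 s (pyrLayer b z r k) := by
  intro k
  induction k with
  | zero => intro _; exact h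
  | succ k ih => intro hk; exact pyr_layer_step hs r k (by omega) (ih (by omega))

theorem pyr_layer_all {s : ℕ} (hs : b + 1 ≤ s)
    (h : (pyr b G z).Reach_s5 s (pyrLayer b z 0 0)) : ∀ r, r < b →
    (pyr b G z).Reach_s5 s (pyrLayer b z r 0) := by
  intro r
  induction r with
  | zero => intro _; exact h
  | succ r ih =>
    intro hr
    refine (pyr_layer_row hs r (ih (by omega)) (b - r - 1) (by omega)).subset ?_
    intro v hv
    obtain ⟨h1, h2⟩ := mem_pyrLayer.1 hv
    have := pyrNode_bound v
    refine mem_pyrLayer.2 ⟨h1, ?_⟩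
    omega

theorem pyr_upper (hb : 2 ≤ b) (hz : 2 ≤ G.black z) :
    (pyr b G z).Reach_s5 (b + G.black z - 1)
      ({Sum.inr (pyrTop hb)} : Finset ((Fin b × G.V) ⊕ PyrPos b)) := by
  have h0 : (pyr b G z).Reach_s5 (b + G.black z - 1) (pyrLayer b z 0 0) := by
    refine (pyr_base_reach (by omega) b le_rfl).subset ?_
    intro v hv
    obtain ⟨h1, h2⟩ := mem_pyrLayer.1 hv
    rcases v with ⟨i, u⟩ | q
    · have : u = z := h1 _ rfl
      subst this
      exact mem_pyrBase.2 ⟨i, i.isLt, rfl⟩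
    · have h3 := q.2.1
      simp only [pyrNode] at h2
      omega
  refine (pyr_layer_all (by omega) h0 (b - 1) (by omega)).subset ?_
  intro v hv
  rw [Finset.mem_singleton] at hv
  subst hv
  refine mem_pyrLayer.2 ⟨(by rintro p hp; cases hp), Or.inr ⟨rfl, Nat.zero_le _⟩⟩

theorem pyr_black (hb : 2 ≤ b) (hz : 2 ≤ G.black z) :
    (pyr b G z).black (Sum.inr (pyrTop hb) : (Fin b × G.V) ⊕ PyrPos b) = b + G.black z - 1 := by
  have hr := pyr_upper hb hz
  apply le_antisymm
  · exact black_le_of_reach hr (Finset.mem_singleton_self _)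
  · obtain ⟨P, τ, hP, hτ, hs⟩ := black_attained hr
    rw [← hs]
    obtain ⟨t, ht, hc⟩ := pyr_lower hb (by omega) hP (by rw [hτ]; exact Finset.mem_singleton_self _)
    have : (P t).card ≤ (pyr b G z).space P τ :=
      Finset.le_sup (f := fun t => (P t).card) (Finset.mem_range.2 (by omega))
    have h3 : G.black z + (b - 1) ≤ (pyr b G z).space P τ := le_trans hc this
    omega

end

end Dgraph

/-- Product construction for standard pebbling (Theorem `th:blowupblack`). -/
theorem blowup_standard
    (G₁ G₂ : Dgraph) (h₁ : G₁.Acyclic) (h₂ : G₂.Acyclic)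
    (z₁ : G₁.V) (z₂ : G₂.V) (hz₁ : G₁.UniqueSink z₁) (hz₂ : G₂.UniqueSink z₂)
    (hd₁ : G₁.InDegLe2) (hd₂ : G₂.InDegLe2)
    (hb₁ : 3 ≤ G₁.black z₁) (hb₂ : 3 ≤ G₂.black z₂) :
    ∃ (B : Dgraph) (zB : B.V),
      B.Acyclic ∧ B.UniqueSink zB ∧ B.InDegLe2 ∧
      Fintype.card B.V = Fintype.card G₁.V * (2 * Fintype.card G₁.V + Fintype.card G₂.V) ∧
      B.black zB = G₁.black z₁ + G₂.black z₂ - 1 := by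
  have hle : G₁.black z₁ ≤ Fintype.card G₁.V := Dgraph.black_le_card (by omega)
  have hcard : Fintype.card (Dgraph.pyr (G₁.black z₁) G₂ z₂).V ≤
      Fintype.card G₁.V * (2 * Fintype.card G₁.V + Fintype.card G₂.V) := by
    refine le_trans Dgraph.pyr_card ?_
    nlinarith [Nat.mul_le_mul hle hle, Nat.mul_le_mul_right (Fintype.card G₂.V) hle]
  have hb : 2 ≤ G₁.black z₁ := by omega
  obtain ⟨B, zB, a, b, c, d, e⟩ := Dgraph.pad_many (G₁.black z₁ + G₂.black z₂ - 1) (by omega)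
    (Fintype.card G₁.V * (2 * Fintype.card G₁.V + Fintype.card G₂.V) -
      Fintype.card (Dgraph.pyr (G₁.black z₁) G₂ z₂).V)
    (Dgraph.pyr (G₁.black z₁) G₂ z₂) _ (Dgraph.pyr_acyclic h₂) (Dgraph.pyr_sink hb hz₂)
    (Dgraph.pyr_indeg hd₂) (Dgraph.pyr_black hb (by omega))
  exact ⟨B, zB, a, b, c, by omega, e⟩
end
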